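/- arXiv:math/0110134 — 4 statements merged into one kernel-verified Lean document; each statement's English description precedes it below -/
import Mathlib

section
/- Let (m_n) be a regular sequence and let h be a homogeneous Hamiltonian on T'ℝ^d which belongs to C(m_n, D) for every open set D with compact closure contained in T'ℝ^d, and whose flow Φ(t; y, η) = (x*(t; y, η), ξ*(t; y, η)) is complete. Let (y₀, η₀) ∈ T'ℝ^d be T-periodic for some T > 0, and assume that the d×d matrix ∂ξ*/∂η(T; y₀, η₀) is invertible. Then there exist an open neighborhood V of (y₀, η₀) in T'ℝ^d and a positive function t* : V → ℝ which belongs to C(m_n) on V and is positively homogeneous of degree 0 in η, such that: (1) t*(y₀, η₀) = T; (2) for (y, η) ∈ V, the gradient ∇_{y,η} t*(y, η) vanishes if and only if Φ(t*(y, η); y, η) = (y, η); (3) ∇_{y,η} t* vanishes to infinite order at a point (y, η) ∈ V if and only if (y, η) is absolutely t*(y, η)-periodic. -/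
open Real Set Filter MeasureTheory
open scoped BigOperators Topology

noncomputable section

/-- A sequence `(m n)` (indexed from 1) of positive reals is *regular* if it is nondecreasing,
grows faster than any power of `n`, satisfies `m (n+1) / m n ≤ n * C ^ n`, and
`n ↦ log (m n / n!)` is convex. -/
def RegularSeq (m : ℕ → ℝ) : Prop :=
  (∀ n : ℕ, 1 ≤ n → 0 < m n) ∧
  (∀ n : ℕ, 1 ≤ n → m n ≤ m (n + 1)) ∧
  (∀ k : ℕ, Filter.Tendsto (fun n : ℕ => m n / (n : ℝ) ^ k) Filter.atTop Filter.atTop) ∧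
  (∃ C : ℝ, 0 < C ∧ ∀ n : ℕ, 1 ≤ n → m (n + 1) / m n ≤ (n : ℝ) * C ^ n) ∧
  (∀ n : ℕ, 1 ≤ n →
    Real.log (m (n + 1) / (Nat.factorial (n + 1) : ℝ)) ≤
      (Real.log (m n / (Nat.factorial n : ℝ)) +
        Real.log (m (n + 2) / (Nat.factorial (n + 2) : ℝ))) / 2)

/-- `u` belongs to the Carleman class `C(m_n, D)`: it is `C^∞` on `D` and there is `C > 0`
with `‖∂^α u‖ ≤ C^{|α|} m_{|α|}` on `D` for every order `|α| ≥ 1`. -/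
def CarlemanClass {E F : Type*} [NormedAddCommGroup E] [NormedSpace ℝ E]
    [NormedAddCommGroup F] [NormedSpace ℝ F]
    (m : ℕ → ℝ) (D : Set E) (u : E → F) : Prop :=
  ContDiffOn ℝ (⊤ : ℕ∞) u D ∧
  ∃ C : ℝ, 0 < C ∧ ∀ n : ℕ, 1 ≤ n → ∀ x ∈ D,
    ‖iteratedFDerivWithin ℝ n u D x‖ ≤ C ^ n * m n

/-- The phase space `ℝ^d × ℝ^d`. -/
abbrev Phase (d : ℕ) := (Fin d → ℝ) × (Fin d → ℝ)

/-- `T'ℝ^d = ℝ^d × (ℝ^d ∖ {0})`. -/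
def Tprime (d : ℕ) : Set (Phase d) := {p | p.2 ≠ 0}

/-- The Hamiltonian vector field `(∂h/∂ξ, −∂h/∂x)` of `h`. -/
def hamField {d : ℕ} (h : Phase d → ℝ) (p : Phase d) : Phase d :=
  (fun j => fderiv ℝ h p (0, Pi.single j 1), fun j => - fderiv ℝ h p (Pi.single j 1, 0))

/-- `γ` solves Hamilton's equations `ẋ = h_ξ`, `ξ̇ = −h_x` on the set `I`. -/
def IsHamTrajOn {d : ℕ} (h : Phase d → ℝ) (γ : ℝ → Phase d) (I : Set ℝ) : Prop :=
  ∀ t ∈ I, HasDerivAt γ (hamField h (γ t)) t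

/-- `h` is a homogeneous Hamiltonian: smooth and positive on `T'ℝ^d`, and positively
homogeneous of degree 1 in `ξ`. -/
def HomHamiltonian {d : ℕ} (h : Phase d → ℝ) : Prop :=
  ContDiffOn ℝ (⊤ : ℕ∞) h (Tprime d) ∧
  (∀ p ∈ Tprime d, 0 < h p) ∧
  (∀ p ∈ Tprime d, ∀ c : ℝ, 0 < c → h (p.1, c • p.2) = c * h p)

/-- `Φ` is the complete flow of `h` on `T'ℝ^d`: it is smooth in `(t, y, η)`, starts at the
identity, stays in `T'ℝ^d`, solves Hamilton's equations for all time, and is the unique such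
trajectory through each point. -/
def IsCompleteFlow {d : ℕ} (h : Phase d → ℝ) (Φ : ℝ → Phase d → Phase d) : Prop :=
  ContDiffOn ℝ (⊤ : ℕ∞) (fun q : ℝ × Phase d => Φ q.1 q.2) (Set.univ ×ˢ Tprime d) ∧
  ∀ p ∈ Tprime d,
    Φ 0 p = p ∧ (∀ t : ℝ, Φ t p ∈ Tprime d) ∧
    IsHamTrajOn h (fun t => Φ t p) Set.univ ∧
    (∀ γ : ℝ → Phase d, γ 0 = p → (∀ t : ℝ, γ t ∈ Tprime d) →
      IsHamTrajOn h γ Set.univ → γ = fun t => Φ t p)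

/-- The function `(y, η) ↦ |x*(T; y, η) − y|² + |ξ*(T; y, η) − η|²`. -/
def periodDefect {d : ℕ} (Φ : ℝ → Phase d → Phase d) (T : ℝ) (p : Phase d) : ℝ :=
  (∑ j, ((Φ T p).1 j - p.1 j) ^ 2) + (∑ j, ((Φ T p).2 j - p.2 j) ^ 2)

/-- `p₀ ∈ T'ℝ^d` is absolutely `T`-periodic: the period defect vanishes to infinite
order at `p₀`. -/
def AbsPeriodic {d : ℕ} (Φ : ℝ → Phase d → Phase d) (T : ℝ) (p₀ : Phase d) : Prop :=
  p₀ ∈ Tprime d ∧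
  ∀ n : ℕ, iteratedFDerivWithin ℝ n (periodDefect Φ T) (Tprime d) p₀ = 0

open scoped ContDiff

lemma aux_iteratedDeriv_poly (P : Polynomial ℝ) (n : ℕ) :
    iteratedDeriv n (fun x => P.eval x) = fun x => (Polynomial.derivative^[n] P).eval x := by
  induction n with
  | zero => simp
  | succ n ih =>
    rw [iteratedDeriv_succ, ih]
    funext x
    rw [Polynomial.deriv, Function.iterate_succ_apply']

lemma aux_iteratedDeriv_poly_zero (P : Polynomial ℝ) (n : ℕ) :
    iteratedDeriv n (fun x => P.eval x) 0 = (n.factorial : ℝ) * P.coeff n := by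
  rw [aux_iteratedDeriv_poly]
  simp only
  rw [← Polynomial.coeff_zero_eq_eval_zero, Polynomial.coeff_iterate_derivative]
  simp [Nat.descFactorial_self]

lemma aux_sum_ofp (Q P : Polynomial ℝ) (hP : P.coeff 0 = 0) (n : ℕ) :
    ∑ c : OrderedFinpartition n, ((c.length.factorial : ℝ) * Q.coeff c.length) *
      ∏ i, (((c.partSize i).factorial : ℝ) * P.coeff (c.partSize i))
      = (n.factorial : ℝ) * (Q.comp P).coeff n := by
  have h := iteratedDeriv_comp_eq_sum_orderedFinpartition (𝕜 := ℝ) (g := fun x => Q.eval x)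
    (f := fun x => P.eval x) (x := 0) (n := ⊤) (i := n) (by exact Q.contDiff_aeval .. |>.contDiffAt)
    (by exact P.contDiff_aeval .. |>.contDiffAt) (by exact_mod_cast le_top)
  have h0 : P.eval 0 = 0 := by rw [← Polynomial.coeff_zero_eq_eval_zero, hP]
  simp only [h0, aux_iteratedDeriv_poly_zero] at h
  rw [← h, ← aux_iteratedDeriv_poly_zero]
  congr 1
  funext x
  simp [Polynomial.eval_comp]

lemma aux_sum_inv_sq (n : ℕ) : ∑ k ∈ Finset.range n, (1 : ℝ) / ((k : ℝ) + 1) ^ 2 ≤ 2 := by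
  have : ∀ n : ℕ, ∑ k ∈ Finset.range n, (1 : ℝ) / ((k : ℝ) + 1) ^ 2 ≤ 2 - 1 / (n : ℝ) := by
    intro n
    induction n with
    | zero => simp
    | succ n ih =>
      rw [Finset.sum_range_succ]
      rcases Nat.eq_zero_or_pos n with rfl | hn1
      · norm_num
      have hn1 : (1 : ℝ) ≤ n := by exact_mod_cast hn1
      push_cast
      have : 1 / ((n : ℝ) + 1) ^ 2 ≤ 1 / n - 1 / (n + 1) := by
        rw [div_sub_div _ _ (by positivity) (by positivity), div_le_div_iff₀ (by positivity) (by positivity)]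
        nlinarith
      linarith
  have h2 := this n
  have : (0 : ℝ) ≤ 1 / (n : ℝ) := by positivity
  linarith

lemma aux_sum_inv_sq' (n : ℕ) : ∑ k ∈ Finset.range (n + 1), (1 : ℝ) / (k : ℝ) ^ 2 ≤ 2 := by
  rw [Finset.sum_range_succ']
  simpa using aux_sum_inv_sq n

lemma aux_conv (n : ℕ) :
    ∑ x ∈ Finset.HasAntidiagonal.antidiagonal n, (1 : ℝ) / (x.1 : ℝ) ^ 2 * (1 / (x.2 : ℝ) ^ 2) ≤ 8 / (n : ℝ) ^ 2 := by
  rcases Nat.eq_zero_or_pos n with rfl | hn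
  · simp
  have hn' : (0 : ℝ) < n := by exact_mod_cast hn
  have key : ∀ x ∈ Finset.HasAntidiagonal.antidiagonal n, (1 : ℝ) / (x.1 : ℝ) ^ 2 * (1 / (x.2 : ℝ) ^ 2) ≤
      2 / (n : ℝ) ^ 2 * (1 / (x.1 : ℝ) ^ 2 + 1 / (x.2 : ℝ) ^ 2) := by
    intro x hx
    rw [Finset.HasAntidiagonal.mem_antidiagonal] at hx
    rcases Nat.eq_zero_or_pos x.1 with h1 | h1
    · rw [h1]; simp; positivity
    rcases Nat.eq_zero_or_pos x.2 with h2 | h2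
    · rw [h2]; simp; positivity
    have h1' : (0 : ℝ) < x.1 := by exact_mod_cast h1
    have h2' : (0 : ℝ) < x.2 := by exact_mod_cast h2
    have hx' : (n : ℝ) = x.1 + x.2 := by rw [← hx]; push_cast; ring
    rw [hx', div_add_div _ _ (by positivity) (by positivity), div_mul_div_comm, div_mul_div_comm,
      div_le_div_iff₀ (by positivity) (by positivity)]
    have : 0 ≤ ((x.1 : ℝ) ^ 2 * (x.2 : ℝ) ^ 2) * ((x.1 : ℝ) - x.2) ^ 2 := by positivity
    nlinarith
  refine (Finset.sum_le_sum key).trans ?_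
  rw [← Finset.mul_sum, Finset.sum_add_distrib]
  have e1 : ∑ x ∈ Finset.HasAntidiagonal.antidiagonal n, (1 : ℝ) / (x.1 : ℝ) ^ 2 ≤ 2 := by
    rw [Finset.Nat.sum_antidiagonal_eq_sum_range_succ_mk]
    exact aux_sum_inv_sq' n
  have e2 : ∑ x ∈ Finset.HasAntidiagonal.antidiagonal n, (1 : ℝ) / (x.2 : ℝ) ^ 2 ≤ 2 := by
    rw [← Finset.Nat.sum_antidiagonal_swap]
    exact e1
  calc 2 / (n : ℝ) ^ 2 * (_ + _) ≤ 2 / (n : ℝ) ^ 2 * (2 + 2) := by gcongr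
    _ = 8 / (n : ℝ) ^ 2 := by ring

lemma aux_coeff_pow (P : Polynomial ℝ) (ε R : ℝ) (hε : 0 ≤ ε) (hR : 0 ≤ R)
    (h0 : ∀ k, 0 ≤ P.coeff k) (h1 : ∀ k, P.coeff k ≤ ε * R ^ k * (1 / (k : ℝ) ^ 2)) (j : ℕ) :
    ∀ n, 0 ≤ (P ^ (j + 1)).coeff n ∧
      (P ^ (j + 1)).coeff n ≤ 8 ^ j * ε ^ (j + 1) * R ^ n * (1 / (n : ℝ) ^ 2) := by
  induction j with
  | zero => intro n; simpa using And.intro (h0 n) (by simpa using h1 n)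
  | succ j ih =>
    intro n
    rw [pow_succ, Polynomial.coeff_mul]
    refine ⟨Finset.sum_nonneg fun x _ => mul_nonneg (ih _).1 (h0 _), ?_⟩
    calc _ ≤ ∑ x ∈ Finset.HasAntidiagonal.antidiagonal n, (8 ^ j * ε ^ (j + 1) * R ^ x.1 * (1 / (x.1 : ℝ) ^ 2)) *
          (ε * R ^ x.2 * (1 / (x.2 : ℝ) ^ 2)) := by
          refine Finset.sum_le_sum fun x _ => ?_
          exact mul_le_mul (ih _).2 (h1 _) (h0 _) (by positivity)
      _ = ∑ x ∈ Finset.HasAntidiagonal.antidiagonal n, (8 ^ j * ε ^ (j + 1 + 1) * R ^ n) *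
          ((1 / (x.1 : ℝ) ^ 2) * (1 / (x.2 : ℝ) ^ 2)) := by
          refine Finset.sum_congr rfl fun x hx => ?_
          rw [← Finset.HasAntidiagonal.mem_antidiagonal.1 hx, pow_add R]
          ring
      _ ≤ (8 ^ j * ε ^ (j + 1 + 1) * R ^ n) * (8 / (n : ℝ) ^ 2) := by
          rw [← Finset.mul_sum]
          exact mul_le_mul_of_nonneg_left (aux_conv n) (by positivity)
      _ = _ := by ring

lemma aux_geom (x : ℝ) (hx : 0 ≤ x) (hx' : x ≤ 1 / 2) (n : ℕ) :
    ∑ j ∈ Finset.range n, x ^ (j + 2) ≤ 2 * x ^ 2 := by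
  have : ∀ n : ℕ, ∑ j ∈ Finset.range n, x ^ j ≤ 2 := by
    intro n
    have h := geom_sum_mul x n
    have h3 : 0 ≤ x ^ n := by positivity
    have h2 : 0 ≤ ∑ j ∈ Finset.range n, x ^ j := Finset.sum_nonneg fun i _ => by positivity
    nlinarith
  simp only [pow_add]
  rw [← Finset.sum_mul]
  exact mul_le_mul_of_nonneg_right (this n) (by positivity)

/-- analytic majorant -/
lemma ofp_analytic_bound (n : ℕ) (C ε R : ℝ) (hC : 0 ≤ C) (hε : 0 ≤ ε) (hR : 0 ≤ R)
    (hs : 8 * (C * ε) ≤ 1 / 2) :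
    ∑ c : OrderedFinpartition n,
      (if 2 ≤ c.length then (c.length.factorial : ℝ) * C ^ c.length else 0) *
      ∏ i, (((c.partSize i).factorial : ℝ) * (ε * R ^ (c.partSize i) * (1 / (c.partSize i : ℝ) ^ 2)))
      ≤ (n.factorial : ℝ) * (16 * (C * ε) ^ 2 * (R ^ n * (1 / (n : ℝ) ^ 2))) := by
  let Q : Polynomial ℝ := ∑ j ∈ Finset.range n, Polynomial.monomial (j + 2) (C ^ (j + 2))
  let P : Polynomial ℝ := ∑ k ∈ Finset.range n,
    Polynomial.monomial (k + 1) (ε * R ^ (k + 1) * (1 / ((k + 1 : ℕ) : ℝ) ^ 2))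
  have hPc : ∀ k, P.coeff k = if k ≤ n then ε * R ^ k * (1 / (k : ℝ) ^ 2) else 0 := by
    intro k
    simp only [P, Polynomial.finsetSum_coeff, Polynomial.coeff_monomial]
    rcases k with _ | k
    · simp
    · simp
  have hQc : ∀ k, k ≤ n → Q.coeff k = if 2 ≤ k then C ^ k else 0 := by
    intro k hk
    simp only [Q, Polynomial.finsetSum_coeff, Polynomial.coeff_monomial]
    rcases k with _ | _ | k
    · simp
    · simp
    · have : k < n := by omega
      simp [this]
  have h := aux_sum_ofp Q P (by simp [hPc]) n
  have e : ∑ c : OrderedFinpartition n,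
      (if 2 ≤ c.length then (c.length.factorial : ℝ) * C ^ c.length else 0) *
      ∏ i, (((c.partSize i).factorial : ℝ) * (ε * R ^ (c.partSize i) * (1 / (c.partSize i : ℝ) ^ 2)))
      = (n.factorial : ℝ) * (Q.comp P).coeff n := by
    rw [← h]
    refine Finset.sum_congr rfl fun c _ => ?_
    rw [hQc _ c.length_le]
    congr 1
    · split_ifs <;> simp
    · refine Finset.prod_congr rfl fun i _ => ?_
      rw [hPc, if_pos (c.partSize_le i)]
  rw [e]
  refine mul_le_mul_of_nonneg_left ?_ (by positivity)
  have hcomp : (Q.comp P).coeff n = ∑ j ∈ Finset.range n, C ^ (j + 2) * (P ^ (j + 2)).coeff n := by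
    simp only [Q, Polynomial.sum_comp, Polynomial.monomial_comp, Polynomial.finsetSum_coeff,
      Polynomial.coeff_C_mul]
  rw [hcomp]
  have hpow := aux_coeff_pow P ε R hε hR (fun k => by rw [hPc]; split_ifs <;> positivity)
    (fun k => by rw [hPc]; split_ifs <;> first | exact le_rfl | positivity)
  calc _ ≤ ∑ j ∈ Finset.range n, (8 * (C * ε)) ^ (j + 2) * (1 / 8 * (R ^ n * (1 / (n : ℝ) ^ 2))) := by
        refine Finset.sum_le_sum fun j _ => ?_
        calc _ ≤ C ^ (j + 2) * (8 ^ (j + 1) * ε ^ (j + 1 + 1) * R ^ n * (1 / (n : ℝ) ^ 2)) :=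
              mul_le_mul_of_nonneg_left (hpow (j + 1) n).2 (by positivity)
          _ = _ := by rw [mul_pow, mul_pow]; ring
    _ ≤ 2 * (8 * (C * ε)) ^ 2 * (1 / 8 * (R ^ n * (1 / (n : ℝ) ^ 2))) := by
        rw [← Finset.sum_mul]
        exact mul_le_mul_of_nonneg_right (aux_geom _ (by positivity) hs n) (by positivity)
    _ = _ := by ring

section regular
variable {m : ℕ → ℝ}

/-- normalised sequence -/
def nrm (m : ℕ → ℝ) (n : ℕ) : ℝ := m n / (n.factorial : ℝ)

lemma nrm_pos (hm : RegularSeq m) {n : ℕ} (hn : 1 ≤ n) : 0 < nrm m n :=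
  div_pos (hm.1 n hn) (by positivity)

lemma nrm_mul (m : ℕ → ℝ) (n : ℕ) : (n.factorial : ℝ) * nrm m n = m n := by
  unfold nrm; field_simp

lemma nrm_convex (hm : RegularSeq m) {n : ℕ} (hn : 1 ≤ n) :
    nrm m (n + 1) * nrm m (n + 1) ≤ nrm m n * nrm m (n + 2) := by
  have h := hm.2.2.2.2 n hn
  change Real.log (nrm m (n + 1)) ≤ (Real.log (nrm m n) + Real.log (nrm m (n + 2))) / 2 at h
  have h1 := nrm_pos hm (n := n + 1) (by omega)
  have h0 := nrm_pos hm hn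
  have h2 := nrm_pos hm (n := n + 2) (by omega)
  rw [← Real.log_le_log_iff (by positivity) (by positivity), Real.log_mul h1.ne' h1.ne',
    Real.log_mul h0.ne' h2.ne']
  linarith

lemma nrm_ratio (hm : RegularSeq m) {i : ℕ} (hi : 1 ≤ i) (k : ℕ) :
    nrm m (i + 1) * nrm m (i + k) ≤ nrm m i * nrm m (i + k + 1) := by
  induction k with
  | zero => simp [mul_comm]
  | succ k ih =>
    have h := nrm_convex hm (n := i + k) (by omega)
    have p0 := nrm_pos hm hi
    have p1 := nrm_pos hm (n := i + 1) (by omega)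
    have p2 := nrm_pos hm (n := i + k) (by omega)
    have p3 := nrm_pos hm (n := i + k + 1) (by omega)
    have p4 := nrm_pos hm (n := i + k + 2) (by omega)
    change nrm m (i + 1) * nrm m (i + k + 1) ≤ nrm m i * nrm m (i + k + 2)
    have : nrm m (i + 1) * nrm m (i + k + 1) * nrm m (i + k) ≤
        nrm m i * nrm m (i + k + 2) * nrm m (i + k) := by
      calc _ = (nrm m (i + 1) * nrm m (i + k)) * nrm m (i + k + 1) := by ring
        _ ≤ (nrm m i * nrm m (i + k + 1)) * nrm m (i + k + 1) := by gcongr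
        _ = nrm m i * (nrm m (i + k + 1) * nrm m (i + k + 1)) := by ring
        _ ≤ nrm m i * (nrm m (i + k) * nrm m (i + k + 2)) := by gcongr
        _ = _ := by ring
    exact le_of_mul_le_mul_right this p2

lemma nrm_mul_le (hm : RegularSeq m) {a : ℕ} (ha : 1 ≤ a) (b : ℕ) :
    nrm m a * nrm m (b + 1) ≤ nrm m 1 * nrm m (a + b) := by
  induction b with
  | zero => simp [mul_comm]
  | succ b ih =>
    have p1 := nrm_pos hm (n := b + 1) (by omega)
    have p2 := nrm_pos hm (n := b + 1 + 1) (by omega)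
    have p3 := nrm_pos hm (n := a + b) (by omega)
    have p4 := nrm_pos hm (n := 1) le_rfl
    have p5 := nrm_pos hm (n := a + b + 1) (by omega)
    have hr : nrm m (b + 1 + 1) * nrm m (a + b) ≤ nrm m (b + 1) * nrm m (a + b + 1) := by
      have := nrm_ratio hm (i := b + 1) (by omega) (a - 1)
      rwa [show b + 1 + (a - 1) = a + b by omega] at this
    have : (nrm m a * nrm m (b + 1 + 1)) * nrm m (b + 1) * nrm m (a + b) ≤
       (nrm m 1 * nrm m (a + (b + 1))) * nrm m (b + 1) * nrm m (a + b) := by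
      calc _ = (nrm m a * nrm m (b + 1)) * (nrm m (b + 1 + 1) * nrm m (a + b)) := by ring
        _ ≤ (nrm m 1 * nrm m (a + b)) * (nrm m (b + 1) * nrm m (a + b + 1)) := by
          apply mul_le_mul ih hr <;> positivity
        _ = _ := by rw [← add_assoc]; ring
    exact le_of_mul_le_mul_right (le_of_mul_le_mul_right this p3) p1

lemma nrm_prod_le (hm : RegularSeq m) (j : ℕ) : ∀ k : Fin (j + 1) → ℕ, (∀ i, 1 ≤ k i) →
    nrm m (j + 1) * ∏ i, nrm m (k i) ≤ nrm m 1 ^ (j + 1) * nrm m (∑ i, k i) := by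
  induction j with
  | zero => intro k hk; simp
  | succ j ih =>
    intro k hk
    rw [Fin.prod_univ_succ, Fin.sum_univ_succ]
    have h1 := ih (fun i => k i.succ) (fun i => hk _)
    set s := ∑ i : Fin (j + 1), k i.succ with hs
    have hsj : j + 1 ≤ s := by
      have : ∑ i : Fin (j + 1), 1 ≤ s := Finset.sum_le_sum fun i _ => hk i.succ
      simpa using this
    set P := ∏ i : Fin (j + 1), nrm m (k i.succ) with hP
    have hPp : 0 < P := Finset.prod_pos fun i _ => nrm_pos hm (hk _)
    have p1 := nrm_pos hm (n := 1) le_rfl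
    have p2 := nrm_pos hm (n := j + 1) (by omega)
    have p3 := nrm_pos hm (n := j + 1 + 1) (by omega)
    have p4 := nrm_pos hm (n := s) (by omega)
    have p5 := nrm_pos hm (n := s + 1) (by omega)
    have p6 := nrm_pos hm (hk 0)
    have hr : nrm m (j + 1 + 1) * nrm m s ≤ nrm m (j + 1) * nrm m (s + 1) := by
      have := nrm_ratio hm (i := j + 1) (by omega) (s - (j + 1))
      rwa [show j + 1 + (s - (j + 1)) = s by omega] at this
    have hq : nrm m (k 0) * nrm m (s + 1) ≤ nrm m 1 * nrm m (k 0 + s) := nrm_mul_le hm (hk 0) s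
    have e1 : (nrm m (j + 1 + 1) * P) * nrm m s ≤ (nrm m 1 ^ (j + 1) * nrm m (s + 1)) * nrm m s := by
      calc _ = (nrm m (j + 1 + 1) * nrm m s) * P := by ring
        _ ≤ (nrm m (j + 1) * nrm m (s + 1)) * P := by gcongr
        _ = (nrm m (j + 1) * P) * nrm m (s + 1) := by ring
        _ ≤ (nrm m 1 ^ (j + 1) * nrm m s) * nrm m (s + 1) := by gcongr
        _ = _ := by ring
    have e2 := le_of_mul_le_mul_right e1 p4
    calc _ = (nrm m (j + 1 + 1) * P) * nrm m (k 0) := by ring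
      _ ≤ (nrm m 1 ^ (j + 1) * nrm m (s + 1)) * nrm m (k 0) := by gcongr
      _ = nrm m 1 ^ (j + 1) * (nrm m (k 0) * nrm m (s + 1)) := by ring
      _ ≤ nrm m 1 ^ (j + 1) * (nrm m 1 * nrm m (k 0 + s)) := by gcongr
      _ = _ := by ring

lemma m_ge_one (hm : RegularSeq m) {n : ℕ} (hn : 1 ≤ n) : m 1 ≤ m n := by
  induction n, hn using Nat.le_induction with
  | base => exact le_rfl
  | succ n hn ih => exact ih.trans (hm.2.1 n hn)

end regular

lemma ofp_sum_partSize {n : ℕ} (c : OrderedFinpartition n) : ∑ i, c.partSize i = n := by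
  have := c.sum_sigma_eq_sum (fun _ => 1)
  simpa using this

lemma ofp_partSize_lt {n : ℕ} (c : OrderedFinpartition n) (hc : 2 ≤ c.length) (i : Fin c.length) :
    c.partSize i < n := by
  have h := ofp_sum_partSize c
  obtain ⟨j, hj⟩ : ∃ j : Fin c.length, j ≠ i := by
    by_contra hcon
    push Not at hcon
    have h0 := hcon ⟨0, by omega⟩
    have h1 := hcon ⟨1, by omega⟩
    rw [← h1] at h0
    simp at h0
  have h2 : ∑ l ∈ {j, i}, c.partSize l ≤ ∑ l, c.partSize l :=
    Finset.sum_le_sum_of_subset (Finset.subset_univ _)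
  rw [Finset.sum_pair hj] at h2
  have := c.partSize_pos j
  omega


section core
variable {E F G : Type*} [NormedAddCommGroup E] [NormedSpace ℝ E]
    [NormedAddCommGroup F] [NormedSpace ℝ F] [NormedAddCommGroup G] [NormedSpace ℝ G]

lemma clm_iteratedFDeriv_zero (L : E →L[ℝ] F) {n : ℕ} (hn : 2 ≤ n) (x : E) :
    iteratedFDeriv ℝ n (fun y => L y) x = 0 := by
  obtain ⟨k, rfl⟩ : ∃ k, n = k + 1 + 1 := ⟨n - 2, by omega⟩
  rw [← norm_eq_zero, ← norm_iteratedFDeriv_fderiv]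
  have : fderiv ℝ (fun y => L y) = fun _ => L := by funext y; exact L.fderiv
  rw [this, iteratedFDeriv_const_of_ne (by omega)]
  simp

lemma nat_le_infty (n : ℕ) : (n : WithTop ℕ∞) ≤ ∞ := by exact_mod_cast le_top

/-- Core remainder estimate. -/
lemma core_rem {m : ℕ → ℝ} (hm : RegularSeq m) {g : F → G} {γ : E → F} {p : E}
    (hg : ContDiffAt ℝ ∞ g (γ p)) (hγ : ContDiffAt ℝ ∞ γ p) {C : ℝ} (hC : 0 ≤ C)
    (hgb : ∀ j, 1 ≤ j → ‖iteratedFDeriv ℝ j g (γ p)‖ ≤ C ^ j * m j)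
    {ε R : ℝ} (hε : 0 ≤ ε) (hR : 0 ≤ R) (hs : 8 * (C * nrm m 1 * ε) ≤ 1 / 2) {n : ℕ} (hn : 1 ≤ n)
    (hb : ∀ k, 1 ≤ k → k < n → ‖iteratedFDeriv ℝ k γ p‖ ≤ m k * (ε * R ^ k * (1 / (k : ℝ) ^ 2))) :
    ‖iteratedFDeriv ℝ n (g ∘ γ) p -
      (fderiv ℝ g (γ p)).compContinuousMultilinearMap (iteratedFDeriv ℝ n γ p)‖ ≤
      m n * (16 * (C * nrm m 1 * ε) ^ 2 * (R ^ n * (1 / (n : ℝ) ^ 2))) := by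
  have p1 := nrm_pos hm (n := 1) le_rfl
  set L := fderiv ℝ g (γ p) with hL
  have hLc : ContDiffAt ℝ ∞ (fun y => L y) (γ p) := L.contDiff.contDiffAt
  have e1 : L.compContinuousMultilinearMap (iteratedFDeriv ℝ n γ p) =
      iteratedFDeriv ℝ n ((fun y => L y) ∘ γ) p :=
    (L.iteratedFDeriv_comp_left hγ (nat_le_infty n)).symm
  have e2 : iteratedFDeriv ℝ n (g ∘ γ) p - iteratedFDeriv ℝ n ((fun y => L y) ∘ γ) p
      = iteratedFDeriv ℝ n ((g - fun y => L y) ∘ γ) p := by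
    rw [← iteratedFDeriv_sub_apply ((hg.comp p hγ).of_le (nat_le_infty n))
      ((hLc.comp p hγ).of_le (nat_le_infty n))]
    rfl
  have hgL : ContDiffAt ℝ ∞ (g - fun y => L y) (γ p) := hg.sub hLc
  rw [e1, e2, iteratedFDeriv_comp hgL hγ (nat_le_infty n)]
  unfold FormalMultilinearSeries.taylorComp
  have d1 : ‖iteratedFDeriv ℝ 1 (g - fun y => L y) (γ p)‖ = 0 := by
    rw [norm_iteratedFDeriv_one, fderiv_sub (hg.differentiableAt (by simp)) L.differentiableAt,
      L.fderiv, ← hL]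
    simp
  have d2 : ∀ j, 2 ≤ j → ‖iteratedFDeriv ℝ j (g - fun y => L y) (γ p)‖ ≤ C ^ j * m j := by
    intro j hj
    rw [iteratedFDeriv_sub_apply (hg.of_le (nat_le_infty j)) (hLc.of_le (nat_le_infty j)),
      clm_iteratedFDeriv_zero L hj, sub_zero]
    exact hgb j (by omega)
  refine (norm_sum_le _ _).trans ?_
  have key : ∀ c : OrderedFinpartition n,
      ‖FormalMultilinearSeries.compAlongOrderedFinpartition
        (ftaylorSeries ℝ (g - fun y => L y) (γ p)) (ftaylorSeries ℝ γ p) c‖ ≤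
      nrm m n * ((if 2 ≤ c.length then (c.length.factorial : ℝ) * (C * nrm m 1) ^ c.length else 0) *
      ∏ i, (((c.partSize i).factorial : ℝ) *
        (ε * R ^ (c.partSize i) * (1 / (c.partSize i : ℝ) ^ 2)))) := by
    intro c
    refine (c.norm_compAlongOrderedFinpartition_le _ _).trans ?_
    change ‖iteratedFDeriv ℝ c.length (g - fun y => L y) (γ p)‖ *
      ∏ i, ‖iteratedFDeriv ℝ (c.partSize i) γ p‖ ≤ _
    have hl := c.length_pos hn
    split_ifs with h2
    · calc _ ≤ (C ^ c.length * m c.length) *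
          ∏ i, (m (c.partSize i) * (ε * R ^ (c.partSize i) * (1 / (c.partSize i : ℝ) ^ 2))) := by
            apply mul_le_mul (d2 _ h2) _ (Finset.prod_nonneg fun _ _ => norm_nonneg _)
            · have := hm.1 c.length (by omega)
              positivity
            · exact Finset.prod_le_prod (fun _ _ => norm_nonneg _)
                fun i _ => hb _ (c.partSize_pos i) (ofp_partSize_lt c h2 i)
        _ = C ^ c.length * c.length.factorial * (nrm m c.length * ∏ i, nrm m (c.partSize i)) *
            ∏ i, (((c.partSize i).factorial : ℝ) *
              (ε * R ^ (c.partSize i) * (1 / (c.partSize i : ℝ) ^ 2))) := by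
            simp_rw [← nrm_mul m]
            rw [show (∏ i, (((c.partSize i).factorial : ℝ) * nrm m (c.partSize i) *
              (ε * R ^ (c.partSize i) * (1 / (c.partSize i : ℝ) ^ 2)))) =
              (∏ i, nrm m (c.partSize i)) * ∏ i, (((c.partSize i).factorial : ℝ) *
              (ε * R ^ (c.partSize i) * (1 / (c.partSize i : ℝ) ^ 2))) by
                rw [← Finset.prod_mul_distrib]
                exact Finset.prod_congr rfl fun i _ => by ring]
            ring
        _ ≤ C ^ c.length * c.length.factorial * (nrm m 1 ^ c.length * nrm m n) *
            ∏ i, (((c.partSize i).factorial : ℝ) *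
              (ε * R ^ (c.partSize i) * (1 / (c.partSize i : ℝ) ^ 2))) := by
            have hpn : nrm m c.length * ∏ i, nrm m (c.partSize i) ≤ nrm m 1 ^ c.length * nrm m n := by
              have hgen : ∀ l : ℕ, 1 ≤ l → ∀ k : Fin l → ℕ, (∀ i, 1 ≤ k i) →
                  nrm m l * ∏ i, nrm m (k i) ≤ nrm m 1 ^ l * nrm m (∑ i, k i) := by
                intro l hl k hk
                obtain ⟨j, rfl⟩ : ∃ j, l = j + 1 := ⟨l - 1, by omega⟩
                exact nrm_prod_le hm j k hk
              have := hgen c.length hl c.partSize c.partSize_pos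
              rwa [ofp_sum_partSize] at this
            have : 0 ≤ ∏ i, (((c.partSize i).factorial : ℝ) *
              (ε * R ^ (c.partSize i) * (1 / (c.partSize i : ℝ) ^ 2))) :=
                Finset.prod_nonneg fun i _ => by positivity
            gcongr
        _ = _ := by rw [mul_pow]; ring
    · have : c.length = 1 := by omega
      have h0 : ‖iteratedFDeriv ℝ c.length (g - fun y => L y) (γ p)‖ = 0 := by rw [this, d1]
      rw [h0]
      simp
  refine (Finset.sum_le_sum fun c _ => key c).trans ?_
  rw [← Finset.mul_sum]
  refine (mul_le_mul_of_nonneg_left (ofp_analytic_bound n (C * nrm m 1) ε R (by positivity) hε hR hs)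
    (nrm_pos hm hn).le).trans ?_
  rw [← nrm_mul m n]
  apply le_of_eq
  ring

end core

section car
variable {E F G : Type*} [NormedAddCommGroup E] [NormedSpace ℝ E]
    [NormedAddCommGroup F] [NormedSpace ℝ F] [NormedAddCommGroup G] [NormedSpace ℝ G]
variable {m : ℕ → ℝ}

/-- pointwise Carleman class on a set -/
def Car (m : ℕ → ℝ) (S : Set E) (u : E → F) : Prop :=
  (∀ x ∈ S, ContDiffAt ℝ ∞ u x) ∧
  ∃ C : ℝ, 0 < C ∧ ∀ n : ℕ, 1 ≤ n → ∀ x ∈ S, ‖iteratedFDeriv ℝ n u x‖ ≤ C ^ n * m n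

lemma Car.mono {S S' : Set E} {u : E → F} (h : Car m S u) (hs : S' ⊆ S) : Car m S' u :=
  ⟨fun x hx => h.1 x (hs hx), let ⟨C, hC, hb⟩ := h.2; ⟨C, hC, fun n hn x hx => hb n hn x (hs hx)⟩⟩

lemma carlemanClass_iff {D : Set E} (hD : IsOpen D) {u : E → F} :
    CarlemanClass m D u ↔ Car m D u := by
  unfold CarlemanClass Car
  refine and_congr ⟨fun h x hx => h.contDiffAt (hD.mem_nhds hx),
    fun h x hx => (h x hx).contDiffWithinAt⟩ ?_
  refine exists_congr fun C => and_congr Iff.rfl ?_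
  refine forall_congr' fun n => forall_congr' fun hn => forall_congr' fun x => forall_congr' fun hx => ?_
  rw [iteratedFDerivWithin_of_isOpen n hD hx]

lemma Car.of_bound (hm : RegularSeq m) {S : Set E} {u : E → F} (hu : ∀ x ∈ S, ContDiffAt ℝ ∞ u x)
    {A B : ℝ} (hA : 0 ≤ A) (hB : 0 < B)
    (hb : ∀ n : ℕ, 1 ≤ n → ∀ x ∈ S, ‖iteratedFDeriv ℝ n u x‖ ≤ A * B ^ n * m n) : Car m S u := by
  refine ⟨hu, (A + 1) * B, by positivity, fun n hn x hx => (hb n hn x hx).trans ?_⟩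
  have := hm.1 n hn
  rw [mul_pow]
  gcongr
  calc A ≤ A + 1 := by linarith
    _ ≤ (A + 1) ^ n := le_self_pow₀ (by linarith) (by omega)

lemma Car.of_bound' (hm : RegularSeq m) {S : Set E} {u : E → F} (hu : ∀ x ∈ S, ContDiffAt ℝ ∞ u x)
    {A : ℝ} (hA : 0 ≤ A)
    (hb : ∀ n : ℕ, 1 ≤ n → ∀ x ∈ S, ‖iteratedFDeriv ℝ n u x‖ ≤ A) : Car m S u := by
  have h1 := hm.1 1 le_rfl
  refine Car.of_bound hm hu (A := A / m 1) (B := 1) (by positivity) one_pos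
    fun n hn x hx => (hb n hn x hx).trans ?_
  rw [one_pow, mul_one, div_mul_eq_mul_div, le_div_iff₀ h1]
  exact mul_le_mul_of_nonneg_left (m_ge_one hm hn) hA

lemma Car.congr {S : Set E} {u v : E → F} (h : Car m S u) (huv : ∀ x ∈ S, v =ᶠ[𝓝 x] u) :
    Car m S v := by
  refine ⟨fun x hx => (h.1 x hx).congr_of_eventuallyEq (huv x hx), ?_⟩
  obtain ⟨C, hC, hb⟩ := h.2
  refine ⟨C, hC, fun n hn x hx => ?_⟩
  rw [((huv x hx).iteratedFDeriv (𝕜 := ℝ) n).eq_of_nhds]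
  exact hb n hn x hx

lemma Car.clm (hm : RegularSeq m) (S : Set E) (L : E →L[ℝ] F) : Car m S (fun x => L x) := by
  refine Car.of_bound' hm (fun x _ => L.contDiff.contDiffAt) (norm_nonneg L) fun n hn x _ => ?_
  rcases Nat.lt_or_ge n 2 with h | h
  · obtain rfl : n = 1 := by omega
    rw [norm_iteratedFDeriv_one, L.fderiv]
  · rw [clm_iteratedFDeriv_zero L h]; simp

lemma Car.bilin (hm : RegularSeq m) {S : Set (E × F)} (hS : Bornology.IsBounded S)
    (B : E →L[ℝ] F →L[ℝ] G) : Car m S (fun x => B x.1 x.2) := by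
  obtain ⟨r, hr⟩ := hS.exists_norm_le
  have hfd : fderiv ℝ (fun x : E × F => B x.1 x.2) = fun x => B.deriv₂ x := by
    funext x
    exact (B.isBoundedBilinearMap.hasFDerivAt x).fderiv
  have hcd : ContDiff ℝ ∞ (fun x : E × F => B x.1 x.2) := B.isBoundedBilinearMap.contDiff
  refine Car.of_bound' hm (A := ‖B.deriv₂‖ * (|r| + 1)) (fun x _ => hcd.contDiffAt)
    (by positivity) fun n hn x hx => ?_
  obtain ⟨k, rfl⟩ : ∃ k, n = k + 1 := ⟨n - 1, by omega⟩
  rw [← norm_iteratedFDeriv_fderiv, hfd]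
  rcases k with _ | _ | k
  · rw [norm_iteratedFDeriv_zero]
    refine (B.deriv₂.le_opNorm x).trans ?_
    gcongr
    linarith [hr x hx, le_abs_self r]
  · rw [zero_add, norm_iteratedFDeriv_one, B.deriv₂.fderiv]
    have : 0 ≤ |r| := abs_nonneg r
    nlinarith [norm_nonneg (B.deriv₂)]
  · rw [clm_iteratedFDeriv_zero _ (by omega)]
    simp; positivity

lemma Car.prodMk {S : Set E} {u : E → F} {v : E → G} (hm : RegularSeq m)
    (hu : Car m S u) (hv : Car m S v) : Car m S (fun x => (u x, v x)) := by
  refine ⟨fun x hx => (hu.1 x hx).prodMk (hv.1 x hx), ?_⟩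
  obtain ⟨C, hC, hb⟩ := hu.2
  obtain ⟨C', hC', hb'⟩ := hv.2
  refine ⟨max C C', by positivity, fun n hn x hx => ?_⟩
  rw [iteratedFDeriv_prodMk (hu.1 x hx) (hv.1 x hx) (nat_le_infty n),
    ContinuousMultilinearMap.opNorm_prod]
  have := hm.1 n hn
  refine max_le ((hb n hn x hx).trans ?_) ((hb' n hn x hx).trans ?_)
  · gcongr; exact le_max_left _ _
  · gcongr; exact le_max_right _ _

lemma Car.fderiv {S : Set E} {u : E → F} (hm : RegularSeq m) (hu : Car m S u) :
    Car m S (fun x => fderiv ℝ u x) := by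
  obtain ⟨C, hC, hb⟩ := hu.2
  obtain ⟨K, hK, hKb⟩ := hm.2.2.2.1
  refine Car.of_bound hm (A := C) (B := 2 * K * C) (fun x hx => (hu.1 x hx).fderiv_right (by simp)) hC.le
    (by positivity) fun n hn x hx => ?_
  have h1 := hm.1 n hn
  have h2 := hKb n hn
  rw [div_le_iff₀ h1] at h2
  have h3 := hb (n + 1) (by omega) x hx
  rw [← norm_iteratedFDeriv_fderiv] at h3
  refine h3.trans ?_
  calc C ^ (n + 1) * m (n + 1) ≤ C ^ (n + 1) * (n * K ^ n * m n) := by gcongr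
    _ ≤ C ^ (n + 1) * (2 ^ n * K ^ n * m n) := by
      gcongr
      exact_mod_cast (Nat.lt_two_pow_self (n := n)).le
    _ = _ := by rw [mul_pow, mul_pow]; ring

lemma aux_sq_le (k : ℕ) : (k : ℝ) ^ 2 ≤ 4 ^ k := by
  have h : (k : ℝ) ≤ 2 ^ k := by exact_mod_cast (Nat.lt_two_pow_self (n := k)).le
  calc (k : ℝ) ^ 2 ≤ (2 ^ k) ^ 2 := by gcongr
    _ = 4 ^ k := by rw [← pow_mul, mul_comm, pow_mul]; norm_num

lemma aux_eps (C ε : ℝ) (hC : 0 ≤ C) (hε : 0 < ε) {k : ℕ} (hk : 1 ≤ k) :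
    C ^ k ≤ ε * (4 * C * (1 + 1 / ε)) ^ k * (1 / (k : ℝ) ^ 2) := by
  have hk' : (0 : ℝ) < k := by exact_mod_cast hk
  rw [mul_one_div, le_div_iff₀ (by positivity), mul_pow, mul_pow]
  have h1 : 1 ≤ ε * (1 + 1 / ε) ^ k := by
    calc 1 ≤ ε * (1 + 1 / ε) := by rw [mul_add, mul_one_div_cancel hε.ne']; linarith
      _ ≤ ε * (1 + 1 / ε) ^ k := by
        gcongr
        exact le_self_pow₀ (by have : 0 < 1 / ε := by positivity
                               linarith) (by omega)
  calc C ^ k * (k : ℝ) ^ 2 ≤ C ^ k * 4 ^ k * 1 := by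
        rw [mul_one]; gcongr; exact aux_sq_le k
    _ ≤ C ^ k * 4 ^ k * (ε * (1 + 1 / ε) ^ k) := by gcongr
    _ = _ := by ring

lemma Car.comp {S : Set E} {g : F → G} {γ : E → F} (hm : RegularSeq m)
    (hg : Car m (γ '' S) g) (hγ : Car m S γ) : Car m S (fun x => g (γ x)) := by
  obtain ⟨C₁, hC₁, hb₁⟩ := hγ.2
  obtain ⟨C₂, hC₂, hb₂⟩ := hg.2
  have p1 := nrm_pos hm (n := 1) le_rfl
  have q1 := hm.1 1 le_rfl
  set ε : ℝ := 1 / (16 * (C₂ * nrm m 1)) with hε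
  have hεp : 0 < ε := by positivity
  have hCε : C₂ * nrm m 1 * ε = 1 / 16 := by rw [hε]; field_simp
  set R : ℝ := 4 * C₁ * (1 + 1 / ε) with hR
  have hRp : 0 < R := by positivity
  refine Car.of_bound hm (A := 1 + C₂ * m 1 * ε) (B := R)
    (fun x hx => (hg.1 _ (mem_image_of_mem _ hx)).comp x (hγ.1 x hx)) (by positivity) hRp
    fun n hn x hx => ?_
  have hb : ∀ k, 1 ≤ k → ‖iteratedFDeriv ℝ k γ x‖ ≤ m k * (ε * R ^ k * (1 / (k : ℝ) ^ 2)) := by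
    intro k hk
    refine (hb₁ k hk x hx).trans ?_
    rw [mul_comm]
    exact mul_le_mul_of_nonneg_left (aux_eps C₁ ε hC₁.le hεp hk) (hm.1 k hk).le
  have h := core_rem hm (hg.1 _ (mem_image_of_mem _ hx)) (hγ.1 x hx) hC₂.le
    (fun j hj => hb₂ j hj _ (mem_image_of_mem _ hx)) hεp.le hRp.le (by rw [hCε]; norm_num) hn
    (fun k hk _ => hb k hk)
  have hL : ‖(_root_.fderiv ℝ g (γ x)).compContinuousMultilinearMap (iteratedFDeriv ℝ n γ x)‖ ≤
      (C₂ * m 1) * (m n * (ε * R ^ n * (1 / (n : ℝ) ^ 2))) := by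
    refine (ContinuousLinearMap.norm_compContinuousMultilinearMap_le _ _).trans ?_
    gcongr
    · have := hb₂ 1 le_rfl _ (mem_image_of_mem _ hx)
      rwa [norm_iteratedFDeriv_one, pow_one] at this
    · exact hb n hn
  have hmn := hm.1 n hn
  have hn1 : 1 / (n : ℝ) ^ 2 ≤ 1 := by
    have : (1 : ℝ) ≤ n := by exact_mod_cast hn
    rw [div_le_one (by positivity)]
    exact one_le_pow₀ this
  have := norm_le_norm_sub_add (iteratedFDeriv ℝ n (g ∘ γ) x)
    ((_root_.fderiv ℝ g (γ x)).compContinuousMultilinearMap (iteratedFDeriv ℝ n γ x))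
  calc ‖iteratedFDeriv ℝ n (g ∘ γ) x‖ ≤ _ := this
    _ ≤ m n * (16 * (C₂ * nrm m 1 * ε) ^ 2 * (R ^ n * (1 / (n : ℝ) ^ 2))) +
      (C₂ * m 1) * (m n * (ε * R ^ n * (1 / (n : ℝ) ^ 2))) := add_le_add h hL
    _ ≤ m n * (16 * (C₂ * nrm m 1 * ε) ^ 2 * (R ^ n * 1)) +
      (C₂ * m 1) * (m n * (ε * R ^ n * 1)) := by gcongr
    _ = (1 / 16 + C₂ * m 1 * ε) * R ^ n * m n := by rw [hCε]; ring
    _ ≤ _ := by gcongr; norm_num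

end car

section flow
variable {E G : Type} [NormedAddCommGroup E] [NormedSpace ℝ E]
    [NormedAddCommGroup G] [NormedSpace ℝ G]

lemma comm_one {U : Set E} (hU : IsOpen U) {F F' : ℝ → E → G}
    (hF : ∀ t, ∀ q ∈ U, ContDiffAt ℝ ∞ (Function.uncurry F) (t, q))
    (hF' : ∀ t, ∀ q ∈ U, HasDerivAt (fun s => F s q) (F' t q) t) (t : ℝ) {p : E} (hp : p ∈ U) :
    HasDerivAt (fun s => fderiv ℝ (F s) p) (fderiv ℝ (F' t) p) t := by
  set W := Function.uncurry F with hW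
  have hdiff : ∀ t, ∀ q ∈ U, HasFDerivAt W (fderiv ℝ W (t, q)) (t, q) := fun t q hq =>
    ((hF t q hq).differentiableAt (by simp)).hasFDerivAt
  have e1 : ∀ t, ∀ q ∈ U, fderiv ℝ (F t) q = (fderiv ℝ W (t, q)).comp (ContinuousLinearMap.inr ℝ ℝ E) := by
    intro t q hq
    refine HasFDerivAt.fderiv ?_
    exact (hdiff t q hq).comp (f := fun q => (t, q)) q (hasFDerivAt_prodMk_right t q)
  have e2 : ∀ t, ∀ q ∈ U, F' t q = fderiv ℝ W (t, q) (1, 0) := by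
    intro t q hq
    refine (hF' t q hq).unique ?_
    have := (hdiff t q hq).comp (f := fun s => (s, q)) t (hasFDerivAt_prodMk_left t q)
    have h := this.hasDerivAt
    simp only [ContinuousLinearMap.comp_apply, ContinuousLinearMap.inl_apply] at h
    exact h
  have hd2 : HasFDerivAt (fderiv ℝ W) (fderiv ℝ (fderiv ℝ W) (t, p)) (t, p) :=
    (((hF t p hp).fderiv_right (m := ∞) (by simp)).differentiableAt (by simp)).hasFDerivAt
  have hsym : IsSymmSndFDerivAt ℝ W (t, p) := (hF t p hp).isSymmSndFDerivAt (by simpa using nat_le_infty 2)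
  have a1 : HasDerivAt (fun s => fderiv ℝ W (s, p)) (fderiv ℝ (fderiv ℝ W) (t, p) (1, 0)) t := by
    have := hd2.comp (f := fun s => (s, p)) t (hasFDerivAt_prodMk_left t p)
    have h := this.hasDerivAt
    simp only [ContinuousLinearMap.comp_apply, ContinuousLinearMap.inl_apply] at h
    exact h
  have a2 : HasFDerivAt (fun q => fderiv ℝ W (t, q))
      ((fderiv ℝ (fderiv ℝ W) (t, p)).comp (ContinuousLinearMap.inr ℝ ℝ E)) p :=
    hd2.comp (f := fun q => (t, q)) p (hasFDerivAt_prodMk_right t p)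
  have a3 : fderiv ℝ (F' t) p = (fderiv ℝ (fderiv ℝ W) (t, p) (1, 0)).comp (ContinuousLinearMap.inr ℝ ℝ E) := by
    have : F' t =ᶠ[𝓝 p] fun q => fderiv ℝ W (t, q) (1, 0) := by
      filter_upwards [hU.mem_nhds hp] with q hq using e2 t q hq
    rw [this.fderiv_eq, (a2.clm_apply (hasFDerivAt_const _ _)).fderiv]
    ext v
    simp [hsym (0, v) (1, 0)]
  have a4 : (fun s => fderiv ℝ (F s) p) = fun s => (fderiv ℝ W (s, p)).comp (ContinuousLinearMap.inr ℝ ℝ E) := by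
    funext s; exact e1 s p hp
  rw [a3, a4]
  exact ((ContinuousLinearMap.compL ℝ E (ℝ × E) G).flip
    (ContinuousLinearMap.inr ℝ ℝ E)).hasFDerivAt.comp_hasDerivAt t a1

lemma smooth_fderiv {U : Set E} {F : ℝ → E → G}
    (hF : ∀ t, ∀ q ∈ U, ContDiffAt ℝ ∞ (Function.uncurry F) (t, q)) :
    ∀ t, ∀ q ∈ U, ContDiffAt ℝ ∞ (Function.uncurry fun t q => fderiv ℝ (F t) q) (t, q) := by
  intro t q hq
  have h1 : ContDiffAt ℝ ∞ (Function.uncurry fun (z : ℝ × E) (w : E) => F z.1 w) ((t, q), q) := by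
    have := (hF t q hq).comp (f := fun z : (ℝ × E) × E => (z.1.1, z.2)) ((t, q), q)
      (by fun_prop)
    exact this
  have := ContDiffAt.fderiv (x₀ := (t, q)) (f := fun (z : ℝ × E) (w : E) => F z.1 w)
    (g := fun z : ℝ × E => z.2) (m := ∞) (n := ∞) h1 (by fun_prop) (by simp)
  exact this

lemma comm_n (n : ℕ) : ∀ {G : Type} [NormedAddCommGroup G] [NormedSpace ℝ G]
    {U : Set E} (_ : IsOpen U) {F F' : ℝ → E → G}
    (_ : ∀ t, ∀ q ∈ U, ContDiffAt ℝ ∞ (Function.uncurry F) (t, q))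
    (_ : ∀ t, ∀ q ∈ U, HasDerivAt (fun s => F s q) (F' t q) t) (t : ℝ) {p : E} (_ : p ∈ U),
    HasDerivAt (fun s => iteratedFDeriv ℝ n (F s) p) (iteratedFDeriv ℝ n (F' t) p) t := by
  induction n with
  | zero =>
    intro G _ _ U hU F F' hF hF' t p hp
    have h := (continuousMultilinearCurryFin0 ℝ E G).symm.toContinuousLinearEquiv.toContinuousLinearMap.hasFDerivAt.comp_hasDerivAt t (hF' t p hp)
    exact h
  | succ n ih =>
    intro G _ _ U hU F F' hF hF' t p hp
    have h := ih hU (smooth_fderiv hF) (F' := fun t q => fderiv ℝ (F' t) q)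
      (fun t q hq => comm_one hU hF hF' t hq) t hp
    simp only [iteratedFDeriv_succ_eq_comp_right]
    exact (continuousMultilinearCurryRightEquiv' ℝ n E G).symm.toContinuousLinearEquiv.toContinuousLinearMap.hasFDerivAt.comp_hasDerivAt t h
end flow

section flow2
variable {E : Type} [NormedAddCommGroup E] [NormedSpace ℝ E]

lemma slice_smooth {G : Type} [NormedAddCommGroup G] [NormedSpace ℝ G] {F : ℝ → E → G} {t : ℝ} {q : E}
    (hF : ContDiffAt ℝ ∞ (Function.uncurry F) (t, q)) : ContDiffAt ℝ ∞ (F t) q :=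
  hF.comp (f := fun q => (t, q)) q (by fun_prop)

lemma flow_car {m : ℕ → ℝ} (hm : RegularSeq m) {U : Set E} (hU : IsOpen U) {Y : E → E}
    (hYC : ∀ K ⊆ U, IsCompact K → Car m K Y) {Ψ : ℝ → E → E}
    (hΨ : ∀ t, ∀ q ∈ U, ContDiffAt ℝ ∞ (Function.uncurry Ψ) (t, q))
    (h0 : ∀ q ∈ U, Ψ 0 q = q) (hin : ∀ t, ∀ q ∈ U, Ψ t q ∈ U)
    (hd : ∀ t, ∀ q ∈ U, HasDerivAt (fun s => Ψ s q) (Y (Ψ t q)) t)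
    {K : Set E} (hK : IsCompact K) (hKU : K ⊆ U) : Car m K (Ψ 1) := by
  set K' : Set E := Function.uncurry Ψ '' (Icc (0 : ℝ) 1 ×ˢ K) with hK'
  have hK'c : IsCompact K' := by
    refine (isCompact_Icc.prod hK).image_of_continuousOn ?_
    rintro ⟨t, q⟩ ⟨_, hq⟩
    exact (hΨ t q (hKU hq)).continuousAt.continuousWithinAt
  have hK'U : K' ⊆ U := by
    rintro _ ⟨⟨t, q⟩, ⟨_, hq⟩, rfl⟩
    exact hin t q (hKU hq)
  obtain ⟨hYs, C, hC, hYb⟩ := hYC K' hK'U hK'c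
  have p1 := nrm_pos hm (n := 1) le_rfl
  have q1 := hm.1 1 le_rfl
  set a := C * nrm m 1 with ha
  have hap : 0 < a := by positivity
  set Lc := C * m 1 with hLc
  have hLp : 0 < Lc := by positivity
  have hel : 0 < Real.exp Lc := Real.exp_pos _
  set ε : ℝ := min (1 / (16 * a)) (Lc / (32 * a ^ 2 * Real.exp Lc)) with hε
  have hεp : 0 < ε := by positivity
  have hε1 : 8 * (a * ε) ≤ 1 / 2 := by
    have : ε ≤ 1 / (16 * a) := min_le_left _ _
    rw [le_div_iff₀ (by positivity)] at this
    linarith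
  have hε2 : 16 * (a * ε) ^ 2 / Lc * Real.exp Lc ≤ ε / 2 := by
    have : ε ≤ Lc / (32 * a ^ 2 * Real.exp Lc) := min_le_right _ _
    rw [le_div_iff₀ (by positivity)] at this
    rw [div_mul_eq_mul_div, div_le_iff₀ hLp]
    nlinarith
  set R : ℝ := 2 * Real.exp Lc / (m 1 * ε) with hR
  have hRp : 0 < R := by positivity
  have key : ∀ n : ℕ, 1 ≤ n → ∀ t ∈ Icc (0 : ℝ) 1, ∀ p ∈ K,
      ‖iteratedFDeriv ℝ n (Ψ t) p‖ ≤ m n * (ε * R ^ n * (1 / (n : ℝ) ^ 2)) := by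
    intro n
    induction n using Nat.strong_induction_on with
    | _ n ih =>
    intro hn t ht p hp
    have hmn := hm.1 n hn
    have hn0 : (0 : ℝ) < n := by exact_mod_cast hn
    set ρ : ℝ := m n * (16 * (a * ε) ^ 2 * (R ^ n * (1 / (n : ℝ) ^ 2))) with hρ
    have hρp : 0 ≤ ρ := by positivity
    have hder : ∀ s : ℝ, HasDerivAt (fun s => iteratedFDeriv ℝ n (Ψ s) p)
        (iteratedFDeriv ℝ n (fun q => Y (Ψ s q)) p) s := fun s =>
      comm_n n hU hΨ (F' := fun t q => Y (Ψ t q)) hd s (hKU hp)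
    have hG := norm_le_gronwallBound_of_norm_deriv_right_le (a := 0) (b := 1)
      (f := fun s => iteratedFDeriv ℝ n (Ψ s) p) (K := Lc) (ε := ρ)
      (δ := ‖iteratedFDeriv ℝ n (Ψ 0) p‖)
      (fun s _ => (hder s).continuousAt.continuousWithinAt)
      (fun s _ => (hder s).hasDerivWithinAt) le_rfl
      (by
        intro s hs
        have hs' : s ∈ Icc (0 : ℝ) 1 := ⟨hs.1, hs.2.le⟩
        have hmem : Ψ s p ∈ K' := ⟨(s, p), ⟨hs', hp⟩, rfl⟩
        have h1 := core_rem hm (hYs _ hmem) (slice_smooth (hΨ s p (hKU hp))) hC.le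
          (fun j hj => hYb j hj _ hmem) hεp.le hRp.le hε1 hn
          (fun k hk hkn => ih k hkn hk s hs' p hp)
        have h2 : ‖(fderiv ℝ Y (Ψ s p)).compContinuousMultilinearMap (iteratedFDeriv ℝ n (Ψ s) p)‖ ≤
            Lc * ‖iteratedFDeriv ℝ n (Ψ s) p‖ := by
          refine (ContinuousLinearMap.norm_compContinuousMultilinearMap_le _ _).trans ?_
          gcongr
          have := hYb 1 le_rfl _ hmem
          rwa [norm_iteratedFDeriv_one, pow_one] at this
        have h3 := norm_le_norm_sub_add (iteratedFDeriv ℝ n (Y ∘ Ψ s) p)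
          ((fderiv ℝ Y (Ψ s p)).compContinuousMultilinearMap (iteratedFDeriv ℝ n (Ψ s) p))
        calc ‖iteratedFDeriv ℝ n (Y ∘ Ψ s) p‖ ≤ _ := h3
          _ ≤ ρ + Lc * ‖iteratedFDeriv ℝ n (Ψ s) p‖ := add_le_add h1 h2
          _ = _ := by ring) t ht
    rw [gronwallBound_of_K_ne_0 hLp.ne', sub_zero] at hG
    have hexp : Real.exp (Lc * t) ≤ Real.exp Lc := by
      apply Real.exp_le_exp.2
      nlinarith [ht.2]
    have h0' : ‖iteratedFDeriv ℝ n (Ψ 0) p‖ * Real.exp Lc ≤ m n * (ε / 2 * R ^ n * (1 / (n : ℝ) ^ 2)) := by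
      have he : Ψ 0 =ᶠ[𝓝 p] fun q => ContinuousLinearMap.id ℝ E q := by
        filter_upwards [hU.mem_nhds (hKU hp)] with q hq using h0 q hq
      rw [((he.iteratedFDeriv (𝕜 := ℝ)) n).eq_of_nhds]
      rcases Nat.lt_or_ge n 2 with h | h
      · obtain rfl : n = 1 := by omega
        rw [norm_iteratedFDeriv_one, ContinuousLinearMap.fderiv]
        have hid := ContinuousLinearMap.norm_id_le (𝕜 := ℝ) (E := E)
        calc ‖ContinuousLinearMap.id ℝ E‖ * Real.exp Lc ≤ 1 * Real.exp Lc := by gcongr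
          _ = _ := by rw [hR]; field_simp; simp
      · rw [clm_iteratedFDeriv_zero _ h]
        simp only [norm_zero, zero_mul]
        positivity
    calc ‖iteratedFDeriv ℝ n (Ψ t) p‖ ≤ _ := hG
      _ ≤ ‖iteratedFDeriv ℝ n (Ψ 0) p‖ * Real.exp Lc + ρ / Lc * Real.exp Lc := by
        refine add_le_add (mul_le_mul_of_nonneg_left hexp (norm_nonneg _))
          (mul_le_mul_of_nonneg_left (by linarith) (by positivity))
      _ ≤ m n * (ε / 2 * R ^ n * (1 / (n : ℝ) ^ 2)) + m n * (ε / 2 * R ^ n * (1 / (n : ℝ) ^ 2)) := by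
        refine add_le_add h0' ?_
        calc ρ / Lc * Real.exp Lc
            = m n * (16 * (a * ε) ^ 2 / Lc * Real.exp Lc * R ^ n * (1 / (n : ℝ) ^ 2)) := by
              rw [hρ]; ring
          _ ≤ _ := by gcongr
      _ = _ := by ring
  refine Car.of_bound hm (A := ε) (B := R) (fun p hp => slice_smooth (hΨ 1 p (hKU hp))) hεp.le hRp
    fun n hn p hp => (key n hn 1 ⟨zero_le_one, le_rfl⟩ p hp).trans ?_
  have hmn := hm.1 n hn
  have hn1 : 1 / (n : ℝ) ^ 2 ≤ 1 := by
    have : (1 : ℝ) ≤ n := by exact_mod_cast hn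
    rw [div_le_one (by positivity)]
    exact one_le_pow₀ this
  calc m n * (ε * R ^ n * (1 / (n : ℝ) ^ 2)) ≤ m n * (ε * R ^ n * 1) := by gcongr
    _ = _ := by ring

/-- implicit function estimate -/
lemma implicit_car {m : ℕ → ℝ} (hm : RegularSeq m) {V : Set E} (hV : IsOpen V) {F : E × ℝ → ℝ}
    {τ : E → ℝ} (hτ : ∀ q ∈ V, ContDiffAt ℝ ∞ τ q) (h0 : ∀ q ∈ V, F (q, τ q) = 0)
    (hFC : ∀ K ⊆ V, IsCompact K → Car m ((fun q => (q, τ q)) '' K) F)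
    (hFt : ∀ q ∈ V, fderiv ℝ F (q, τ q) (0, 1) ≠ 0)
    {K : Set E} (hK : IsCompact K) (hKV : K ⊆ V) : Car m K τ := by
  obtain ⟨hFs, C, hC, hFb⟩ := hFC K hKV hK
  rcases K.eq_empty_or_nonempty with rfl | hne
  · exact ⟨by simp, 1, one_pos, by simp⟩
  have hγs : ∀ q ∈ V, ContDiffAt ℝ ∞ (fun q => (q, τ q)) q := fun q hq =>
    contDiffAt_id.prodMk (hτ q hq)
  have hcont : ContinuousOn (fun q => fderiv ℝ F (q, τ q) (0, 1)) K := by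
    intro q hq
    have h1 : ContinuousAt (fderiv ℝ F) (q, τ q) :=
      ((hFs _ (mem_image_of_mem _ hq)).fderiv_right (m := ∞) (by simp)).continuousAt
    have h2 : ContinuousAt (fun q => fderiv ℝ F (q, τ q)) q :=
      ContinuousAt.comp (f := fun q => (q, τ q)) h1 (hγs q (hKV hq)).continuousAt
    exact (h2.clm_apply continuousAt_const).continuousWithinAt
  obtain ⟨δ, hδ, hδb⟩ : ∃ δ > 0, ∀ q ∈ K, δ ≤ |fderiv ℝ F (q, τ q) (0, 1)| := by
    obtain ⟨q0, hq0, hmin⟩ := hK.exists_isMinOn hne hcont.abs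
    exact ⟨_, abs_pos.2 (hFt q0 (hKV hq0)), fun q hq => hmin hq⟩
  obtain ⟨A, hA, hAb⟩ : ∃ A > 0, ∀ q ∈ K, ‖fderiv ℝ (fun q => (q, τ q)) q‖ ≤ A := by
    have : ContinuousOn (fderiv ℝ (fun q => (q, τ q))) K := fun q hq =>
      ((hγs q (hKV hq)).fderiv_right (m := ∞) (by simp)).continuousAt.continuousWithinAt
    obtain ⟨A, hA⟩ := hK.exists_bound_of_continuousOn this
    exact ⟨|A| + 1, by positivity, fun q hq => (hA q hq).trans (by linarith [le_abs_self A])⟩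
  have p1 := nrm_pos hm (n := 1) le_rfl
  have q1 := hm.1 1 le_rfl
  set a := C * nrm m 1 with ha
  have hap : 0 < a := by positivity
  set ε : ℝ := min (1 / (16 * a)) (δ / (16 * a ^ 2)) with hε
  have hεp : 0 < ε := by positivity
  have hε1 : 8 * (a * ε) ≤ 1 / 2 := by
    have : ε ≤ 1 / (16 * a) := min_le_left _ _
    rw [le_div_iff₀ (by positivity)] at this
    linarith
  have hε2 : 16 * (a * ε) ^ 2 ≤ δ * ε := by
    have : ε ≤ δ / (16 * a ^ 2) := min_le_right _ _
    rw [le_div_iff₀ (by positivity)] at this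
    nlinarith
  set R : ℝ := A / (m 1 * ε) with hR
  have hRp : 0 < R := by positivity
  have hγn : ∀ n : ℕ, 2 ≤ n → ∀ q ∈ V, iteratedFDeriv ℝ n (fun q => (q, τ q)) q =
      (0 : E [×n]→L[ℝ] E).prod (iteratedFDeriv ℝ n τ q) := by
    intro n hn q hq
    rw [iteratedFDeriv_prodMk (f := fun q : E => q) contDiffAt_id (hτ q hq) (nat_le_infty n)]
    congr 1
    exact clm_iteratedFDeriv_zero (ContinuousLinearMap.id ℝ E) hn q
  have hτle : ∀ n : ℕ, ∀ q ∈ V, ‖iteratedFDeriv ℝ n τ q‖ ≤ ‖iteratedFDeriv ℝ n (fun q => (q, τ q)) q‖ := by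
    intro n q hq
    rw [iteratedFDeriv_prodMk (f := fun q : E => q) contDiffAt_id (hτ q hq) (nat_le_infty n),
      ContinuousMultilinearMap.opNorm_prod]
    exact le_max_right _ _
  have key : ∀ n : ℕ, 1 ≤ n → ∀ p ∈ K,
      ‖iteratedFDeriv ℝ n (fun q => (q, τ q)) p‖ ≤ m n * (ε * R ^ n * (1 / (n : ℝ) ^ 2)) := by
    intro n
    induction n using Nat.strong_induction_on with
    | _ n ih =>
    intro hn p hp
    have hmn := hm.1 n hn
    have hn0 : (0 : ℝ) < n := by exact_mod_cast hn
    rcases Nat.lt_or_ge n 2 with h | h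
    · obtain rfl : n = 1 := by omega
      rw [norm_iteratedFDeriv_one]
      refine (hAb p hp).trans (le_of_eq ?_)
      rw [hR]; field_simp; simp
    · have hmem : (p, τ p) ∈ (fun q => (q, τ q)) '' K := mem_image_of_mem _ hp
      have h1 := core_rem hm (g := F) (γ := fun q => (q, τ q)) (hFs _ hmem) (hγs p (hKV hp)) hC.le
          (fun j hj => hFb j hj _ hmem) hεp.le hRp.le hε1 hn
          (fun k hk hkn => ih k hkn hk p hp)
      have hz : iteratedFDeriv ℝ n (F ∘ fun q => (q, τ q)) p = 0 := by
        have he : (F ∘ fun q => (q, τ q)) =ᶠ[𝓝 p] fun q => (0 : E →L[ℝ] ℝ) q := by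
          filter_upwards [hV.mem_nhds (hKV hp)] with q hq
          simpa using h0 q hq
        rw [((he.iteratedFDeriv (𝕜 := ℝ)) n).eq_of_nhds]
        exact clm_iteratedFDeriv_zero _ h p
      rw [hz, zero_sub, norm_neg, hγn n h p (hKV hp)] at h1
      have h2 : (fderiv ℝ F (p, τ p)).compContinuousMultilinearMap
          ((0 : E [×n]→L[ℝ] E).prod (iteratedFDeriv ℝ n τ p)) =
          (fderiv ℝ F (p, τ p) (0, 1)) • iteratedFDeriv ℝ n τ p := by
        ext v
        have : ((0 : E), iteratedFDeriv ℝ n τ p v) = (iteratedFDeriv ℝ n τ p v) • ((0 : E), (1 : ℝ)) := by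
          simp
        simp only [ContinuousLinearMap.compContinuousMultilinearMap_coe, Function.comp_apply,
          ContinuousMultilinearMap.prod_apply, ContinuousMultilinearMap.zero_apply,
          ContinuousMultilinearMap.smul_apply]
        rw [this, map_smul, smul_eq_mul, smul_eq_mul, mul_comm]
      rw [h2, norm_smul, Real.norm_eq_abs] at h1
      rw [hγn n h p (hKV hp), ContinuousMultilinearMap.opNorm_prod, norm_zero,
        max_eq_right (norm_nonneg _)]
      refine le_of_mul_le_mul_left ?_ hδ
      calc δ * ‖iteratedFDeriv ℝ n τ p‖ ≤ |fderiv ℝ F (p, τ p) (0, 1)| * ‖iteratedFDeriv ℝ n τ p‖ := by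
            gcongr; exact hδb p hp
        _ ≤ _ := h1
        _ ≤ m n * (δ * ε * (R ^ n * (1 / (n : ℝ) ^ 2))) := by gcongr
        _ = _ := by ring
  refine Car.of_bound hm (A := ε) (B := R) (fun p hp => hτ p (hKV hp)) hεp.le hRp
    fun n hn p hp => (hτle n p (hKV hp)).trans ((key n hn p hp).trans ?_)
  have hmn := hm.1 n hn
  have hn1 : 1 / (n : ℝ) ^ 2 ≤ 1 := by
    have : (1 : ℝ) ≤ n := by exact_mod_cast hn
    rw [div_le_one (by positivity)]
    exact one_le_pow₀ this
  calc m n * (ε * R ^ n * (1 / (n : ℝ) ^ 2)) ≤ m n * (ε * R ^ n * 1) := by gcongr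
    _ = _ := by ring
end flow2

section flat
set_option linter.unusedSectionVars false
open Asymptotics
variable {E G : Type} [NormedAddCommGroup E] [NormedSpace ℝ E]
    [NormedAddCommGroup G] [NormedSpace ℝ G]

/-- flat to infinite order -/
def FlatO (u : E → G) (p : E) : Prop := ∀ N : ℕ, u =O[𝓝 p] fun q => ‖q - p‖ ^ N

lemma flat_of_zero (N : ℕ) : ∀ {G : Type} [NormedAddCommGroup G] [NormedSpace ℝ G] {u : E → G} {p : E}
    (_ : ContDiffAt ℝ ∞ u p) (_ : ∀ n, iteratedFDeriv ℝ n u p = 0),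
    u =O[𝓝 p] fun q => ‖q - p‖ ^ N := by
  induction N with
  | zero =>
    intro G _ _ u p hu _
    simpa using hu.continuousAt.norm.isBoundedUnder_le.isBigO_one ℝ
  | succ N ih =>
    intro G _ _ u p hu hz
    have h1 := ih (u := fderiv ℝ u) (p := p) (hu.fderiv_right (by simp)) (by
      intro n
      rw [← norm_eq_zero, norm_iteratedFDeriv_fderiv, hz (n + 1), norm_zero])
    have hup : u p = 0 := by
      have := hz 0
      rw [← norm_eq_zero, norm_iteratedFDeriv_zero] at this
      exact norm_eq_zero.1 this
    obtain ⟨A, hA, hAb⟩ := h1.exists_nonneg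
    rw [isBigOWith_iff] at hAb
    have hdiff : ∀ᶠ q in 𝓝 p, DifferentiableAt ℝ u q := by
      have := (hu.of_le (nat_le_infty 1)).eventually (by simp)
      filter_upwards [this] with q hq using hq.differentiableAt (by simp)
    obtain ⟨r, hr, hrb⟩ := Metric.eventually_nhds_iff_ball.1 (hAb.and hdiff)
    refine IsBigO.of_bound A ?_
    filter_upwards [Metric.ball_mem_nhds p hr] with q hq
    rw [Metric.mem_ball, dist_eq_norm] at hq
    have hsub : ∀ x ∈ Metric.closedBall p ‖q - p‖, x ∈ Metric.ball p r := fun x hx => by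
      rw [Metric.mem_closedBall] at hx
      exact lt_of_le_of_lt hx hq
    have := (convex_closedBall p ‖q - p‖).norm_image_sub_le_of_norm_fderiv_le (𝕜 := ℝ) (f := u)
      (C := A * ‖q - p‖ ^ N) (x := p) (y := q) (fun x hx => (hrb x (hsub x hx)).2) (by
        intro x hx
        refine (hrb x (hsub x hx)).1.trans ?_
        rw [Metric.mem_closedBall, dist_eq_norm] at hx
        simp only [norm_pow, norm_norm]
        gcongr) (by simp) (by simp [dist_eq_norm])
    rw [hup, sub_zero] at this
    rw [norm_pow, norm_norm, pow_succ, ← mul_assoc]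
    exact this

lemma FlatO.zero {u : E → G} {p : E} (h : FlatO u p) : u p = 0 := by
  obtain ⟨A, hA⟩ := (h 1).bound
  have := hA.self_of_nhds
  simpa using this

lemma FlatO.fderiv {u : E → G} {p : E} (hu : ContDiffAt ℝ ∞ u p) (h : FlatO u p) :
    FlatO (fderiv ℝ u) p := by
  have hp0 : _root_.fderiv ℝ u p = 0 := ((h 2).hasFDerivAt (by norm_num)).fderiv
  have hf1 : ContDiffAt ℝ 1 (_root_.fderiv ℝ u) p :=
    (hu.fderiv_right (m := ∞) (by simp)).of_le (nat_le_infty 1)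
  obtain ⟨M, t, ht, hM⟩ := hf1.exists_lipschitzOnWith
  have hdiff : ∀ᶠ q in 𝓝 p, DifferentiableAt ℝ u q := by
    have := (hu.of_le (nat_le_infty 1)).eventually (by simp)
    filter_upwards [this] with q hq using hq.differentiableAt (by simp)
  suffices H : ∀ N : ℕ, 1 ≤ N → _root_.fderiv ℝ u =O[𝓝 p] fun q => ‖q - p‖ ^ N by
    intro N
    rcases Nat.eq_zero_or_pos N with rfl | hN
    · simpa using hf1.continuousAt.norm.isBoundedUnder_le.isBigO_one ℝ
    · exact H N hN
  intro N hN
  obtain ⟨A, hA, hAb⟩ := (h (2 * N)).exists_nonneg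
  rw [isBigOWith_iff] at hAb
  obtain ⟨r, hr, hrb⟩ := Metric.eventually_nhds_iff_ball.1 ((hAb.and hdiff).and ht)
  refine IsBigO.of_bound ((M : ℝ) + A * (4 ^ N + 1)) ?_
  filter_upwards [Metric.ball_mem_nhds p (show 0 < min 1 (r / 2) by positivity)] with q hq
  rw [Metric.mem_ball, dist_eq_norm] at hq
  set ρ := ‖q - p‖ with hρ
  have hρ1 : ρ < 1 := lt_of_lt_of_le hq (min_le_left _ _)
  have hρ2 : ρ < r / 2 := lt_of_lt_of_le hq (min_le_right _ _)
  have hρ0 : 0 ≤ ρ := norm_nonneg _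
  rw [norm_pow, Real.norm_eq_abs, abs_of_nonneg hρ0]
  rcases hρ0.eq_or_lt with hz | hρp
  · have : q = p := by
      rw [← sub_eq_zero, ← norm_eq_zero]; exact hz.symm
    rw [this, hp0, norm_zero]
    positivity
  refine ContinuousLinearMap.opNorm_le_of_unit_norm (by positivity) fun w hw => ?_
  set s := ρ ^ N with hs
  have hsp : 0 < s := by positivity
  have hsρ : s ≤ ρ := by
    calc ρ ^ N ≤ ρ ^ 1 := pow_le_pow_of_le_one hρ0 hρ1.le hN
      _ = ρ := pow_one _
  have hin : ∀ x ∈ Metric.closedBall q s, x ∈ Metric.ball p r ∧ ‖x - p‖ ≤ 2 * ρ := by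
    intro x hx
    rw [Metric.mem_closedBall, dist_eq_norm] at hx
    have : ‖x - p‖ ≤ 2 * ρ := by
      calc ‖x - p‖ ≤ ‖x - q‖ + ‖q - p‖ := norm_sub_le_norm_sub_add_norm_sub _ _ _
        _ ≤ s + ρ := add_le_add hx le_rfl
        _ ≤ _ := by linarith
    refine ⟨?_, this⟩
    rw [Metric.mem_ball, dist_eq_norm]
    linarith
  have hqm : q ∈ Metric.closedBall q s := Metric.mem_closedBall_self hsp.le
  have hym : q + s • w ∈ Metric.closedBall q s := by
    rw [Metric.mem_closedBall, dist_eq_norm]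
    simp [norm_smul, hw, abs_of_pos hsp]
  have hT := (convex_closedBall q s).norm_image_sub_le_of_norm_hasFDerivWithin_le' (f := u)
    (f' := _root_.fderiv ℝ u) (φ := _root_.fderiv ℝ u q) (C := M * s) (x := q) (y := q + s • w)
    (fun x hx => (hrb x (hin x hx).1).1.2.hasFDerivAt.hasFDerivWithinAt)
    (by
      intro x hx
      have h1 := hM.dist_le_mul x (hrb x (hin x hx).1).2 q (hrb q (hin q hqm).1).2
      rw [dist_eq_norm] at h1
      refine h1.trans ?_
      rw [Metric.mem_closedBall] at hx
      gcongr) hqm hym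
  have hu1 := (hrb _ (hin _ hym).1).1.1
  have hu2 := (hrb _ (hin _ hqm).1).1.1
  have hb1 : ‖u (q + s • w)‖ ≤ A * (4 ^ N * (s * s)) := by
    refine hu1.trans ?_
    rw [norm_pow, norm_norm]
    calc A * ‖q + s • w - p‖ ^ (2 * N) ≤ A * (2 * ρ) ^ (2 * N) := by
          gcongr; exact (hin _ hym).2
      _ = _ := by rw [mul_pow, pow_mul, hs, ← pow_add, two_mul]; norm_num
  have hb2 : ‖u q‖ ≤ A * (s * s) := by
    refine hu2.trans (le_of_eq ?_)
    rw [norm_pow, norm_norm, ← hρ, hs, ← pow_add, two_mul]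
  simp only [add_sub_cancel_left, map_smul, norm_smul, Real.norm_eq_abs, abs_of_pos hsp, hw, mul_one] at hT
  have hfin : s * ‖_root_.fderiv ℝ u q w‖ ≤ s * (((M : ℝ) + A * (4 ^ N + 1)) * s) := by
    calc s * ‖_root_.fderiv ℝ u q w‖ = ‖s • _root_.fderiv ℝ u q w‖ := by
          rw [norm_smul, Real.norm_eq_abs, abs_of_pos hsp]
      _ = ‖(u (q + s • w) - u q) - (u (q + s • w) - u q - s • _root_.fderiv ℝ u q w)‖ := by
          congr 1; abel
      _ ≤ ‖u (q + s • w)‖ + ‖u q‖ + ‖u (q + s • w) - u q - s • _root_.fderiv ℝ u q w‖ := by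
          refine (norm_sub_le _ _).trans ?_
          gcongr
          exact norm_sub_le _ _
      _ ≤ A * (4 ^ N * (s * s)) + A * (s * s) + M * s * s := by gcongr
      _ = _ := by ring
  exact le_of_mul_le_mul_left hfin hsp

lemma zero_of_flat (n : ℕ) : ∀ {G : Type} [NormedAddCommGroup G] [NormedSpace ℝ G] {u : E → G} {p : E}
    (_ : ContDiffAt ℝ ∞ u p) (_ : FlatO u p), iteratedFDeriv ℝ n u p = 0 := by
  induction n with
  | zero =>
    intro G _ _ u p hu h
    rw [← norm_eq_zero, norm_iteratedFDeriv_zero, h.zero, norm_zero]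
  | succ n ih =>
    intro G _ _ u p hu h
    rw [← norm_eq_zero, ← norm_iteratedFDeriv_fderiv,
      ih (hu.fderiv_right (by simp)) (h.fderiv hu), norm_zero]

lemma flat_iff {u : E → G} {p : E} (hu : ContDiffAt ℝ ∞ u p) :
    (∀ n, iteratedFDeriv ℝ n u p = 0) ↔ FlatO u p :=
  ⟨fun h N => flat_of_zero N hu h, fun h n => zero_of_flat n hu h⟩

lemma FlatO.of_isBigO {G' : Type} [NormedAddCommGroup G'] {u : E → G} {v : E → G'} {p : E}
    [NormedSpace ℝ G'] (h : FlatO u p) (hv : v =O[𝓝 p] u) : FlatO v p := fun N => hv.trans (h N)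

lemma FlatO.add {u v : E → G} {p : E} (h : FlatO u p) (h' : FlatO v p) :
    FlatO (fun q => u q + v q) p := fun N => (h N).add (h' N)

lemma FlatO.sub {u v : E → G} {p : E} (h : FlatO u p) (h' : FlatO v p) :
    FlatO (fun q => u q - v q) p := fun N => (h N).sub (h' N)

lemma FlatO.sum {ι : Type} {s : Finset ι} {u : ι → E → G} {p : E} (h : ∀ i ∈ s, FlatO (u i) p) :
    FlatO (fun q => ∑ i ∈ s, u i q) p := fun N => IsBigO.fun_sum fun i hi => h i hi N

lemma FlatO.mul_cont {u v : E → ℝ} {p : E} (h : FlatO u p) (h' : ContinuousAt v p) :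
    FlatO (fun q => u q * v q) p := fun N => by
  have := (h N).mul (h'.norm.isBoundedUnder_le.isBigO_one ℝ)
  simpa using this

lemma FlatO.clm {G' : Type} [NormedAddCommGroup G'] [NormedSpace ℝ G'] {u : E → G} {p : E}
    (h : FlatO u p) (L : G →L[ℝ] G') : FlatO (fun q => L (u q)) p :=
  h.of_isBigO (L.isBigO_comp _ _)

lemma FlatO.congr {u v : E → G} {p : E} (h : FlatO u p) (h' : v =ᶠ[𝓝 p] u) : FlatO v p :=
  fun N => (h N).congr' h'.symm EventuallyEq.rfl

lemma FlatO.of_sq {u : E → ℝ} {p : E} (h : FlatO (fun q => u q ^ 2) p) : FlatO u p := by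
  intro N
  have := h (2 * N)
  refine IsBigO.of_pow (n := 2) two_ne_zero ?_
  refine this.congr' EventuallyEq.rfl (Eventually.of_forall fun q => ?_)
  simp [← pow_mul, mul_comm]

lemma FlatO.of_le {u v : E → ℝ} {p : E} (h : FlatO u p) (h' : ∀ q, |v q| ≤ |u q|) : FlatO v p :=
  h.of_isBigO (IsBigO.of_bound 1 (Eventually.of_forall fun q => by simpa using h' q))

/-- `tau - tau p` is flat iff `F(·, tau p)` is flat -/
lemma flat_implicit {F : E × ℝ → ℝ} {τ : E → ℝ} {p : E} (hF : ContDiffAt ℝ ∞ F (p, τ p))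
    (hτ : ContinuousAt τ p) (h0 : ∀ᶠ q in 𝓝 p, F (q, τ q) = 0)
    (hFt : fderiv ℝ F (p, τ p) (0, 1) ≠ 0) :
    FlatO (fun q => τ q - τ p) p ↔ FlatO (fun q => F (q, τ p)) p := by
  set c := fderiv ℝ F (p, τ p) (0, 1) with hc
  have hs : HasStrictFDerivAt F (fderiv ℝ F (p, τ p)) (p, τ p) := hF.hasStrictFDerivAt (by simp)
  have hlim : Tendsto (fun q => ((q, τ p), (q, τ q))) (𝓝 p) (𝓝 ((p, τ p), (p, τ p))) := by
    refine Tendsto.prodMk_nhds ?_ ?_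
    · exact (continuous_id.prodMk continuous_const).continuousAt
    · exact (continuousAt_id.prodMk hτ)
  have h1 := (hasStrictFDerivAt_iff_isLittleO.1 hs).comp_tendsto hlim
  have h2 : (fun q => F (q, τ p) + c * (τ q - τ p)) =o[𝓝 p] fun q => τ q - τ p := by
    refine IsLittleO.congr' (h1.trans_isBigO (IsBigO.of_bound 1 (g := fun q => τ q - τ p) ?_)) ?_ EventuallyEq.rfl
    · refine Eventually.of_forall fun q => ?_
      simp [Prod.norm_def, abs_sub_comm]
    · filter_upwards [h0] with q hq
      have : ((q, τ p) - (q, τ q) : E × ℝ) = (τ p - τ q) • ((0 : E), (1 : ℝ)) := by simp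
      simp only [Function.comp_apply]
      rw [hq, this, map_smul, ← hc, smul_eq_mul]
      ring
  have hself : (fun q => τ q - τ p) =O[𝓝 p] fun q => c * (τ q - τ p) :=
    (isBigO_refl _ _).const_mul_right hFt |>.trans (isBigO_refl _ _)
  have hself' : (fun q => c * (τ q - τ p)) =O[𝓝 p] fun q => (τ q - τ p) :=
    (isBigO_refl _ _).const_mul_left c
  constructor
  · intro h
    refine h.of_isBigO ?_
    have := h2.isBigO.sub hself'
    simpa using this
  · intro h
    refine h.of_isBigO ?_
    have h3 : (fun q => F (q, τ p) + c * (τ q - τ p)) =o[𝓝 p] fun q => c * (τ q - τ p) :=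
      h2.trans_isBigO hself
    have h4 := h3.right_isBigO_sub
    refine hself.trans (h4.trans ?_)
    exact IsBigO.of_bound 1 (Eventually.of_forall fun q => by simp)
end flat

section ham
variable {d : ℕ}

lemma Tprime_open : IsOpen (Tprime d) :=
  isOpen_ne.preimage (continuous_snd (X := Fin d → ℝ) (Y := Fin d → ℝ))

lemma ham_smooth {h : Phase d → ℝ} (hh : HomHamiltonian h) {q : Phase d} (hq : q ∈ Tprime d) :
    ContDiffAt ℝ ∞ h q := hh.1.contDiffAt (Tprime_open.mem_nhds hq)

lemma flow_smooth {h : Phase d → ℝ} {Φ : ℝ → Phase d → Phase d} (hΦ : IsCompleteFlow h Φ)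
    (t : ℝ) (q : Phase d) (hq : q ∈ Tprime d) : ContDiffAt ℝ ∞ (Function.uncurry Φ) (t, q) :=
  hΦ.1.contDiffAt ((isOpen_univ.prod Tprime_open).mem_nhds ⟨mem_univ _, hq⟩)

/-- the symplectic map -/
def hamJ (d : ℕ) : (Phase d →L[ℝ] ℝ) →L[ℝ] Phase d :=
  (ContinuousLinearMap.pi fun j => ContinuousLinearMap.apply ℝ ℝ ((0, Pi.single j 1) : Phase d)).prod
  (ContinuousLinearMap.pi fun j => - ContinuousLinearMap.apply ℝ ℝ ((Pi.single j 1, 0) : Phase d))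

lemma hamField_eq (h : Phase d → ℝ) (p : Phase d) : hamField h p = hamJ d (fderiv ℝ h p) := by
  ext j <;> simp [hamField, hamJ]

/-- dot product -/
def dotB (d : ℕ) : (Fin d → ℝ) →L[ℝ] (Fin d → ℝ) →L[ℝ] ℝ :=
  ∑ j, (ContinuousLinearMap.mul ℝ ℝ).bilinearComp (ContinuousLinearMap.proj j) (ContinuousLinearMap.proj j)

lemma dotB_apply (a b : Fin d → ℝ) : dotB d a b = ∑ j, a j * b j := by
  simp [dotB]

lemma dot_hasDerivAt {u v : ℝ → Fin d → ℝ} {u' v' : Fin d → ℝ} {t : ℝ} (hu : HasDerivAt u u' t)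
    (hv : HasDerivAt v v' t) :
    HasDerivAt (fun s => dotB d (u s) (v s)) (dotB d (u t) v' + dotB d u' (v t)) t := by
  have h1 : HasDerivAt (fun s => dotB d (u s)) (dotB d u') t :=
    (dotB d).hasFDerivAt.comp_hasDerivAt t hu
  rw [add_comm]
  exact h1.clm_apply hv

lemma d_fst {u : ℝ → Phase d} {u' : Phase d} {t : ℝ} (hu : HasDerivAt u u' t) :
    HasDerivAt (fun s => (u s).1) u'.1 t :=
  (ContinuousLinearMap.fst ℝ (Fin d → ℝ) (Fin d → ℝ)).hasFDerivAt.comp_hasDerivAt t hu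

lemma d_snd {u : ℝ → Phase d} {u' : Phase d} {t : ℝ} (hu : HasDerivAt u u' t) :
    HasDerivAt (fun s => (u s).2) u'.2 t :=
  (ContinuousLinearMap.snd ℝ (Fin d → ℝ) (Fin d → ℝ)).hasFDerivAt.comp_hasDerivAt t hu

lemma dotB_comm (a b : Fin d → ℝ) : dotB d a b = dotB d b a := by
  simp only [dotB_apply, mul_comm]

lemma sum_single_inl (a : Fin d → ℝ) : ((a, 0) : Phase d) = ∑ j, a j • ((Pi.single j 1, 0) : Phase d) := by
  ext k
  · simp [Prod.fst_sum, Finset.sum_apply, Pi.single_apply]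
  · simp [Prod.snd_sum, Finset.sum_apply]

lemma sum_single_inr (a : Fin d → ℝ) : ((0, a) : Phase d) = ∑ j, a j • ((0, Pi.single j 1) : Phase d) := by
  ext k
  · simp [Prod.fst_sum, Finset.sum_apply]
  · simp [Prod.snd_sum, Finset.sum_apply, Pi.single_apply]

lemma fderiv_repr (h : Phase d → ℝ) (p w : Phase d) :
    fderiv ℝ h p w = dotB d w.2 (hamField h p).1 - dotB d w.1 (hamField h p).2 := by
  have : w = (w.1, 0) + (0, w.2) := by simp
  conv_lhs => rw [this, map_add, sum_single_inl, sum_single_inr]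
  simp only [map_sum, map_smul, dotB_apply, hamField, smul_eq_mul, mul_neg, Finset.sum_neg_distrib]
  ring

/-- scaling of the fibre -/
def scal (d : ℕ) (c : ℝ) : Phase d →L[ℝ] Phase d :=
  (ContinuousLinearMap.fst ℝ _ _).prod (c • ContinuousLinearMap.snd ℝ _ _)

lemma scal_apply (c : ℝ) (p : Phase d) : scal d c p = (p.1, c • p.2) := rfl

lemma scal_mem {c : ℝ} (hc : 0 < c) {p : Phase d} (hp : p ∈ Tprime d) : scal d c p ∈ Tprime d := by
  exact smul_ne_zero hc.ne' hp

lemma euler {h : Phase d → ℝ} (hh : HomHamiltonian h) {p : Phase d} (hp : p ∈ Tprime d) :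
    dotB d p.2 (hamField h p).1 = h p := by
  have h1 : HasFDerivAt h (fderiv ℝ h p) p := ((ham_smooth hh hp).differentiableAt (by simp)).hasFDerivAt
  have h2 : HasDerivAt (fun c : ℝ => (p.1, c • p.2)) ((0, p.2) : Phase d) 1 := by
    refine (hasDerivAt_const _ _).prodMk ?_
    simpa using (hasDerivAt_id (1 : ℝ)).smul_const p.2
  have h3 : HasDerivAt (fun c : ℝ => h (p.1, c • p.2)) (fderiv ℝ h p (0, p.2)) 1 := by
    refine HasFDerivAt.comp_hasDerivAt (f := fun c : ℝ => (p.1, c • p.2)) 1 ?_ h2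
    simpa using h1
  have h4 : HasDerivAt (fun c : ℝ => h (p.1, c • p.2)) (h p) 1 := by
    have : HasDerivAt (fun c : ℝ => c * h p) (h p) 1 := by
      simpa using (hasDerivAt_id (1 : ℝ)).mul_const (h p)
    refine this.congr_of_eventuallyEq ?_
    filter_upwards [lt_mem_nhds (zero_lt_one (α := ℝ))] with c hc using hh.2.2 p hp c hc
  have h5 := h3.unique h4
  rw [fderiv_repr] at h5
  simpa using h5

lemma hamField_scal {h : Phase d → ℝ} (hh : HomHamiltonian h) {p : Phase d} (hp : p ∈ Tprime d)
    {c : ℝ} (hc : 0 < c) : hamField h (scal d c p) = scal d c (hamField h p) := by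
  have key : ∀ w, fderiv ℝ h (scal d c p) (scal d c w) = c * fderiv ℝ h p w := by
    have h1 : HasFDerivAt h (fderiv ℝ h (scal d c p)) (scal d c p) :=
      ((ham_smooth hh (scal_mem hc hp)).differentiableAt (by simp)).hasFDerivAt
    have h2 := h1.comp p (scal d c).hasFDerivAt
    have h3 : HasFDerivAt (fun q => c * h q) (c • fderiv ℝ h p) p :=
      ((ham_smooth hh hp).differentiableAt (by simp)).hasFDerivAt.const_mul c
    have h4 : HasFDerivAt (fun q => c * h q) ((fderiv ℝ h (scal d c p)).comp (scal d c)) p := by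
      refine h2.congr_of_eventuallyEq ?_
      filter_upwards [Tprime_open.mem_nhds hp] with q hq
      exact (hh.2.2 q hq c hc).symm
    intro w
    have := congrArg (fun L => L w) (h4.unique h3)
    simpa using this
  have e1 : ∀ j, fderiv ℝ h (scal d c p) (0, Pi.single j 1) = fderiv ℝ h p (0, Pi.single j 1) := by
    intro j
    have := key (c⁻¹ • (0, Pi.single j 1))
    rw [map_smul, map_smul, map_smul] at this
    have e : scal d c (0, Pi.single j 1) = c • ((0, Pi.single j 1) : Phase d) := by
      rw [scal_apply]; simp
    rw [e, map_smul, smul_smul, inv_mul_cancel₀ hc.ne', one_smul, smul_eq_mul, ← mul_assoc,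
      mul_inv_cancel₀ hc.ne', one_mul] at this
    exact this
  have e2 : ∀ j, fderiv ℝ h (scal d c p) (Pi.single j 1, 0) = c * fderiv ℝ h p (Pi.single j 1, 0) := by
    intro j
    have := key (Pi.single j 1, 0)
    have e : scal d c (Pi.single j 1, 0) = ((Pi.single j 1, 0) : Phase d) := by
      rw [scal_apply]; simp
    rwa [e] at this
  ext j
  · simpa [hamField, scal] using e1 j
  · have := e2 j
    rw [scal_apply c (hamField h p)]
    simp only [hamField, Pi.smul_apply, smul_eq_mul, this]
    ring

section
variable {h : Phase d → ℝ} (hh : HomHamiltonian h) {Φ : ℝ → Phase d → Phase d}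
  (hΦ : IsCompleteFlow h Φ)

lemma flow_scal (hh : HomHamiltonian h) (hΦ : IsCompleteFlow h Φ) {p : Phase d} (hp : p ∈ Tprime d) {c : ℝ} (hc : 0 < c) (t : ℝ) :
    Φ t (scal d c p) = scal d c (Φ t p) := by
  obtain ⟨h0, hin, htr, _⟩ := hΦ.2 p hp
  obtain ⟨_, _, _, huniq⟩ := hΦ.2 _ (scal_mem hc hp)
  have := huniq (fun t => scal d c (Φ t p)) (by simp [h0]) (fun t => scal_mem hc (hin t)) (by
    intro t _
    simp only [hamField_scal hh (hin t) hc]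
    exact (scal d c).hasFDerivAt.comp_hasDerivAt t (htr t (mem_univ _)))
  exact (congrFun this t).symm

lemma hamField_smooth (hh : HomHamiltonian h) {q : Phase d} (hq : q ∈ Tprime d) :
    ContDiffAt ℝ ∞ (hamField h) q := by
  have : hamField h = fun p => hamJ d (fderiv ℝ h p) := funext fun p => hamField_eq h p
  rw [this]
  exact (hamJ d).contDiff.contDiffAt.comp q ((ham_smooth hh hq).fderiv_right (by simp))

lemma euler_diff (hh : HomHamiltonian h) {p : Phase d} (hp : p ∈ Tprime d) (w : Phase d) :
    dotB d p.2 (fderiv ℝ (hamField h) p w).1 + dotB d w.1 (hamField h p).2 = 0 := by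
  have hd := ((hamField_smooth hh hp).differentiableAt (by simp)).hasFDerivAt
  have h1 : HasFDerivAt (fun q : Phase d => dotB d q.2 (hamField h q).1) _ p :=
    (dotB d).hasFDerivAt_of_bilinear (hasFDerivAt_snd (𝕜 := ℝ) (p := p)) hd.fst
  have h2 : HasFDerivAt (fun q : Phase d => dotB d q.2 (hamField h q).1) (fderiv ℝ h p) p := by
    refine ((ham_smooth hh hp).differentiableAt (by simp)).hasFDerivAt.congr_of_eventuallyEq ?_
    filter_upwards [Tprime_open.mem_nhds hp] with q hq using euler hh hq
  have h3 := congrArg (fun L => L w) (h1.unique h2)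
  simp only [fderiv_repr] at h3
  simp at h3
  linarith

lemma flow_diff (hΦ : IsCompleteFlow h Φ) {p : Phase d} (hp : p ∈ Tprime d) (t : ℝ) :
    HasFDerivAt (Φ t) (fderiv ℝ (Φ t) p) p :=
  ((slice_smooth (flow_smooth hΦ t p hp)).differentiableAt (by simp)).hasFDerivAt

lemma canonical (hh : HomHamiltonian h) (hΦ : IsCompleteFlow h Φ) {p : Phase d} (hp : p ∈ Tprime d)
    (t : ℝ) (v : Phase d) : dotB d (Φ t p).2 (fderiv ℝ (Φ t) p v).1 = dotB d p.2 v.1 := by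
  have hder : ∀ t, HasDerivAt (fun t => dotB d (Φ t p).2 (fderiv ℝ (Φ t) p v).1) 0 t := by
    intro t
    have hin := (hΦ.2 p hp).2.1 t
    have h1 : HasDerivAt (fun t => Φ t p) (hamField h (Φ t p)) t := (hΦ.2 p hp).2.2.1 t (mem_univ _)
    have h2 := comm_one Tprime_open (flow_smooth hΦ) (F' := fun t q => hamField h (Φ t q))
      (fun t q hq => (hΦ.2 q hq).2.2.1 t (mem_univ _)) t hp
    have h3 : HasDerivAt (fun t => fderiv ℝ (Φ t) p v)
        (fderiv ℝ (hamField h) (Φ t p) (fderiv ℝ (Φ t) p v)) t := by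
      have h4 := h2.clm_apply (hasDerivAt_const t v)
      have h5 : fderiv ℝ (fun q => hamField h (Φ t q)) p =
          (fderiv ℝ (hamField h) (Φ t p)).comp (fderiv ℝ (Φ t) p) :=
        (((hamField_smooth hh hin).differentiableAt (by simp)).hasFDerivAt.comp p
          (flow_diff hΦ hp t)).fderiv
      rw [h5] at h4
      simpa using h4
    have h6 := dot_hasDerivAt (d_snd h1) (d_fst h3)
    convert h6 using 1
    rw [← euler_diff hh hin (fderiv ℝ (Φ t) p v), dotB_comm (hamField h (Φ t p)).2]
  have hconst := is_const_of_deriv_eq_zero (fun t => (hder t).differentiableAt)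
    (fun t => (hder t).deriv) t 0
  rw [hconst, (hΦ.2 p hp).1]
  have : Φ 0 =ᶠ[𝓝 p] id := by
    filter_upwards [Tprime_open.mem_nhds hp] with q hq using (hΦ.2 q hq).1
  rw [this.fderiv_eq, fderiv_id]
  rfl

/-- the phase function -/
def phF (Φ : ℝ → Phase d → Phase d) (z : Phase d × ℝ) : ℝ :=
  dotB d (z.1.1 - (Φ z.2 z.1).1) (Φ z.2 z.1).2

lemma phF_smooth (hΦ : IsCompleteFlow h Φ) {p : Phase d} (hp : p ∈ Tprime d) (t : ℝ) :
    ContDiffAt ℝ ∞ (phF Φ) (p, t) := by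
  have h1 : ContDiffAt ℝ ∞ (fun z : Phase d × ℝ => Φ z.2 z.1) (p, t) :=
    (flow_smooth hΦ t p hp).comp (f := fun z : Phase d × ℝ => (z.2, z.1)) (p, t) (by fun_prop)
  have h2 : ContDiffAt ℝ ∞ (fun z : Phase d × ℝ => (z.1.1 - (Φ z.2 z.1).1, (Φ z.2 z.1).2)) (p, t) := by
    refine ContDiffAt.prodMk (ContDiffAt.sub (by fun_prop) h1.fst) h1.snd
  exact (dotB d).isBoundedBilinearMap.contDiff.contDiffAt.comp (p, t) h2

lemma phF_t (hh : HomHamiltonian h) (hΦ : IsCompleteFlow h Φ) {p : Phase d} (hp : p ∈ Tprime d) (t : ℝ) :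
    fderiv ℝ (phF Φ) (p, t) (0, 1) =
      - h (Φ t p) + dotB d (p.1 - (Φ t p).1) (hamField h (Φ t p)).2 := by
  have hin := (hΦ.2 p hp).2.1 t
  have h1 : HasDerivAt (fun t => Φ t p) (hamField h (Φ t p)) t := (hΦ.2 p hp).2.2.1 t (mem_univ _)
  have h2 := dot_hasDerivAt ((hasDerivAt_const t p.1).sub (d_fst h1)) (d_snd h1)
  have h3 : HasDerivAt (fun s => phF Φ (p, s)) (fderiv ℝ (phF Φ) (p, t) (0, 1)) t := by
    have := (((phF_smooth hΦ hp t).differentiableAt (by simp)).hasFDerivAt).comp_hasDerivAt t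
      (f := fun s => (p, s)) ((hasDerivAt_const t p).prodMk (hasDerivAt_id t))
    exact this
  rw [h3.unique h2, ← euler hh hin, dotB_comm (0 - _)]
  simp
  ring

lemma phF_q (hh : HomHamiltonian h) (hΦ : IsCompleteFlow h Φ) {p : Phase d} (hp : p ∈ Tprime d) (t : ℝ)
    (v : Phase d) :
    fderiv ℝ (fun q => phF Φ (q, t)) p v =
      dotB d v.1 ((Φ t p).2 - p.2) + dotB d (p.1 - (Φ t p).1) (fderiv ℝ (Φ t) p v).2 := by
  have h1 := flow_diff hΦ hp t
  have h2 : HasFDerivAt (fun q => phF Φ (q, t)) _ p :=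
    (dotB d).hasFDerivAt_of_bilinear ((hasFDerivAt_fst (𝕜 := ℝ) (p := p)).sub h1.fst) h1.snd
  rw [h2.fderiv]
  have h3 := canonical hh hΦ hp t v
  simp
  rw [dotB_comm _ (Φ t p).2, dotB_comm _ (Φ t p).2, h3, dotB_comm v.1 p.2]
  ring

lemma phF_scal (hh : HomHamiltonian h) (hΦ : IsCompleteFlow h Φ) {p : Phase d} (hp : p ∈ Tprime d)
    {c : ℝ} (hc : 0 < c) (t : ℝ) : phF Φ (scal d c p, t) = c * phF Φ (p, t) := by
  simp only [phF, flow_scal hh hΦ hp hc]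
  simp [scal_apply]
end
end ham

section hcar
variable {d : ℕ} {m : ℕ → ℝ} {h : Phase d → ℝ} {Φ : ℝ → Phase d → Phase d}

lemma ham_car
    (hhC : ∀ D : Set (Phase d), IsOpen D → IsCompact (closure D) → closure D ⊆ Tprime d →
      CarlemanClass m D h) {K : Set (Phase d)} (hK : IsCompact K) (hKT : K ⊆ Tprime d) : Car m K h := by
  obtain ⟨D, hD, hKD, hDT, hDc⟩ := exists_open_between_and_isCompact_closure hK Tprime_open hKT
  exact ((carlemanClass_iff hD).1 (hhC D hD hDc hDT)).mono hKD

lemma flow_car' (hm : RegularSeq m)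
    (hhC : ∀ D : Set (Phase d), IsOpen D → IsCompact (closure D) → closure D ⊆ Tprime d →
      CarlemanClass m D h) (hΦ : IsCompleteFlow h Φ)
    {K : Set (ℝ × Phase d)} (hK : IsCompact K) (hKT : K ⊆ univ ×ˢ Tprime d) :
    Car m K (fun z => Φ z.1 z.2) := by
  have hU : IsOpen ((univ : Set ℝ) ×ˢ Tprime d) := isOpen_univ.prod Tprime_open
  have hY : ∀ K ⊆ (univ : Set ℝ) ×ˢ Tprime d, IsCompact K →
      Car m K (fun z : ℝ × Phase d => ((0 : ℝ), z.1 • hamField h z.2)) := by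
    intro K hKT hK
    have c1 : Car m K (fun z : ℝ × Phase d => z.2) := Car.clm hm K (ContinuousLinearMap.snd ℝ ℝ (Phase d))
    have c0 : Car m K (fun z : ℝ × Phase d => z.1) := Car.clm hm K (ContinuousLinearMap.fst ℝ ℝ (Phase d))
    have hc : IsCompact ((fun z : ℝ × Phase d => z.2) '' K) := hK.image continuous_snd
    have hcT : (fun z : ℝ × Phase d => z.2) '' K ⊆ Tprime d := by
      rintro _ ⟨z, hz, rfl⟩; exact (hKT hz).2
    have c2 : Car m K (fun z : ℝ × Phase d => fderiv ℝ h z.2) :=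
      Car.comp hm ((ham_car hhC hc hcT).fderiv hm) c1
    have c3 : Car m K (fun z : ℝ × Phase d => hamField h z.2) := by
      have := Car.comp hm (Car.clm hm _ (hamJ d)) c2
      simpa only [← hamField_eq] using this
    have c4 := Car.prodMk hm c0 c3
    have hb : IsCompact ((fun z : ℝ × Phase d => (z.1, hamField h z.2)) '' K) := by
      refine hK.image_of_continuousOn fun z hz => ?_
      exact (c4.1 z hz).continuousAt.continuousWithinAt
    have c5 := Car.comp hm (Car.bilin hm hb.isBounded (ContinuousLinearMap.lsmul ℝ ℝ)) c4
    exact Car.comp hm (Car.clm hm _ (ContinuousLinearMap.inr ℝ ℝ (Phase d))) c5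
  have key := flow_car hm hU hY (Ψ := fun s z => (z.1, Φ (s * z.1) z.2))
    (by
      rintro t ⟨s, q⟩ ⟨_, hq⟩
      refine ContDiffAt.prodMk (by fun_prop) ?_
      exact (flow_smooth hΦ (t * s) q hq).comp (f := fun w : ℝ × (ℝ × Phase d) => (w.1 * w.2.1, w.2.2))
        (t, (s, q)) (by fun_prop))
    (by
      rintro ⟨s, q⟩ ⟨_, hq⟩
      simp [(hΦ.2 q hq).1])
    (by
      rintro t ⟨s, q⟩ ⟨_, hq⟩
      exact ⟨mem_univ _, (hΦ.2 q hq).2.1 _⟩)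
    (by
      rintro t ⟨s, q⟩ ⟨_, hq⟩
      refine (hasDerivAt_const _ _).prodMk ?_
      have h1 : HasDerivAt (fun t => Φ t q) (hamField h (Φ (t * s) q)) (t * s) := (hΦ.2 q hq).2.2.1 _ (mem_univ _)
      have h2 : HasDerivAt (fun t => t * s) s t := by simpa using (hasDerivAt_id t).mul_const s
      exact HasDerivAt.scomp (h := fun t => t * s) t h1 h2) hK hKT
  have := Car.comp hm (Car.clm hm _ (ContinuousLinearMap.snd ℝ ℝ (Phase d))) key
  simpa using this

lemma phF_car (hm : RegularSeq m)
    (hhC : ∀ D : Set (Phase d), IsOpen D → IsCompact (closure D) → closure D ⊆ Tprime d →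
      CarlemanClass m D h) (hΦ : IsCompleteFlow h Φ)
    {K : Set (Phase d × ℝ)} (hK : IsCompact K) (hKT : ∀ z ∈ K, z.1 ∈ Tprime d) :
    Car m K (phF Φ) := by
  have c1 : Car m K (fun z : Phase d × ℝ => (z.2, z.1)) :=
    Car.clm hm K ((ContinuousLinearMap.snd ℝ (Phase d) ℝ).prod (ContinuousLinearMap.fst ℝ (Phase d) ℝ))
  have hc : IsCompact ((fun z : Phase d × ℝ => (z.2, z.1)) '' K) := hK.image (by fun_prop)
  have c2 : Car m K (fun z : Phase d × ℝ => Φ z.2 z.1) :=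
    Car.comp (g := fun z : ℝ × Phase d => Φ z.1 z.2) hm (flow_car' hm hhC hΦ hc (by
      rintro _ ⟨z, hz, rfl⟩; exact ⟨mem_univ _, hKT z hz⟩)) c1
  have c3 : Car m K (fun z : Phase d × ℝ => z.1) := Car.clm hm K (ContinuousLinearMap.fst ℝ (Phase d) ℝ)
  have c4 := Car.prodMk hm c3 c2
  let L : (Phase d × Phase d) →L[ℝ] (Fin d → ℝ) × (Fin d → ℝ) :=
    ((ContinuousLinearMap.fst ℝ _ _).comp (ContinuousLinearMap.fst ℝ (Phase d) (Phase d)) -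
      (ContinuousLinearMap.fst ℝ _ _).comp (ContinuousLinearMap.snd ℝ (Phase d) (Phase d))).prod
      ((ContinuousLinearMap.snd ℝ _ _).comp (ContinuousLinearMap.snd ℝ (Phase d) (Phase d)))
  have c5 := Car.comp hm (Car.clm hm _ L) c4
  have hb : IsCompact ((fun z : Phase d × ℝ => L (z.1, Φ z.2 z.1)) '' K) := by
    refine hK.image_of_continuousOn fun z hz => ?_
    exact (c5.1 z hz).continuousAt.continuousWithinAt
  have c6 := Car.comp hm (Car.bilin hm hb.isBounded (dotB d)) c5
  exact c6
end hcar

section geo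
variable {d : ℕ} {h : Phase d → ℝ} {Φ : ℝ → Phase d → Phase d}

/-- the matrix of derivatives of the momentum -/
def xiM (Φ : ℝ → Phase d → Phase d) (t : ℝ) (p : Phase d) : Matrix (Fin d) (Fin d) ℝ :=
  Matrix.of fun j k => (fderiv ℝ (Φ t) p ((0 : Fin d → ℝ), Pi.single k 1)).2 j

lemma xiM_eq (hΦ : IsCompleteFlow h Φ) {p : Phase d} (hp : p ∈ Tprime d) (t : ℝ) :
    (Matrix.of fun j k : Fin d =>
      fderiv ℝ (fun q : Phase d => (Φ t q).2 j) p ((0 : Fin d → ℝ), Pi.single k 1)) = xiM Φ t p := by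
  ext j k
  simp only [Matrix.of_apply, xiM]
  have h1 := flow_diff hΦ hp t
  have h2 := ((ContinuousLinearMap.proj (R := ℝ) (φ := fun _ : Fin d => ℝ) j).comp
    (ContinuousLinearMap.snd ℝ (Fin d → ℝ) (Fin d → ℝ))).hasFDerivAt.comp p h1
  have h3 : HasFDerivAt (fun q : Phase d => (Φ t q).2 j) _ p := h2
  rw [h3.fderiv]
  rfl

lemma fd_cont (hΦ : IsCompleteFlow h Φ) {p : Phase d} (hp : p ∈ Tprime d) (t : ℝ) (v : Phase d) (j : Fin d) :
    ContinuousAt (fun z : Phase d × ℝ => (fderiv ℝ (Φ z.2) z.1 v).2 j) (p, t) := by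
  have h1 : ContinuousAt (fun z : ℝ × Phase d => fderiv ℝ (Φ z.1) z.2) (t, p) :=
    (smooth_fderiv (flow_smooth hΦ) t p hp).continuousAt
  have h2 : ContinuousAt (fun z : Phase d × ℝ => fderiv ℝ (Φ z.2) z.1) (p, t) :=
    ContinuousAt.comp (f := fun z : Phase d × ℝ => (z.2, z.1)) (x := (p, t)) h1 (by fun_prop)
  have h3 : ContinuousAt (fun z : Phase d × ℝ => fderiv ℝ (Φ z.2) z.1 v) (p, t) :=
    h2.clm_apply continuousAt_const
  exact (continuous_apply j).continuousAt.comp (continuous_snd.continuousAt.comp h3)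

lemma xiM_cont (hΦ : IsCompleteFlow h Φ) {p : Phase d} (hp : p ∈ Tprime d) (t : ℝ) :
    ContinuousAt (fun z : Phase d × ℝ => xiM Φ z.2 z.1) (p, t) := by
  refine continuousAt_pi.2 fun j => continuousAt_pi.2 fun k => ?_
  exact fd_cont hΦ hp t _ j

lemma phF_eta (hh : HomHamiltonian h) (hΦ : IsCompleteFlow h Φ) {p : Phase d} (hp : p ∈ Tprime d) (t : ℝ)
    (k : Fin d) : fderiv ℝ (fun q => phF Φ (q, t)) p (0, Pi.single k 1) =
      Matrix.vecMul (p.1 - (Φ t p).1) (xiM Φ t p) k := by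
  rw [phF_q hh hΦ hp t]
  simp [dotB_apply, Matrix.vecMul, dotProduct, xiM]
  simp only [sub_mul, Finset.sum_sub_distrib]

lemma phF_y (hh : HomHamiltonian h) (hΦ : IsCompleteFlow h Φ) {p : Phase d} (hp : p ∈ Tprime d) (t : ℝ)
    (k : Fin d) : fderiv ℝ (fun q => phF Φ (q, t)) p (Pi.single k 1, 0) =
      ((Φ t p).2 k - p.2 k) + ∑ i, (p.1 - (Φ t p).1) i * (fderiv ℝ (Φ t) p (Pi.single k 1, 0)).2 i := by
  rw [phF_q hh hΦ hp t, dotB_apply, dotB_apply]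
  simp [Pi.single_apply]

lemma phF_grad_zero (hh : HomHamiltonian h) (hΦ : IsCompleteFlow h Φ) {p : Phase d} (hp : p ∈ Tprime d)
    (t : ℝ) (hdet : (xiM Φ t p).det ≠ 0) :
    fderiv ℝ (fun q => phF Φ (q, t)) p = 0 ↔ Φ t p = p := by
  constructor
  · intro hz
    have h1 : Matrix.vecMul (p.1 - (Φ t p).1) (xiM Φ t p) = 0 := by
      funext k
      rw [← phF_eta hh hΦ hp t k, hz]; rfl
    have h2 := Matrix.eq_zero_of_vecMul_eq_zero hdet h1
    have h3 : ∀ k, (Φ t p).2 k - p.2 k = 0 := by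
      intro k
      have := phF_y hh hΦ hp t k
      rw [hz, h2] at this
      simpa using this.symm
    refine Prod.ext (sub_eq_zero.1 h2).symm (funext fun k => sub_eq_zero.1 (h3 k))
  · intro he
    ext v
    · rw [ContinuousLinearMap.comp_apply, phF_q hh hΦ hp t, he]; simp
    · rw [ContinuousLinearMap.comp_apply, phF_q hh hΦ hp t, he]; simp

lemma phF_flat (hh : HomHamiltonian h) (hΦ : IsCompleteFlow h Φ) {p : Phase d} (hp : p ∈ Tprime d)
    (t : ℝ) (hdet : (xiM Φ t p).det ≠ 0) :
    FlatO (fun q => phF Φ (q, t)) p ↔ AbsPeriodic Φ t p := by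
  have hsm : ContDiffAt ℝ ∞ (Φ t) p := slice_smooth (flow_smooth hΦ t p hp)
  have hx : ∀ j, ContDiffAt ℝ ∞ (fun q : Phase d => (Φ t q).1 j - q.1 j) p := fun j =>
    (contDiffAt_pi.1 hsm.fst j).sub (by fun_prop)
  have hxi : ∀ j, ContDiffAt ℝ ∞ (fun q : Phase d => (Φ t q).2 j - q.2 j) p := fun j =>
    (contDiffAt_pi.1 hsm.snd j).sub (by fun_prop)
  have hdef : ContDiffAt ℝ ∞ (periodDefect Φ t) p := by
    unfold periodDefect
    exact (ContDiffAt.sum fun j _ => (hx j).pow 2).add (ContDiffAt.sum fun j _ => (hxi j).pow 2)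
  have habs : AbsPeriodic Φ t p ↔ FlatO (periodDefect Φ t) p := by
    rw [← flat_iff hdef, AbsPeriodic]
    simp only [iteratedFDerivWithin_of_isOpen _ Tprime_open hp, hp, true_and]
  have hcomp : FlatO (periodDefect Φ t) p ↔
      (∀ j, FlatO (fun q : Phase d => (Φ t q).1 j - q.1 j) p) ∧
      (∀ j, FlatO (fun q : Phase d => (Φ t q).2 j - q.2 j) p) := by
    constructor
    · intro hf
      constructor
      · intro j
        refine (hf.of_le fun q => ?_ : FlatO (fun q : Phase d => ((Φ t q).1 j - q.1 j) ^ 2) p).of_sq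
        have h1 := Finset.single_le_sum (f := fun j => ((Φ t q).1 j - q.1 j) ^ 2)
          (fun i _ => sq_nonneg _) (Finset.mem_univ j)
        have h2 := Finset.sum_nonneg (s := Finset.univ) (f := fun j => ((Φ t q).2 j - q.2 j) ^ 2)
          (fun i _ => sq_nonneg _)
        rw [abs_of_nonneg (sq_nonneg _)]
        refine le_trans ?_ (le_abs_self _)
        unfold periodDefect
        linarith
      · intro j
        refine (hf.of_le fun q => ?_ : FlatO (fun q : Phase d => ((Φ t q).2 j - q.2 j) ^ 2) p).of_sq
        have h1 := Finset.single_le_sum (f := fun j => ((Φ t q).2 j - q.2 j) ^ 2)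
          (fun i _ => sq_nonneg _) (Finset.mem_univ j)
        have h2 := Finset.sum_nonneg (s := Finset.univ) (f := fun j => ((Φ t q).1 j - q.1 j) ^ 2)
          (fun i _ => sq_nonneg _)
        rw [abs_of_nonneg (sq_nonneg _)]
        refine le_trans ?_ (le_abs_self _)
        unfold periodDefect
        linarith
    · rintro ⟨h1, h2⟩
      unfold periodDefect
      refine FlatO.add (FlatO.sum fun j _ => ?_) (FlatO.sum fun j _ => ?_)
      · simp only [pow_two]
        exact (h1 j).mul_cont (hx j).continuousAt
      · simp only [pow_two]
        exact (h2 j).mul_cont (hxi j).continuousAt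
  rw [habs, hcomp]
  have hT : ∀ᶠ q in 𝓝 p, q ∈ Tprime d := Tprime_open.mem_nhds hp
  constructor
  · intro hg
    have hgs : ContDiffAt ℝ ∞ (fun q => phF Φ (q, t)) p :=
      (phF_smooth hΦ hp t).comp (f := fun q => (q, t)) p (by fun_prop)
    have hdg := hg.fderiv hgs
    have hv : ∀ v : Phase d, FlatO (fun q => fderiv ℝ (fun q => phF Φ (q, t)) q v) p := fun v =>
      hdg.clm (ContinuousLinearMap.apply ℝ ℝ v)
    have hM : ContinuousAt (fun q => xiM Φ t q) p :=
      ContinuousAt.comp (f := fun q => (q, t)) (xiM_cont hΦ hp t) (by fun_prop)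
    have hdetc : ContinuousAt (fun q => (xiM Φ t q).det) p :=
      (Continuous.matrix_det continuous_id).continuousAt.comp hM
    have hdete : ∀ᶠ q in 𝓝 p, (xiM Φ t q).det ≠ 0 := hdetc.eventually_ne hdet
    have hinv : ContinuousAt (fun q => (xiM Φ t q)⁻¹) p := by
      simp only [Matrix.inv_def, Ring.inverse_eq_inv']
      exact (hdetc.inv₀ hdet).smul ((Continuous.matrix_adjugate continuous_id).continuousAt.comp hM)
    have hinvc : ∀ k j, ContinuousAt (fun q => (xiM Φ t q)⁻¹ k j) p := fun k j =>
      continuousAt_pi.1 (continuousAt_pi.1 hinv k) j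
    have ha : ∀ j, FlatO (fun q : Phase d => (q.1 - (Φ t q).1) j) p := by
      intro j
      refine (FlatO.sum (s := Finset.univ) fun k _ => (hv (0, Pi.single k 1)).mul_cont (hinvc k j)).congr ?_
      filter_upwards [hT, hdete] with q hq hqd
      have e1 : Matrix.vecMul (Matrix.vecMul (q.1 - (Φ t q).1) (xiM Φ t q)) (xiM Φ t q)⁻¹ = q.1 - (Φ t q).1 := by
        rw [Matrix.vecMul_vecMul, Matrix.mul_nonsing_inv _ (isUnit_iff_ne_zero.2 hqd), Matrix.vecMul_one]
      have e2 := congrFun e1 j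
      rw [← e2]
      simp only [phF_eta hh hΦ hq t]
      rfl
    refine ⟨fun j => ?_, fun j => ?_⟩
    · exact (ha j).of_le fun q => by simp [abs_sub_comm]
    · have hsum : FlatO (fun q : Phase d => ∑ i, (q.1 - (Φ t q).1) i * (fderiv ℝ (Φ t) q (Pi.single j 1, 0)).2 i) p :=
        FlatO.sum fun i _ => (ha i).mul_cont
          (ContinuousAt.comp (f := fun q => (q, t)) (fd_cont hΦ hp t _ i) (by fun_prop))
      refine ((hv (Pi.single j 1, 0)).sub hsum).congr ?_
      filter_upwards [hT] with q hq
      rw [phF_y hh hΦ hq t]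
      ring
  · rintro ⟨h1, _⟩
    have : (fun q => phF Φ (q, t)) = fun q => ∑ j, ((Φ t q).1 j - q.1 j) * (-(Φ t q).2 j) := by
      funext q
      simp only [phF, dotB_apply]
      refine Finset.sum_congr rfl fun j _ => ?_
      simp only [Pi.sub_apply]; ring
    rw [this]
    exact FlatO.sum fun j _ => (h1 j).mul_cont (contDiffAt_pi.1 hsm.snd j).continuousAt.neg

lemma flat_tau {τ : Phase d → ℝ} {p : Phase d} (hτ : ContDiffAt ℝ ∞ τ p) :
    (∀ n : ℕ, 1 ≤ n → iteratedFDeriv ℝ n τ p = 0) ↔ FlatO (fun q => τ q - τ p) p := by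
  have hw : ContDiffAt ℝ ∞ (fun q => τ q - τ p) p := hτ.sub contDiffAt_const
  rw [← flat_iff hw]
  have hfd : fderiv ℝ (fun q => τ q - τ p) = fderiv ℝ τ := by
    funext q; exact fderiv_sub_const _
  have key : ∀ n : ℕ, ‖iteratedFDeriv ℝ (n + 1) (fun q => τ q - τ p) p‖ = ‖iteratedFDeriv ℝ (n + 1) τ p‖ := by
    intro n
    rw [← norm_iteratedFDeriv_fderiv, ← norm_iteratedFDeriv_fderiv, hfd]
  constructor
  · intro hz n
    rcases n with _ | n
    · rw [← norm_eq_zero, norm_iteratedFDeriv_zero]; simp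
    · rw [← norm_eq_zero, key, hz (n + 1) (by omega), norm_zero]
  · intro hz n hn
    obtain ⟨k, rfl⟩ : ∃ k, n = k + 1 := ⟨n - 1, by omega⟩
    rw [← norm_eq_zero, ← key, hz, norm_zero]

lemma grad_tau {E : Type} [NormedAddCommGroup E] [NormedSpace ℝ E] {F : E × ℝ → ℝ} {τ : E → ℝ} {p : E}
    (hF : ContDiffAt ℝ ∞ F (p, τ p)) (hτ : ContDiffAt ℝ ∞ τ p) (h0 : ∀ᶠ q in 𝓝 p, F (q, τ q) = 0)
    (hFt : fderiv ℝ F (p, τ p) (0, 1) ≠ 0) :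
    fderiv ℝ τ p = 0 ↔ fderiv ℝ (fun q => F (q, τ p)) p = 0 := by
  have hFd := (hF.differentiableAt (by simp)).hasFDerivAt
  have hτd := (hτ.differentiableAt (by simp)).hasFDerivAt
  have h1 : HasFDerivAt (fun q => F (q, τ q)) ((fderiv ℝ F (p, τ p)).comp
      ((ContinuousLinearMap.id ℝ E).prod (fderiv ℝ τ p))) p :=
    hFd.comp (f := fun q => (q, τ q)) p ((hasFDerivAt_id p).prodMk hτd)
  have h2 : HasFDerivAt (fun q => F (q, τ q)) (0 : E →L[ℝ] ℝ) p := by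
    refine (hasFDerivAt_const (0 : ℝ) p).congr_of_eventuallyEq ?_
    filter_upwards [h0] with q hq using hq
  have h3 : fderiv ℝ (fun q => F (q, τ p)) p = (fderiv ℝ F (p, τ p)).comp (ContinuousLinearMap.inl ℝ E ℝ) :=
    (hFd.comp (f := fun q => (q, τ p)) p (hasFDerivAt_prodMk_left p (τ p))).fderiv
  have h4 : ∀ v, fderiv ℝ (fun q => F (q, τ p)) p v + fderiv ℝ τ p v * fderiv ℝ F (p, τ p) (0, 1) = 0 := by
    intro v
    have h5 := congrArg (fun L => L v) (h1.unique h2)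
    have e : ((v, fderiv ℝ τ p v) : E × ℝ) = (v, 0) + (fderiv ℝ τ p v) • ((0 : E), (1 : ℝ)) := by simp
    simp only [ContinuousLinearMap.comp_apply, ContinuousLinearMap.prod_apply,
      ContinuousLinearMap.id_apply] at h5
    rw [e, map_add, map_smul, smul_eq_mul] at h5
    rw [h3]
    exact h5
  constructor
  · intro hz
    ext v
    have := h4 v
    rw [hz] at this
    simpa using this
  · intro hz
    ext v
    have := h4 v
    rw [hz] at this
    simpa [hFt] using this
end geo

section fin
variable {d : ℕ} {m : ℕ → ℝ} {h : Phase d → ℝ} {Φ : ℝ → Phase d → Phase d}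

lemma ift_pack {E : Type} [NormedAddCommGroup E] [NormedSpace ℝ E] [CompleteSpace E]
    {F : E × ℝ → ℝ} {p : E} {t : ℝ} (hF : ContDiffAt ℝ ∞ F (p, t)) (h0 : F (p, t) = 0)
    (hFt : fderiv ℝ F (p, t) (0, 1) ≠ 0) :
    ∃ τ : E → ℝ, τ p = t ∧ ContDiffAt ℝ ∞ τ p ∧ (∀ᶠ q in 𝓝 p, F (q, τ q) = 0) ∧
      ∀ᶠ v in 𝓝 (p, t), F v = 0 ↔ τ v.1 = v.2 := by
  have hinv : (fderiv ℝ F (p, t) ∘SL ContinuousLinearMap.inr ℝ E ℝ).IsInvertible :=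
    ⟨ContinuousLinearEquiv.unitsEquivAut ℝ (Units.mk0 _ hFt), by ext; simp⟩
  have hn : (∞ : WithTop ℕ∞) ≠ 0 := by simp
  refine ⟨hF.implicitFunction hn hinv, hF.implicitFunction_apply_self hn hinv,
    hF.contDiffAt_implicitFunction hn hinv, ?_, ?_⟩
  · simpa [h0] using hF.eventually_apply_implicitFunction hn hinv
  · simpa [h0] using hF.eventually_apply_eq_iff_implicitFunction hn hinv

lemma smooth_of_ift {E : Type} [NormedAddCommGroup E] [NormedSpace ℝ E] [CompleteSpace E]
    {F : E × ℝ → ℝ} {τ : E → ℝ} {p : E} (hF : ContDiffAt ℝ ∞ F (p, τ p))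
    (h0 : ∀ᶠ q in 𝓝 p, F (q, τ q) = 0) (hτ : ContinuousAt τ p)
    (hFt : fderiv ℝ F (p, τ p) (0, 1) ≠ 0) : ContDiffAt ℝ ∞ τ p := by
  obtain ⟨σ, h1, h2, h3, h4⟩ := ift_pack hF h0.self_of_nhds hFt
  refine h2.congr_of_eventuallyEq ?_
  have h5 : ContinuousAt (fun q => (q, τ q)) p := continuousAt_id.prodMk hτ
  filter_upwards [h0, h5.eventually h4] with q hq hq2
  exact (hq2.1 hq).symm

/-- Existence of the period function `t*` (Lemma 6.1): near a `T`-periodic point with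
`det ∂ξ*/∂η (T; y₀, η₀) ≠ 0` there is a positive Carleman-class function `t*`, positively
homogeneous of degree 0 in `η`, with `t*(y₀, η₀) = T`, whose gradient vanishes exactly at
points periodic with period `t*`, and vanishes to infinite order exactly at the absolutely
`t*`-periodic points. -/
theorem exists_period_function {d : ℕ} (m : ℕ → ℝ) (hm : RegularSeq m)
    (h : Phase d → ℝ) (hh : HomHamiltonian h)
    (hhC : ∀ D : Set (Phase d), IsOpen D → IsCompact (closure D) → closure D ⊆ Tprime d →
      CarlemanClass m D h)
    (Φ : ℝ → Phase d → Phase d) (hΦ : IsCompleteFlow h Φ)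
    (T : ℝ) (hT : 0 < T) (p₀ : Phase d) (hp₀ : p₀ ∈ Tprime d) (hper : Φ T p₀ = p₀)
    (hnd : (Matrix.of fun j k : Fin d =>
      fderiv ℝ (fun q : Phase d => (Φ T q).2 j) p₀ ((0 : Fin d → ℝ), Pi.single k 1)).det ≠ 0) :
    ∃ V : Set (Phase d), IsOpen V ∧ p₀ ∈ V ∧ V ⊆ Tprime d ∧
      ∃ tstar : Phase d → ℝ,
        (∀ p ∈ V, 0 < tstar p) ∧
        tstar p₀ = T ∧
        (∀ p ∈ V, ∀ c : ℝ, 0 < c → (p.1, c • p.2) ∈ V → tstar (p.1, c • p.2) = tstar p) ∧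
        (∀ D : Set (Phase d), IsOpen D → IsCompact (closure D) → closure D ⊆ V →
          CarlemanClass m D tstar) ∧
        (∀ p ∈ V, (fderiv ℝ tstar p = 0 ↔ Φ (tstar p) p = p)) ∧
        (∀ p ∈ V, ((∀ n : ℕ, 1 ≤ n → iteratedFDeriv ℝ n tstar p = 0) ↔
          AbsPeriodic Φ (tstar p) p)) := by
  rw [xiM_eq hΦ hp₀ T] at hnd
  have hF0 : phF Φ (p₀, T) = 0 := by simp [phF, hper]
  have hFs := phF_smooth hΦ hp₀ T
  have hFt : fderiv ℝ (phF Φ) (p₀, T) (0, 1) ≠ 0 := by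
    rw [phF_t hh hΦ hp₀ T, hper]
    simpa using (hh.2.1 p₀ hp₀).ne'
  obtain ⟨τ, hτT, hτs, hτ0, hτu⟩ := ift_pack hFs hF0 hFt
  have hpair : ContinuousAt (fun q => (q, τ q)) p₀ := continuousAt_id.prodMk hτs.continuousAt
  have hpair' : Tendsto (fun q => (q, τ q)) (𝓝 p₀) (𝓝 (p₀, T)) := by
    have := hpair.tendsto
    rwa [hτT] at this
  have e1 : ∀ᶠ q in 𝓝 p₀, q ∈ Tprime d := Tprime_open.mem_nhds hp₀
  have e2 : ∀ᶠ q in 𝓝 p₀, 0 < τ q :=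
    hτs.continuousAt.eventually (lt_mem_nhds (by rw [hτT]; exact hT))
  have e3 : ∀ᶠ q in 𝓝 p₀, fderiv ℝ (phF Φ) (q, τ q) (0, 1) ≠ 0 := by
    have hc : ContinuousAt (fun z => fderiv ℝ (phF Φ) z (0, 1)) (p₀, T) :=
      ((hFs.fderiv_right (m := ∞) (by simp)).continuousAt).clm_apply continuousAt_const
    exact hpair'.eventually (hc.eventually_ne hFt)
  have e4 : ∀ᶠ q in 𝓝 p₀, (xiM Φ (τ q) q).det ≠ 0 := by
    have hc : ContinuousAt (fun z : Phase d × ℝ => (xiM Φ z.2 z.1).det) (p₀, T) :=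
      (Continuous.matrix_det continuous_id).continuousAt.comp (xiM_cont hΦ hp₀ T)
    exact hpair'.eventually (hc.eventually_ne hnd)
  have e5 : ∀ᶠ q in 𝓝 p₀, ContinuousAt τ q := by
    have := (hτs.of_le (m := 1) (by simp)).eventually (by simp)
    filter_upwards [this] with q hq using hq.continuousAt
  rw [nhds_prod_eq] at hτu
  obtain ⟨W1, hW1, W2, hW2, hW⟩ := Filter.mem_prod_iff.1 hτu
  have e6 : ∀ᶠ q in 𝓝 p₀, q ∈ W1 := hW1
  have e7 : ∀ᶠ q in 𝓝 p₀, τ q ∈ W2 :=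
    hτs.continuousAt.eventually (by rw [hτT]; exact hW2)
  obtain ⟨V, hV, hVo, hpV⟩ := eventually_nhds_iff.1
    (e1.and (e2.and (e3.and (e4.and (e5.and (e6.and (e7.and hτ0)))))))
  have hVs : ∀ q ∈ V, ∀ᶠ z in 𝓝 q, phF Φ (z, τ z) = 0 := fun q hq => by
    filter_upwards [hVo.mem_nhds hq] with z hz using (hV z hz).2.2.2.2.2.2.2
  have hsm : ∀ q ∈ V, ContDiffAt ℝ ∞ τ q := fun q hq => by
    obtain ⟨a1, a2, a3, a4, a5, a6, a7, a8⟩ := hV q hq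
    exact smooth_of_ift (phF_smooth hΦ a1 _) (hVs q hq) a5 a3
  refine ⟨V, hVo, hpV, fun q hq => (hV q hq).1, τ, fun q hq => (hV q hq).2.1, hτT, ?_, ?_, ?_, ?_⟩
  · intro p hp c hc hcp
    obtain ⟨a1, a2, a3, a4, a5, a6, a7, a8⟩ := hV p hp
    have b6 := (hV _ hcp).2.2.2.2.2.1
    have hz : phF Φ ((p.1, c • p.2), τ p) = 0 := by
      have := phF_scal hh hΦ a1 hc (τ p)
      rw [scal_apply] at this
      rw [this, a8, mul_zero]
    exact (hW (Set.mk_mem_prod b6 a7)).1 hz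
  · intro D hD hDc hDV
    refine (carlemanClass_iff hD).2 (Car.mono ?_ subset_closure)
    refine implicit_car (F := phF Φ) hm hVo hsm (fun q hq => (hV q hq).2.2.2.2.2.2.2) ?_
      (fun q hq => (hV q hq).2.2.1) hDc hDV
    intro K hKV hK
    refine phF_car hm hhC hΦ (hK.image_of_continuousOn ?_) ?_
    · exact fun q hq => (continuousAt_id.prodMk (hV q (hKV hq)).2.2.2.2.1).continuousWithinAt
    · rintro _ ⟨q, hq, rfl⟩
      exact (hV q (hKV hq)).1
  · intro p hp
    obtain ⟨a1, a2, a3, a4, a5, a6, a7, a8⟩ := hV p hp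
    rw [grad_tau (phF_smooth hΦ a1 _) (hsm p hp) (hVs p hp) a3]
    exact phF_grad_zero hh hΦ a1 _ a4
  · intro p hp
    obtain ⟨a1, a2, a3, a4, a5, a6, a7, a8⟩ := hV p hp
    rw [flat_tau (hsm p hp), flat_implicit (phF_smooth hΦ a1 _) a5 (hVs p hp) a3]
    exact phF_flat hh hΦ a1 _ a4

end fin
end
end

section
/- Let f satisfy the stated conditions, let α ∈ (0, π/2), and let (θ, φ) : ℝ → ℝ² be a solution of the Euler–Lagrange equations with θ(0) = 0, φ̇(0) = cos α, and unit speed at t = 0. Then the latitude coordinate is periodic with the explicit period T_*(α): θ(t + T_*(α)) = θ(t) for all t ∈ ℝ. -/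
open Real Set Filter MeasureTheory
open scoped BigOperators Topology

noncomputable section

/-- The conditions on the profile function `f` of the surface of revolution:
`f` is `C^∞` on `(−π/2, π/2)`, `f 0 = 0` and `1 + f ψ > |sin ψ|`. -/
def SurfaceFun (f : ℝ → ℝ) : Prop :=
  ContDiffOn ℝ (⊤ : ℕ∞) f (Set.Ioo (-(π / 2)) (π / 2)) ∧
  f 0 = 0 ∧
  ∀ ψ ∈ Set.Ioo (-(π / 2)) (π / 2), |Real.sin ψ| < 1 + f ψ

/-- `(θ, φ)` solves the Euler–Lagrange equations of the Lagrangian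
`L = φ̇² cos²θ + θ̇² (1 + f θ)²` on the set `I`. -/
def IsELGeodesicOn (f θ φ : ℝ → ℝ) (I : Set ℝ) : Prop :=
  ContDiff ℝ 2 θ ∧ ContDiff ℝ 2 φ ∧
  (∀ t ∈ I, deriv (fun s => deriv φ s * Real.cos (θ s) ^ 2) t = 0) ∧
  (∀ t ∈ I, deriv (deriv θ) t * (1 + f (θ t)) ^ 2
      + (deriv θ t) ^ 2 * (1 + f (θ t)) * deriv f (θ t)
      + (deriv φ t) ^ 2 * Real.cos (θ t) * Real.sin (θ t) = 0)

/-- `f̃(θ) = (f(θ) + f(−θ))/2`. -/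
def tildeF (f : ℝ → ℝ) (θ : ℝ) : ℝ := (f θ + f (-θ)) / 2

/-- The period `T_*(α)` of the latitude coordinate of a geodesic crossing the equator
at angle `α`. -/
def Tper (f : ℝ → ℝ) (α : ℝ) : ℝ :=
  2 * π + 2 * ∫ θ in (-α)..α,
    tildeF f θ * Real.cos θ / Real.sqrt (Real.cos θ ^ 2 - Real.cos α ^ 2)

/-- The angular shift `R(α)` (minus `2π`) over one latitude period. -/
def Rshift (f : ℝ → ℝ) (α : ℝ) : ℝ :=
  2 * Real.cos α * ∫ θ in (-α)..α,
    tildeF f θ / (Real.cos θ * Real.sqrt (Real.cos θ ^ 2 - Real.cos α ^ 2))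


def sig (α s : ℝ) : ℝ := Real.arcsin (Real.sin α * Real.sin s)

lemma sin_sig (α s : ℝ) : Real.sin (sig α s) = Real.sin α * Real.sin s := by
  have h : |Real.sin α * Real.sin s| ≤ 1 := by
    rw [abs_mul]
    exact mul_le_one₀ (Real.abs_sin_le_one _) (abs_nonneg _) (Real.abs_sin_le_one _)
  exact Real.sin_arcsin (abs_le.1 h).1 (abs_le.1 h).2

lemma sig_cont (α : ℝ) : Continuous (sig α) := by
  unfold sig; fun_prop

lemma sina_mem {α : ℝ} (hα : α ∈ Set.Ioo 0 (π / 2)) : 0 < Real.sin α ∧ Real.sin α < 1 := by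
  refine ⟨Real.sin_pos_of_pos_of_lt_pi hα.1 (by linarith [hα.2, Real.pi_pos]), ?_⟩
  have := Real.sin_lt_sin_of_lt_of_le_pi_div_two (by linarith [hα.1, Real.pi_pos]) le_rfl hα.2
  simpa using this

lemma sprod_mem {α : ℝ} (hα : α ∈ Set.Ioo 0 (π / 2)) (s : ℝ) :
    -1 < Real.sin α * Real.sin s ∧ Real.sin α * Real.sin s < 1 := by
  obtain ⟨h0, h1⟩ := sina_mem hα
  constructor <;> nlinarith [Real.neg_one_le_sin s, Real.sin_le_one s]

lemma sig_mem {α : ℝ} (hα : α ∈ Set.Ioo 0 (π / 2)) (s : ℝ) :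
    sig α s ∈ Set.Ioo (-(π / 2)) (π / 2) := by
  obtain ⟨h0, h1⟩ := sprod_mem hα s
  exact ⟨Real.neg_pi_div_two_lt_arcsin.2 h0, Real.arcsin_lt_pi_div_two.2 h1⟩

lemma sig_neg (α s : ℝ) : sig α (-s) = - sig α s := by
  simp [sig, Real.arcsin_neg]

lemma fsig_cont {f : ℝ → ℝ} (hf : SurfaceFun f) {α : ℝ} (hα : α ∈ Set.Ioo 0 (π / 2)) :
    Continuous (fun s => f (sig α s)) :=
  hf.1.continuousOn.comp_continuous (sig_cont α) (sig_mem hα)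

lemma sig_deriv {α : ℝ} (hα : α ∈ Set.Ioo 0 (π / 2)) (s : ℝ) :
    HasDerivAt (sig α) (Real.sin α * Real.cos s / Real.cos (sig α s)) s := by
  obtain ⟨h0, h1⟩ := sprod_mem hα s
  have := (Real.hasDerivAt_arcsin h0.ne' h1.ne).comp s ((Real.hasDerivAt_sin s).const_mul (Real.sin α))
  refine HasDerivAt.congr_deriv (this) (Eq.symm ?_)
  simp only [sig]; rw [Real.cos_arcsin]; ring

lemma sig_image {α : ℝ} (hα : α ∈ Set.Ioo 0 (π / 2)) :
    sig α '' Set.Ioo (-(π / 2)) (π / 2) = Set.Ioo (-α) α := by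
  obtain ⟨h0, h1⟩ := sina_mem hα
  ext x
  constructor
  · rintro ⟨s, hs, rfl⟩
    have hm := sig_mem hα s
    have e := sin_sig α s
    have c1 : Real.sin s < 1 := by
      simpa using Real.sin_lt_sin_of_lt_of_le_pi_div_two hs.1.le le_rfl hs.2
    have c2 : -1 < Real.sin s := by
      simpa using Real.sin_lt_sin_of_lt_of_le_pi_div_two le_rfl hs.2.le hs.1
    have a1 : -(π / 2) ≤ α ∧ α ≤ π / 2 := ⟨by linarith [hα.1, Real.pi_pos], hα.2.le⟩
    constructor
    · refine (Real.strictMonoOn_sin.lt_iff_lt ⟨by linarith [a1.2], by linarith [a1.1]⟩ ⟨hm.1.le, hm.2.le⟩).1 ?_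
      rw [e, Real.sin_neg]; nlinarith
    · refine (Real.strictMonoOn_sin.lt_iff_lt ⟨hm.1.le, hm.2.le⟩ a1).1 ?_
      rw [e]; nlinarith
  · rintro ⟨hx1, hx2⟩
    have c1 : Real.sin x < Real.sin α :=
      Real.sin_lt_sin_of_lt_of_le_pi_div_two (by linarith [hα.2]) hα.2.le hx2
    have c2 : -Real.sin α < Real.sin x := by
      rw [← Real.sin_neg]
      exact Real.sin_lt_sin_of_lt_of_le_pi_div_two (by linarith [hα.2]) (by linarith [hα.2]) hx1
    have d1 : Real.sin x / Real.sin α < 1 := by rw [div_lt_one h0]; exact c1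
    have d2 : -1 < Real.sin x / Real.sin α := by rw [lt_div_iff₀ h0]; linarith
    refine ⟨Real.arcsin (Real.sin x / Real.sin α),
      ⟨Real.neg_pi_div_two_lt_arcsin.2 d2, Real.arcsin_lt_pi_div_two.2 d1⟩, ?_⟩
    rw [sig, Real.sin_arcsin d2.le d1.le, mul_div_cancel₀ _ h0.ne',
      Real.arcsin_sin (by linarith [hα.2]) (by linarith [hα.2])]

lemma sig_inj {α : ℝ} (hα : α ∈ Set.Ioo 0 (π / 2)) :
    Set.InjOn (sig α) (Set.Ioo (-(π / 2)) (π / 2)) := by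
  obtain ⟨h0, h1⟩ := sina_mem hα
  intro x hx y hy h
  have h2 := congrArg Real.sin h
  rw [sin_sig, sin_sig] at h2
  exact Real.injOn_sin ⟨hx.1.le, hx.2.le⟩ ⟨hy.1.le, hy.2.le⟩ (mul_left_cancel₀ h0.ne' h2)

lemma subst_int {α : ℝ} (hα : α ∈ Set.Ioo 0 (π / 2)) (g : ℝ → ℝ) :
    (∫ θ in (-α)..α, g θ * Real.cos θ / Real.sqrt (Real.cos θ ^ 2 - Real.cos α ^ 2))
      = ∫ s in (-(π / 2))..(π / 2), g (sig α s) := by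
  obtain ⟨h0, h1⟩ := sina_mem hα
  rw [intervalIntegral.integral_of_le (by linarith [hα.1]),
    intervalIntegral.integral_of_le (by linarith [Real.pi_pos]),
    MeasureTheory.integral_Ioc_eq_integral_Ioo, MeasureTheory.integral_Ioc_eq_integral_Ioo,
    ← sig_image hα,
    MeasureTheory.integral_image_eq_integral_abs_deriv_smul measurableSet_Ioo
      (fun x _ => (sig_deriv hα x).hasDerivWithinAt) (sig_inj hα)]
  refine MeasureTheory.setIntegral_congr_fun measurableSet_Ioo ?_
  intro s hs
  have hc : 0 < Real.cos s := Real.cos_pos_of_mem_Ioo hs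
  have hc2 : 0 < Real.cos (sig α s) := Real.cos_pos_of_mem_Ioo (sig_mem hα s)
  have e : Real.cos (sig α s) ^ 2 - Real.cos α ^ 2 = (Real.sin α * Real.cos s) ^ 2 := by
    rw [Real.cos_sq', Real.cos_sq', sin_sig, mul_pow, mul_pow, Real.cos_sq']; ring
  simp only [smul_eq_mul]
  rw [e, Real.sqrt_sq (by positivity), abs_of_pos (by positivity)]
  field_simp

lemma T_eq {f : ℝ → ℝ} (hf : SurfaceFun f) {α : ℝ} (hα : α ∈ Set.Ioo 0 (π / 2)) :
    ∫ s in (0:ℝ)..(2 * π), (1 + f (sig α s)) = Tper f α := by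
  have hc := fsig_cont hf hα
  have hi : ∀ a b, IntervalIntegrable (fun s => f (sig α s)) volume a b :=
    fun a b => hc.intervalIntegrable a b
  have hper : Function.Periodic (fun s => f (sig α s)) (2 * π) := by
    intro s; simp [sig]
  have e1 : ∫ s in (0:ℝ)..(2 * π), f (sig α s) = ∫ s in (-(π/2))..(-(π/2) + 2 * π), f (sig α s) := by
    have := hper.intervalIntegral_add_eq 0 (-(π/2))
    simpa using this
  have e2 : ∫ s in (π/2)..(-(π/2) + 2 * π), f (sig α s) = ∫ s in (-(π/2))..(π/2), f (sig α s) := by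
    have := intervalIntegral.integral_comp_sub_left (fun s => f (sig α s)) (a := -(π/2)) (b := π/2) π
    have h3 : ∀ x, f (sig α (π - x)) = f (sig α x) := by intro x; simp [sig, Real.sin_pi_sub]
    simp only [h3] at this
    rw [this]; congr 1 <;> ring
  have e3 : ∫ s in (-(π/2))..(π/2), f (-sig α s) = ∫ s in (-(π/2))..(π/2), f (sig α s) := by
    have := intervalIntegral.integral_comp_neg (fun s => f (sig α s)) (a := -(π/2)) (b := π/2)
    simp only [sig_neg, neg_neg] at this
    exact this
  have hi2 : ∀ a b, IntervalIntegrable (fun s => f (-sig α s)) volume a b := by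
    intro a b
    have : Continuous (fun s => f (sig α (-s))) := hc.comp continuous_neg
    simp only [sig_neg] at this
    exact this.intervalIntegrable a b
  rw [Tper, subst_int hα, intervalIntegral.integral_add (by simp) (hi _ _), e1,
    ← intervalIntegral.integral_add_adjacent_intervals (hi _ (π/2)) (hi _ _), e2]
  have e4 : ∫ s in (-(π/2))..(π/2), tildeF f (sig α s) = ∫ s in (-(π/2))..(π/2), f (sig α s) := by
    simp only [tildeF]
    rw [intervalIntegral.integral_div, intervalIntegral.integral_add (hi _ _) (hi2 _ _), e3]
    ring
  rw [e4]
  simp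
  ring

/-- The latitude coordinate of a geodesic crossing the equator at angle `α` is periodic
with period `T_*(α)`. -/
theorem latitude_periodic (f : ℝ → ℝ) (hf : SurfaceFun f)
    (α : ℝ) (hα : α ∈ Set.Ioo 0 (π / 2))
    (θ φ : ℝ → ℝ) (hEL : IsELGeodesicOn f θ φ Set.univ)
    (hθ0 : θ 0 = 0) (hφ'0 : deriv φ 0 = Real.cos α)
    (hunit : (deriv φ 0) ^ 2 * Real.cos (θ 0) ^ 2
      + (deriv θ 0) ^ 2 * (1 + f (θ 0)) ^ 2 = 1) :
    ∀ t : ℝ, θ (t + Tper f α) = θ t := by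
  obtain ⟨hθc, hφc, hp, hq⟩ := hEL
  obtain ⟨sa0, sa1⟩ := sina_mem hα
  have ca0 : 0 < Real.cos α := Real.cos_pos_of_mem_Ioo ⟨by linarith [hα.1, Real.pi_pos], hα.2⟩
  have dθ : ∀ t, HasDerivAt θ (deriv θ t) t := fun t =>
    ((hθc.differentiable (by norm_num)) t).hasDerivAt
  have ddθ : ∀ t, HasDerivAt (deriv θ) (deriv (deriv θ) t) t := fun t =>
    (((contDiff_succ_iff_deriv (n := 1)).1 hθc).2.2.differentiable (by norm_num) t).hasDerivAt
  have ddφ : Differentiable ℝ (deriv φ) :=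
    ((contDiff_succ_iff_deriv (n := 1)).1 hφc).2.2.differentiable (by norm_num)
  have hmom : ∀ t, deriv φ t * Real.cos (θ t) ^ 2 = Real.cos α := by
    intro t
    have := is_const_of_deriv_eq_zero (f := fun s => deriv φ s * Real.cos (θ s) ^ 2)
      (ddφ.mul (((hθc.differentiable (by norm_num)).cos).pow 2)) (fun t => hp t trivial) t 0
    simpa [hθ0, hφ'0] using this
  have hcne : ∀ t, Real.cos (θ t) ≠ 0 := by
    intro t h
    have := hmom t
    rw [h] at this
    simp at this
    linarith
  have hmem : ∀ t, θ t ∈ Set.Ioo (-(π / 2)) (π / 2) := by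
    intro t
    have hconn : (Set.range θ).OrdConnected := (isPreconnected_range hθc.continuous).ordConnected
    constructor
    · by_contra! h
      have : -(π/2) ∈ Set.range θ :=
        hconn.out ⟨t, rfl⟩ ⟨0, rfl⟩ ⟨h, by rw [hθ0]; linarith [Real.pi_pos]⟩
      obtain ⟨u, hu⟩ := this
      exact hcne u (by rw [hu]; simp)
    · by_contra! h
      have : π/2 ∈ Set.range θ :=
        hconn.out ⟨0, rfl⟩ ⟨t, rfl⟩ ⟨by rw [hθ0]; linarith [Real.pi_pos], h⟩
      obtain ⟨u, hu⟩ := this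
      exact hcne u (by rw [hu]; simp)
  have hFpos : ∀ x ∈ Set.Ioo (-(π / 2)) (π / 2), 0 < 1 + f x := fun x hx =>
    lt_of_le_of_lt (abs_nonneg _) (hf.2.2 x hx)
  have hpos : ∀ t, 0 < 1 + f (θ t) := fun t => hFpos _ (hmem t)
  have df : ∀ t, HasDerivAt f (deriv f (θ t)) (θ t) := fun t =>
    ((hf.1.contDiffAt (Ioo_mem_nhds (hmem t).1 (hmem t).2)).differentiableAt (by simp)).hasDerivAt
  have dF : ∀ t, HasDerivAt (fun s => 1 + f (θ s)) (deriv f (θ t) * deriv θ t) t := fun t =>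
    ((df t).comp t (dθ t)).const_add 1
  have dv : ∀ t, HasDerivAt (fun s => deriv θ s * (1 + f (θ s)))
      (-(deriv φ t) ^ 2 * Real.cos (θ t) * Real.sin (θ t) / (1 + f (θ t))) t := by
    intro t
    refine HasDerivAt.congr_deriv ((ddθ t).mul (dF t)) (Eq.symm ?_)
    have := hq t trivial
    have h0 := (hpos t).ne'
    rw [div_eq_iff h0]
    linear_combination -this
  have hφ : ∀ t, deriv φ t = Real.cos α / Real.cos (θ t) ^ 2 := fun t => by
    rw [eq_div_iff (pow_ne_zero 2 (hcne t)), hmom]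
  have hE : ∀ t, Real.cos α ^ 2 / Real.cos (θ t) ^ 2 + (deriv θ t * (1 + f (θ t))) ^ 2 = 1 := by
    have hd : ∀ t, HasDerivAt (fun t => Real.cos α ^ 2 / Real.cos (θ t) ^ 2
        + (deriv θ t * (1 + f (θ t))) ^ 2) 0 t := by
      intro t
      have h1 := ((hasDerivAt_const t (Real.cos α ^ 2)).div (((dθ t).cos).pow 2)
        (pow_ne_zero 2 (hcne t))).add ((dv t).pow 2)
      refine HasDerivAt.congr_deriv (h1) (Eq.symm ?_)
      have h0 := (hpos t).ne'
      have h2 := hcne t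
      try simp only [Pi.pow_apply]
      rw [hφ t]
      field_simp
      push_cast
      ring
    intro t
    have := is_const_of_deriv_eq_zero (fun t => (hd t).differentiableAt) (fun t => (hd t).deriv) t 0
    beta_reduce at this
    rw [this]
    rw [hφ'0, hθ0] at hunit
    rw [hθ0]
    simp at hunit ⊢
    linear_combination hunit
  set x : ℝ → ℝ := fun t => Real.sin (θ t) / Real.sin α with hx
  set y : ℝ → ℝ := fun t => deriv θ t * (1 + f (θ t)) * Real.cos (θ t) / Real.sin α with hy
  set w : ℝ → ℝ := fun t => 1 / (1 + f (θ t)) with hw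
  have wc : Continuous w := by
    have : Continuous (fun s => 1 + f (θ s)) :=
      continuous_iff_continuousAt.2 fun t => (dF t).continuousAt
    exact continuous_const.div this (fun t => (hpos t).ne')
  have dx : ∀ t, HasDerivAt x (y t * w t) t := by
    intro t
    refine HasDerivAt.congr_deriv (((dθ t).sin).div_const (Real.sin α)) (Eq.symm ?_)
    have h0 := (hpos t).ne'
    simp only [hy, hw]
    field_simp
  have dy : ∀ t, HasDerivAt y (-x t * w t) t := by
    intro t
    refine HasDerivAt.congr_deriv (((dv t).mul (dθ t).cos).div_const (Real.sin α)) (Eq.symm ?_)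
    have h0 := (hpos t).ne'
    have h2 := hcne t
    have h3 := hE t
    simp only [hx, hw]
    rw [hφ t]
    field_simp at h3 ⊢
    linear_combination (Real.sin (θ t)) * h3
  have hx0 : x 0 = 0 := by simp [hx, hθ0]
  have hy0 : y 0 = 1 ∨ y 0 = -1 := by
    have h1 := hE 0
    have h2 := Real.sin_sq_add_cos_sq α
    have h3 : y 0 ^ 2 = 1 := by
      simp only [hy]
      rw [hθ0] at h1 ⊢
      simp only [Real.cos_zero, mul_one, one_pow, div_one] at h1 ⊢
      rw [div_pow, div_eq_one_iff_eq (by positivity)]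
      linarith
    simpa using h3
  obtain ⟨ψ0, hs0, hc0⟩ : ∃ ψ0, Real.sin ψ0 = 0 ∧ Real.cos ψ0 = y 0 := by
    rcases hy0 with h | h
    · exact ⟨0, by simp, by simp [h]⟩
    · exact ⟨π, by simp, by simp [h]⟩
  set ψ : ℝ → ℝ := fun t => ψ0 + ∫ s in (0:ℝ)..t, w s with hψ
  have dψ : ∀ t, HasDerivAt ψ (w t) t := fun t =>
    (intervalIntegral.integral_hasDerivAt_right (wc.intervalIntegrable _ _)
      (wc.stronglyMeasurableAtFilter _ _) wc.continuousAt).const_add ψ0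
  have hψ0 : ψ 0 = ψ0 := by simp [hψ]
  have hA : ∀ t, x t * Real.cos (ψ t) - y t * Real.sin (ψ t) = 0 := by
    have hd : ∀ t, HasDerivAt (fun t => x t * Real.cos (ψ t) - y t * Real.sin (ψ t)) 0 t := by
      intro t
      refine HasDerivAt.congr_deriv (((dx t).mul (dψ t).cos).sub ((dy t).mul (dψ t).sin)) (Eq.symm ?_)
      ring
    intro t
    have := is_const_of_deriv_eq_zero (fun t => (hd t).differentiableAt) (fun t => (hd t).deriv) t 0
    beta_reduce at this
    rw [this, hx0, hψ0, hs0]; ring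
  have hB : ∀ t, x t * Real.sin (ψ t) + y t * Real.cos (ψ t) = 1 := by
    have hd : ∀ t, HasDerivAt (fun t => x t * Real.sin (ψ t) + y t * Real.cos (ψ t)) 0 t := by
      intro t
      refine HasDerivAt.congr_deriv (((dx t).mul (dψ t).sin).add ((dy t).mul (dψ t).cos)) (Eq.symm ?_)
      ring
    intro t
    have := is_const_of_deriv_eq_zero (fun t => (hd t).differentiableAt) (fun t => (hd t).deriv) t 0
    beta_reduce at this
    rw [this, hx0, hψ0, hs0, hc0]
    rcases hy0 with h | h <;> rw [h] <;> norm_num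
  have hxs : ∀ t, x t = Real.sin (ψ t) := by
    intro t
    linear_combination Real.cos (ψ t) * hA t + Real.sin (ψ t) * hB t
      - x t * Real.sin_sq_add_cos_sq (ψ t)
  have hθψ : ∀ t, θ t = sig α (ψ t) := by
    intro t
    have h1 : Real.sin α * Real.sin (ψ t) = Real.sin (θ t) := by
      rw [← hxs t]; simp only [hx]; field_simp
    rw [sig, h1, Real.arcsin_sin (hmem t).1.le (hmem t).2.le]
  set h : ℝ → ℝ := fun s => 1 + f (sig α s) with hh
  have hcont : Continuous h := continuous_const.add (fsig_cont hf hα)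
  have hhpos : ∀ s, 0 < h s := fun s => hFpos _ (sig_mem hα s)
  have hii : ∀ a b, IntervalIntegrable h volume a b := fun a b => hcont.intervalIntegrable a b
  set G : ℝ → ℝ := fun u => ∫ s in (0:ℝ)..u, h s with hG
  have dG : ∀ u, HasDerivAt G (h u) u := fun u =>
    intervalIntegral.integral_hasDerivAt_right (hii _ _)
      (hcont.stronglyMeasurableAtFilter _ _) hcont.continuousAt
  have hGm : StrictMono G := strictMono_of_deriv_pos (fun u => by rw [(dG u).deriv]; exact hhpos u)
  have hper : Function.Periodic h (2 * π) := by
    intro s; simp [hh, sig]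
  have hGT : ∀ u, G (u + 2 * π) = G u + Tper f α := by
    intro u
    simp only [hG]
    rw [← intervalIntegral.integral_add_adjacent_intervals (hii 0 u) (hii u _),
      hper.intervalIntegral_add_eq u 0, zero_add, T_eq hf hα]
  have hGψ : ∀ t, G (ψ t) = t + G ψ0 := by
    have hd : ∀ t, HasDerivAt (fun t => G (ψ t) - t) 0 t := by
      intro t
      refine HasDerivAt.congr_deriv (((dG (ψ t)).comp t (dψ t)).sub (hasDerivAt_id t)) (Eq.symm ?_)
      simp only [hh, hw]
      rw [← hθψ t, mul_one_div_cancel (hpos t).ne', sub_self]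
    intro t
    have := is_const_of_deriv_eq_zero (fun t => (hd t).differentiableAt) (fun t => (hd t).deriv) t 0
    simp only [hψ0] at this
    linarith
  intro t
  have key : ψ (t + Tper f α) = ψ t + 2 * π := by
    apply hGm.injective
    rw [hGT, hGψ, hGψ]; ring
  rw [hθψ, hθψ t, key]
  simp [sig]
end
end

section
/- Let f satisfy the stated conditions, let α ∈ (0, π/2), and let (θ, φ) : ℝ → ℝ² be a solution of the Euler–Lagrange equations with θ(0) = 0, φ̇(0) = cos α, and unit speed at t = 0. Then for every t ∈ ℝ, φ(t + T_*(α)) = φ(t) + 2π + R(α). -/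
open Real Set Filter MeasureTheory
open scoped BigOperators Topology

noncomputable section

set_option linter.unusedSimpArgs false

/-- Latitude as a function of the phase. -/
def Th (α v : ℝ) : ℝ := Real.arcsin (Real.sin α * Real.sin v)

lemma sinA_pos {α : ℝ} (hα : α ∈ Set.Ioo 0 (π / 2)) : 0 < Real.sin α :=
  Real.sin_pos_of_pos_of_lt_pi hα.1 (by linarith [hα.2, Real.pi_pos])

lemma cosA_pos {α : ℝ} (hα : α ∈ Set.Ioo 0 (π / 2)) : 0 < Real.cos α :=
  Real.cos_pos_of_mem_Ioo ⟨by linarith [hα.1, Real.pi_pos], hα.2⟩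

lemma arg_mem {α : ℝ} (hα : α ∈ Set.Ioo 0 (π / 2)) (v : ℝ) :
    -1 < Real.sin α * Real.sin v ∧ Real.sin α * Real.sin v < 1 := by
  have h1 := sinA_pos hα
  have h2 := cosA_pos hα
  have h3 := Real.sin_sq_add_cos_sq α
  have h4 := Real.neg_one_le_sin v
  have h5 := Real.sin_le_one v
  have h6 : Real.sin α < 1 := by nlinarith
  constructor <;> nlinarith

lemma sin_Th {α : ℝ} (hα : α ∈ Set.Ioo 0 (π / 2)) (v : ℝ) :
    Real.sin (Th α v) = Real.sin α * Real.sin v :=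
  Real.sin_arcsin (arg_mem hα v).1.le (arg_mem hα v).2.le

lemma Th_mem {α : ℝ} (hα : α ∈ Set.Ioo 0 (π / 2)) (v : ℝ) :
    Th α v ∈ Set.Ioo (-(π / 2)) (π / 2) :=
  ⟨Real.neg_pi_div_two_lt_arcsin.2 (arg_mem hα v).1, Real.arcsin_lt_pi_div_two.2 (arg_mem hα v).2⟩

lemma cos_Th_pos {α : ℝ} (hα : α ∈ Set.Ioo 0 (π / 2)) (v : ℝ) : 0 < Real.cos (Th α v) :=
  Real.cos_pos_of_mem_Ioo (Th_mem hα v)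

lemma cos_sq_Th {α : ℝ} (hα : α ∈ Set.Ioo 0 (π / 2)) (v : ℝ) :
    Real.cos (Th α v) ^ 2 = 1 - (Real.sin α * Real.sin v) ^ 2 := by
  rw [Real.cos_sq', sin_Th hα]

lemma Th_cont (α : ℝ) : Continuous (Th α) := by
  unfold Th; fun_prop

lemma Th_neg (α v : ℝ) : Th α (-v) = - Th α v := by
  simp [Th, Real.arcsin_neg]

lemma Th_pi_sub (α v : ℝ) : Th α (π - v) = Th α v := by
  simp [Th]

lemma Th_per (α v : ℝ) : Th α (v + 2 * π) = Th α v := by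
  simp [Th]

lemma Th_hasDeriv {α : ℝ} (hα : α ∈ Set.Ioo 0 (π / 2)) (v : ℝ) :
    HasDerivAt (Th α) (Real.sin α * Real.cos v / Real.cos (Th α v)) v := by
  have h := (Real.hasDerivAt_arcsin (arg_mem hα v).1.ne' (arg_mem hα v).2.ne).comp v
    ((Real.hasDerivAt_sin v).const_mul (Real.sin α))
  have e : Real.cos (Th α v) = √(1 - (Real.sin α * Real.sin v) ^ 2) := by
    rw [Th, Real.cos_arcsin]
  rw [e]
  refine HasDerivAt.congr_deriv (h) ?_
  symm
  try simp only [Pi.mul_apply, Pi.add_apply, Pi.sub_apply, Pi.pow_apply, Pi.div_apply, Nat.cast_ofNat, Nat.add_one_sub_one, pow_one, zero_mul, Function.comp_apply]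
  ring

lemma Th_image {α : ℝ} (hα : α ∈ Set.Ioo 0 (π / 2)) :
    Th α '' Set.Ioo (-(π / 2)) (π / 2) = Set.Ioo (-α) α := by
  have hs := sinA_pos hα
  have hπ := Real.pi_pos
  have e : Real.arcsin (Real.sin α) = α :=
    Real.arcsin_sin (by linarith [hα.1]) hα.2.le
  ext x
  constructor
  · rintro ⟨v, hv, rfl⟩
    have h1 : Real.sin v < 1 := by
      have := Real.strictMonoOn_sin ⟨hv.1.le, hv.2.le⟩ ⟨by linarith, le_refl _⟩ hv.2
      simpa using this
    have h2 : -1 < Real.sin v := by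
      have := Real.strictMonoOn_sin ⟨le_refl _, by linarith⟩ ⟨hv.1.le, hv.2.le⟩ hv.1
      simpa using this
    have hT := Th_mem hα v
    constructor
    · by_contra hc
      have := Real.monotoneOn_sin ⟨hT.1.le, hT.2.le⟩
        (⟨by linarith [hα.2], by linarith [hα.1]⟩ : -α ∈ Set.Icc (-(π/2)) (π/2)) (not_lt.1 hc)
      rw [sin_Th hα, Real.sin_neg] at this
      nlinarith
    · by_contra hc
      have := Real.monotoneOn_sin
        (⟨by linarith [hα.1], by linarith [hα.2]⟩ : α ∈ Set.Icc (-(π/2)) (π/2))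
        ⟨hT.1.le, hT.2.le⟩ (not_lt.1 hc)
      rw [sin_Th hα] at this
      nlinarith
  · intro hx
    have h1 : Real.sin x < Real.sin α := Real.strictMonoOn_sin
      ⟨by linarith [hx.1, hα.2], by linarith [hx.2, hα.2]⟩
      ⟨by linarith [hα.1], by linarith [hα.2]⟩ hx.2
    have h2 : Real.sin (-α) < Real.sin x := Real.strictMonoOn_sin
      ⟨by linarith [hα.2], by linarith [hα.1]⟩
      ⟨by linarith [hx.1, hα.2], by linarith [hx.2, hα.2]⟩ hx.1
    rw [Real.sin_neg] at h2
    have h3 : Real.sin x / Real.sin α < 1 := by rwa [div_lt_one hs]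
    have h4 : -1 < Real.sin x / Real.sin α := by rw [lt_div_iff₀ hs]; linarith
    refine ⟨Real.arcsin (Real.sin x / Real.sin α),
      ⟨Real.neg_pi_div_two_lt_arcsin.2 h4, Real.arcsin_lt_pi_div_two.2 h3⟩, ?_⟩
    rw [Th, Real.sin_arcsin h4.le h3.le, mul_div_cancel₀ _ hs.ne']
    exact Real.arcsin_sin (by linarith [hx.1, hα.2]) (by linarith [hx.2, hα.2])

lemma Th_inj {α : ℝ} (hα : α ∈ Set.Ioo 0 (π / 2)) :
    Set.InjOn (Th α) (Set.Ioo (-(π / 2)) (π / 2)) := by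
  intro x hx y hy h
  have h1 : Real.sin α * Real.sin x = Real.sin α * Real.sin y := by
    rw [← sin_Th hα, ← sin_Th hα, h]
  exact Real.injOn_sin ⟨hx.1.le, hx.2.le⟩ ⟨hy.1.le, hy.2.le⟩
    (mul_left_cancel₀ (sinA_pos hα).ne' h1)

lemma cov {α : ℝ} (hα : α ∈ Set.Ioo 0 (π / 2)) (g : ℝ → ℝ) :
    ∫ θ in (-α)..α, g θ * Real.cos θ / Real.sqrt (Real.cos θ ^ 2 - Real.cos α ^ 2)
      = ∫ v in (-(π / 2))..(π / 2), g (Th α v) := by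
  have hπ := Real.pi_pos
  rw [intervalIntegral.integral_of_le (by linarith [hα.1]),
    intervalIntegral.integral_of_le (by linarith),
    integral_Ioc_eq_integral_Ioo, integral_Ioc_eq_integral_Ioo, ← Th_image hα,
    integral_image_eq_integral_abs_deriv_smul measurableSet_Ioo
      (fun v _ => (Th_hasDeriv hα v).hasDerivWithinAt) (Th_inj hα)]
  apply setIntegral_congr_fun measurableSet_Ioo
  intro v hv
  have hs := sinA_pos hα
  have hc := cos_Th_pos hα v
  have hcv := Real.cos_pos_of_mem_Ioo hv
  have e : Real.cos (Th α v) ^ 2 - Real.cos α ^ 2 = (Real.sin α * Real.cos v) ^ 2 := by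
    rw [cos_sq_Th hα, Real.cos_sq' α, mul_pow, mul_pow, Real.cos_sq' v]; ring
  simp only [smul_eq_mul]
  rw [e, Real.sqrt_sq (by positivity), abs_of_pos (by positivity)]
  field_simp

lemma fold_int (g : ℝ → ℝ) (hg : Continuous g) (h1 : ∀ v, g (π - v) = g v)
    (h2 : ∀ v, g (v + 2 * π) = g v) :
    ∫ v in (0:ℝ)..(2 * π), g v = 2 * ∫ v in (-(π / 2))..(π / 2), g v := by
  have hp : Function.Periodic g (2 * π) := h2
  have e1 := hp.intervalIntegral_add_eq 0 (-(π / 2))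
  rw [zero_add] at e1
  rw [e1, ← intervalIntegral.integral_add_adjacent_intervals (hg.intervalIntegrable _ (π / 2))
    (hg.intervalIntegrable _ _)]
  have e2 : ∫ v in (π / 2)..(-(π / 2) + 2 * π), g v = ∫ v in (-(π / 2))..(π / 2), g v := by
    have := intervalIntegral.integral_comp_sub_left (a := -(π / 2)) (b := π / 2) g π
    simp only [h1] at this
    rw [this]
    congr 1 <;> ring
  rw [e2]; ring

lemma even_int (F k : ℝ → ℝ) (hF : Continuous F) (hk : Continuous k) (he : ∀ v, k (-v) = k v)
    (a : ℝ) : ∫ v in (-a)..a, (F v + F (-v)) / 2 * k v = ∫ v in (-a)..a, F v * k v := by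
  have e1 : ∫ v in (-a)..a, F (-v) * k v = ∫ v in (-a)..a, F v * k v := by
    have := intervalIntegral.integral_comp_neg (a := -a) (b := a) (fun v => F v * k v)
    simpa [he] using this
  have e2 : (fun v => (F v + F (-v)) / 2 * k v)
      = fun v => (1 / 2) * (F v * k v + F (-v) * k v) := by
    funext v; ring
  rw [e2, intervalIntegral.integral_const_mul, intervalIntegral.integral_add, e1]
  · ring
  · exact (hF.mul hk).intervalIntegrable _ _
  · exact ((hF.comp continuous_neg).mul hk).intervalIntegrable _ _

lemma base_int {α : ℝ} (hα : α ∈ Set.Ioo 0 (π / 2)) :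
    ∫ v in (0:ℝ)..(2 * π), Real.cos α / Real.cos (Th α v) ^ 2 = 2 * π := by
  have hs := sinA_pos hα
  have hc := cosA_pos hα
  set c := Real.cos α with hcdef
  have key : ∀ v : ℝ, HasDerivAt (fun v => v - Real.arctan ((1 - c) * (Real.sin v * Real.cos v)
      / (Real.cos v ^ 2 + c * Real.sin v ^ 2))) (c / Real.cos (Th α v) ^ 2) v := by
    intro v
    have sc := Real.sin_sq_add_cos_sq v
    have sa := Real.sin_sq_add_cos_sq α
    have hD : 0 < Real.cos v ^ 2 + c * Real.sin v ^ 2 := by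
      rcases eq_or_ne (Real.cos v) 0 with h | h
      · have : Real.sin v ^ 2 = 1 := by rw [h] at sc; linarith
        rw [this]; nlinarith [sq_nonneg (Real.cos v)]
      · positivity
    have hE : Real.cos (Th α v) ^ 2 = Real.cos v ^ 2 + c ^ 2 * Real.sin v ^ 2 := by
      rw [cos_sq_Th hα, mul_pow, Real.sin_sq α, ← hcdef]; linear_combination -sc
    have hEp : 0 < Real.cos v ^ 2 + c ^ 2 * Real.sin v ^ 2 := by
      rw [← hE]; have := cos_Th_pos hα v; positivity
    have hN := ((Real.hasDerivAt_sin v).mul (Real.hasDerivAt_cos v)).const_mul (1 - c)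
    have hDD := ((Real.hasDerivAt_cos v).pow 2).add (((Real.hasDerivAt_sin v).pow 2).const_mul c)
    have := (hasDerivAt_id v).sub ((hN.div hDD hD.ne').arctan)
    refine HasDerivAt.congr_deriv (this) ?_
    symm
    try simp only [Pi.mul_apply, Pi.add_apply, Pi.sub_apply, Pi.pow_apply, Pi.div_apply, Nat.cast_ofNat, Nat.add_one_sub_one, pow_one, zero_mul, Function.comp_apply]
    rw [hE]
    generalize Real.sin v = s at *
    generalize Real.cos v = k at *
    have hG : (k ^ 2 + c * s ^ 2) ^ 2 + ((1 - c) * (s * k)) ^ 2 = k ^ 2 + c ^ 2 * s ^ 2 := by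
      linear_combination (k ^ 2 + c ^ 2 * s ^ 2) * sc
    have hH : 1 + ((1 - c) * (s * k) / (k ^ 2 + c * s ^ 2)) ^ 2
        = (k ^ 2 + c ^ 2 * s ^ 2) / (k ^ 2 + c * s ^ 2) ^ 2 := by
      rw [← hG]; field_simp
    rw [hH]
    field_simp
    linear_combination (-c + (1 - c) * (k ^ 2 - c * s ^ 2)) * sc
  rw [intervalIntegral.integral_eq_sub_of_hasDerivAt (fun v _ => key v)]
  · simp
  · apply Continuous.intervalIntegrable
    refine continuous_const.div ((Real.continuous_cos.comp (Th_cont α)).pow 2) ?_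
    intro v
    exact pow_ne_zero _ (cos_Th_pos hα v).ne'

lemma f_cont {f : ℝ → ℝ} (hf : SurfaceFun f) {α : ℝ} (hα : α ∈ Set.Ioo 0 (π / 2)) :
    Continuous (fun v => f (Th α v)) :=
  hf.1.continuousOn.comp_continuous (Th_cont α) (Th_mem hα)

lemma f_pos {f : ℝ → ℝ} (hf : SurfaceFun f) {x : ℝ} (hx : x ∈ Set.Ioo (-(π / 2)) (π / 2)) :
    0 < 1 + f x := lt_of_le_of_lt (abs_nonneg _) (hf.2.2 x hx)

lemma P_eq {f : ℝ → ℝ} (hf : SurfaceFun f) {α : ℝ} (hα : α ∈ Set.Ioo 0 (π / 2)) :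
    ∫ v in (0:ℝ)..(2 * π), (1 + f (Th α v)) = Tper f α := by
  have hF := f_cont hf hα
  rw [Tper, cov hα, intervalIntegral.integral_add (by simp) (hF.intervalIntegrable _ _),
    fold_int _ hF (by simp [Th_pi_sub]) (by simp [Th_per])]
  have := even_int _ (fun _ => 1) hF continuous_const (by simp) (π / 2)
  simp only [mul_one, Th_neg] at this
  simp [tildeF, this]

lemma Q_eq {f : ℝ → ℝ} (hf : SurfaceFun f) {α : ℝ} (hα : α ∈ Set.Ioo 0 (π / 2)) :
    ∫ v in (0:ℝ)..(2 * π), Real.cos α * (1 + f (Th α v)) / Real.cos (Th α v) ^ 2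
      = 2 * π + Rshift f α := by
  have hF := f_cont hf hα
  have hk : Continuous (fun v => 1 / Real.cos (Th α v) ^ 2) := 
    continuous_const.div ((Real.continuous_cos.comp (Th_cont α)).pow 2)
      (fun v => pow_ne_zero _ (cos_Th_pos hα v).ne')
  have e0 : (fun v => Real.cos α * (1 + f (Th α v)) / Real.cos (Th α v) ^ 2)
      = fun v => Real.cos α / Real.cos (Th α v) ^ 2
        + Real.cos α * (f (Th α v) * (1 / Real.cos (Th α v) ^ 2)) := by
    funext v; ring
  have hb : Continuous (fun v => Real.cos α / Real.cos (Th α v) ^ 2) :=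
    continuous_const.div ((Real.continuous_cos.comp (Th_cont α)).pow 2)
      (fun v => pow_ne_zero _ (cos_Th_pos hα v).ne')
  have hb2 : Continuous (fun v => Real.cos α * (f (Th α v) * (1 / Real.cos (Th α v) ^ 2))) :=
    continuous_const.mul (hF.mul hk)
  have hb3 : Continuous (fun v => f (Th α v) * (1 / Real.cos (Th α v) ^ 2)) := hF.mul hk
  rw [e0, intervalIntegral.integral_add (hb.intervalIntegrable _ _)
    (hb2.intervalIntegrable _ _), base_int hα,
    intervalIntegral.integral_const_mul,
    fold_int _ hb3 (by simp [Th_pi_sub]) (by simp [Th_per]),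
    ← even_int _ _ hF hk (by simp [Th_neg])]
  have e1 := cov hα (fun θ => tildeF f θ * (1 / Real.cos θ ^ 2))
  simp only [Th_neg]
  simp only [tildeF] at e1
  rw [← e1, Rshift]
  have e2 : ∫ θ in (-α)..α, tildeF f θ / (Real.cos θ * √(Real.cos θ ^ 2 - Real.cos α ^ 2))
      = ∫ θ in (-α)..α, (f θ + f (-θ)) / 2 * (1 / Real.cos θ ^ 2) * Real.cos θ
        / √(Real.cos θ ^ 2 - Real.cos α ^ 2) := by
    congr 1
    funext θ
    rw [tildeF]
    by_cases h : Real.cos θ = 0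
    · simp [h]
    · field_simp
  rw [e2]; ring

lemma const_of_deriv {g : ℝ → ℝ} (h : ∀ t, HasDerivAt g 0 t) (a b : ℝ) : g a = g b :=
  is_const_of_deriv_eq_zero (fun t => (h t).differentiableAt) (fun t => (h t).deriv) a b

lemma prim_shift (g : ℝ → ℝ) (hg : Continuous g) (h2 : ∀ v, g (v + 2 * π) = g v) (w : ℝ) :
    ∫ v in (0:ℝ)..(w + 2 * π), g v
      = (∫ v in (0:ℝ)..w, g v) + ∫ v in (0:ℝ)..(2 * π), g v := by
  have hp : Function.Periodic g (2 * π) := h2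
  have e1 := hp.intervalIntegral_add_eq 0 w
  rw [zero_add] at e1
  rw [e1, intervalIntegral.integral_add_adjacent_intervals (hg.intervalIntegrable _ _)
    (hg.intervalIntegrable _ _)]

/-- Over one latitude period `T_*(α)`, the longitude of a geodesic crossing the equator at
angle `α` advances by exactly `2π + R(α)`. -/
theorem longitude_shift (f : ℝ → ℝ) (hf : SurfaceFun f)
    (α : ℝ) (hα : α ∈ Set.Ioo 0 (π / 2))
    (θ φ : ℝ → ℝ) (hEL : IsELGeodesicOn f θ φ Set.univ)
    (hθ0 : θ 0 = 0) (hφ'0 : deriv φ 0 = Real.cos α)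
    (hunit : (deriv φ 0) ^ 2 * Real.cos (θ 0) ^ 2
      + (deriv θ 0) ^ 2 * (1 + f (θ 0)) ^ 2 = 1) :
    ∀ t : ℝ, φ (t + Tper f α) = φ t + 2 * π + Rshift f α := by
  have hs := sinA_pos hα
  have hc := cosA_pos hα
  obtain ⟨hθ, hφ, hE1, hE2⟩ := hEL
  have hf0 := hf.2.1
  have hdθ : ∀ t, HasDerivAt θ (deriv θ t) t := fun t =>
    ((hθ.differentiable (by norm_num)) t).hasDerivAt
  have hdφ : ∀ t, HasDerivAt φ (deriv φ t) t := fun t =>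
    ((hφ.differentiable (by norm_num)) t).hasDerivAt
  have hddθ : ∀ t, HasDerivAt (deriv θ) (deriv (deriv θ) t) t := fun t =>
    (((hθ.iterate_deriv' 1 1).differentiable (by norm_num)) t).hasDerivAt
  have hddφ : ∀ t, HasDerivAt (deriv φ) (deriv (deriv φ) t) t := fun t =>
    (((hφ.iterate_deriv' 1 1).differentiable (by norm_num)) t).hasDerivAt
  -- angular momentum
  have hM : ∀ t, deriv φ t * Real.cos (θ t) ^ 2 = Real.cos α := by
    intro t
    have h : ∀ t, HasDerivAt (fun s => deriv φ s * Real.cos (θ s) ^ 2) 0 t := by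
      intro t
      have h1 : DifferentiableAt ℝ (fun s => deriv φ s * Real.cos (θ s) ^ 2) t :=
        (hddφ t).differentiableAt.mul (((hdθ t).cos.differentiableAt).pow 2)
      have := h1.hasDerivAt
      rwa [hE1 t (Set.mem_univ _)] at this
    have := const_of_deriv h t 0
    simp only [hθ0, hφ'0] at this
    simpa using this
  have hcne : ∀ t, Real.cos (θ t) ≠ 0 := by
    intro t h
    have := hM t
    rw [h] at this
    simp at this
    exact hc.ne this
  have hπ := Real.pi_pos
  have hmem : ∀ t, θ t ∈ Set.Ioo (-(π / 2)) (π / 2) := by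
    have hconn : (Set.range θ).OrdConnected :=
      (isPreconnected_range hθ.continuous).ordConnected
    have h0 : (0:ℝ) ∈ Set.range θ := ⟨0, hθ0⟩
    intro t
    constructor
    · by_contra hcon
      obtain ⟨s, hs'⟩ := hconn.out ⟨t, rfl⟩ h0 (⟨not_lt.1 hcon, by linarith⟩ :
        -(π / 2) ∈ Set.Icc (θ t) 0)
      apply hcne s; rw [hs']; simp
    · by_contra hcon
      obtain ⟨s, hs'⟩ := hconn.out h0 ⟨t, rfl⟩ (⟨by linarith, not_lt.1 hcon⟩ :
        (π / 2) ∈ Set.Icc 0 (θ t))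
      apply hcne s; rw [hs']; simp
  have hcp : ∀ t, 0 < Real.cos (θ t) := fun t => Real.cos_pos_of_mem_Ioo (hmem t)
  have hfp : ∀ t, 0 < 1 + f (θ t) := fun t => f_pos hf (hmem t)
  have hdf : ∀ t, HasDerivAt (fun s => f (θ s)) (deriv f (θ t) * deriv θ t) t := by
    intro t
    have h1 : DifferentiableAt ℝ f (θ t) :=
      (hf.1.differentiableOn (by simp)).differentiableAt (isOpen_Ioo.mem_nhds (hmem t))
    exact h1.hasDerivAt.comp t (hdθ t)
  -- momentum p = θ' (1 + f)
  have hp : ∀ t, HasDerivAt (fun s => deriv θ s * (1 + f (θ s)))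
      (-(deriv φ t ^ 2 * Real.cos (θ t) * Real.sin (θ t)) / (1 + f (θ t))) t := by
    intro t
    have h := (hddθ t).mul ((hdf t).const_add 1)
    refine HasDerivAt.congr_deriv (h) ?_
    symm
    try simp only [Pi.mul_apply, Pi.add_apply, Pi.sub_apply, Pi.pow_apply, Pi.div_apply, Nat.cast_ofNat, Nat.add_one_sub_one, pow_one, zero_mul, Function.comp_apply]
    have := hE2 t (Set.mem_univ _)
    have hne := (hfp t).ne'
    field_simp
    linear_combination -this
  have hφ2 : ∀ t, deriv φ t = Real.cos α / Real.cos (θ t) ^ 2 := by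
    intro t
    rw [eq_div_iff (pow_ne_zero _ (hcne t)), hM t]
  have hdd : ∀ t, HasDerivAt (fun s => Real.cos α ^ 2 / Real.cos (θ s) ^ 2)
      (2 * Real.cos α ^ 2 * Real.sin (θ t) * deriv θ t / Real.cos (θ t) ^ 3) t := by
    intro t
    have h := (hasDerivAt_const t (Real.cos α ^ 2)).div (((hdθ t).cos).pow 2)
      (pow_ne_zero 2 (hcne t))
    refine HasDerivAt.congr_deriv (h) ?_
    symm
    try simp only [Pi.mul_apply, Pi.add_apply, Pi.sub_apply, Pi.pow_apply, Pi.div_apply, Nat.cast_ofNat, Nat.add_one_sub_one, pow_one, zero_mul, Function.comp_apply]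
    have := hcne t
    field_simp
    norm_num
  -- energy
  have hEn : ∀ t, Real.cos α ^ 2 / Real.cos (θ t) ^ 2
      + (deriv θ t * (1 + f (θ t))) ^ 2 = 1 := by
    intro t
    have h : ∀ t, HasDerivAt (fun t => Real.cos α ^ 2 / Real.cos (θ t) ^ 2
      + (deriv θ t * (1 + f (θ t))) ^ 2) 0 t := by
      intro t
      have h := (hdd t).add ((hp t).pow 2)
      refine HasDerivAt.congr_deriv (h) ?_
      symm
      try simp only [Pi.mul_apply, Pi.add_apply, Pi.sub_apply, Pi.pow_apply, Pi.div_apply, Nat.cast_ofNat, Nat.add_one_sub_one, pow_one, zero_mul, Function.comp_apply]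
      rw [hφ2 t]
      have := hcne t
      have hne := (hfp t).ne'
      field_simp
      ring
    have := const_of_deriv h t 0
    have h2 := hunit
    rw [hφ'0, hθ0] at h2
    rw [this, hθ0]
    simp only [Real.cos_zero, one_pow, mul_one, div_one] at h2 ⊢
    linear_combination h2
  set x : ℝ → ℝ := fun t => Real.sin (θ t) / Real.sin α with hx
  set y : ℝ → ℝ := fun t => (deriv θ t * (1 + f (θ t))) * Real.cos (θ t) / Real.sin α with hy
  have hdx : ∀ t, HasDerivAt x (y t / (1 + f (θ t))) t := by
    intro t
    refine HasDerivAt.congr_deriv (((hdθ t).sin).div_const (Real.sin α)) ?_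
    symm
    try simp only [Pi.mul_apply, Pi.add_apply, Pi.sub_apply, Pi.pow_apply, Pi.div_apply, Nat.cast_ofNat, Nat.add_one_sub_one, pow_one, zero_mul, Function.comp_apply]
    have hne := (hfp t).ne'
    simp only [hy]
    field_simp
  have hdy : ∀ t, HasDerivAt y (-x t / (1 + f (θ t))) t := by
    intro t
    refine HasDerivAt.congr_deriv (((hp t).mul (hdθ t).cos).div_const (Real.sin α)) ?_
    symm
    try simp only [Pi.mul_apply, Pi.add_apply, Pi.sub_apply, Pi.pow_apply, Pi.div_apply, Nat.cast_ofNat, Nat.add_one_sub_one, pow_one, zero_mul, Function.comp_apply]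
    have hne := (hfp t).ne'
    have hne' := hcne t
    have h := hEn t
    rw [hφ2 t]
    simp only [hx]
    field_simp at h ⊢
    linear_combination Real.sin (θ t) * h
  have hy0 : y 0 ^ 2 = 1 := by
    have h := hunit
    rw [hφ'0, hθ0, hf0] at h
    simp at h
    simp only [hy, hθ0, hf0, Real.cos_zero, add_zero, mul_one]
    rw [div_pow, div_eq_one_iff_eq (by positivity), Real.sin_sq]
    linarith
  have hx0 : x 0 = 0 := by simp [hx, hθ0]
  obtain ⟨u0, hu1, hu2⟩ : ∃ u0 : ℝ, Real.sin u0 = 0 ∧ Real.cos u0 = y 0 := by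
    rcases (sq_eq_sq_iff_eq_or_eq_neg.1 (hy0.trans (one_pow 2).symm)) with h | h
    · exact ⟨0, by simp, by simp [h]⟩
    · exact ⟨π, by simp, by simp [h]⟩
  set u : ℝ → ℝ := fun t => u0 + ∫ s in (0:ℝ)..t, 1 / (1 + f (θ s)) with hu
  have hfc : Continuous (fun s => f (θ s)) :=
    hf.1.continuousOn.comp_continuous hθ.continuous hmem
  have hdu : ∀ t, HasDerivAt u (1 / (1 + f (θ t))) t := by
    intro t
    have hcont : Continuous (fun s => 1 / (1 + f (θ s))) :=
      continuous_const.div (continuous_const.add hfc) (fun s => (hfp s).ne')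
    exact (hcont.integral_hasStrictDerivAt 0 t).hasDerivAt.const_add u0
  have hsc : ∀ t, (x t - Real.sin (u t)) ^ 2 + (y t - Real.cos (u t)) ^ 2 = 0 := by
    intro t
    have h : ∀ t, HasDerivAt
        (fun t => (x t - Real.sin (u t)) ^ 2 + (y t - Real.cos (u t)) ^ 2) 0 t := by
      intro t
      refine HasDerivAt.congr_deriv ((((hdx t).sub (hdu t).sin).pow 2).add (((hdy t).sub (hdu t).cos).pow 2)) ?_
      symm
      try simp only [Pi.mul_apply, Pi.add_apply, Pi.sub_apply, Pi.pow_apply, Pi.div_apply, Nat.cast_ofNat, Nat.add_one_sub_one, pow_one, zero_mul, Function.comp_apply]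
      have hne := (hfp t).ne'
      field_simp
      norm_num
    rw [const_of_deriv h t 0]
    simp [hu, hx0, hu1, hu2]
  have hxs : ∀ t, x t = Real.sin (u t) := by
    intro t
    have := hsc t
    have h2 : (x t - Real.sin (u t)) ^ 2 = 0 := by
      nlinarith [sq_nonneg (x t - Real.sin (u t)), sq_nonneg (y t - Real.cos (u t))]
    have := pow_eq_zero_iff (two_ne_zero) |>.1 h2
    linarith
  have hTh : ∀ t, θ t = Th α (u t) := by
    intro t
    rw [Th, ← hxs t]
    simp only [hx]
    rw [mul_div_cancel₀ _ hs.ne', Real.arcsin_sin (hmem t).1.le (hmem t).2.le]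
  have hgc : Continuous (fun v => 1 + f (Th α v)) := continuous_const.add (f_cont hf hα)
  have hhc : Continuous (fun v => Real.cos α * (1 + f (Th α v)) / Real.cos (Th α v) ^ 2) :=
    (continuous_const.mul hgc).div ((Real.continuous_cos.comp (Th_cont α)).pow 2)
      (fun v => pow_ne_zero _ (cos_Th_pos hα v).ne')
  set G : ℝ → ℝ := fun w => ∫ v in (0:ℝ)..w, (1 + f (Th α v)) with hG
  set H : ℝ → ℝ := fun w =>
    ∫ v in (0:ℝ)..w, Real.cos α * (1 + f (Th α v)) / Real.cos (Th α v) ^ 2 with hH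
  have hdG : ∀ w, HasDerivAt G (1 + f (Th α w)) w := fun w =>
    (hgc.integral_hasStrictDerivAt 0 w).hasDerivAt
  have hdH : ∀ w, HasDerivAt H (Real.cos α * (1 + f (Th α w)) / Real.cos (Th α w) ^ 2) w :=
    fun w => (hhc.integral_hasStrictDerivAt 0 w).hasDerivAt
  have hGmono : StrictMono G := by
    apply strictMono_of_deriv_pos
    intro w
    rw [(hdG w).deriv]
    exact f_pos hf (Th_mem hα w)
  have hGu : ∀ a b, G (u a) - a = G (u b) - b := by
    apply const_of_deriv (g := fun t => G (u t) - t)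
    intro t
    refine HasDerivAt.congr_deriv (((hdG (u t)).comp t (hdu t)).sub (hasDerivAt_id t)) ?_
    symm
    try simp only [Pi.mul_apply, Pi.add_apply, Pi.sub_apply, Pi.pow_apply, Pi.div_apply, Nat.cast_ofNat, Nat.add_one_sub_one, pow_one, zero_mul, Function.comp_apply]
    rw [← hTh t]
    have hne := (hfp t).ne'
    field_simp
    norm_num
  have hHu : ∀ a b, H (u a) - φ a = H (u b) - φ b := by
    apply const_of_deriv (g := fun t => H (u t) - φ t)
    intro t
    refine HasDerivAt.congr_deriv (((hdH (u t)).comp t (hdu t)).sub (hdφ t)) ?_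
    symm
    try simp only [Pi.mul_apply, Pi.add_apply, Pi.sub_apply, Pi.pow_apply, Pi.div_apply, Nat.cast_ofNat, Nat.add_one_sub_one, pow_one, zero_mul, Function.comp_apply]
    rw [← hTh t, hφ2 t]
    have hne := (hfp t).ne'
    have hne' := hcne t
    field_simp
    norm_num
  have hG2 : ∀ w, G (w + 2 * π) = G w + Tper f α := by
    intro w
    rw [← P_eq hf hα]
    exact prim_shift _ hgc (by simp [Th_per]) w
  have hH2 : ∀ w, H (w + 2 * π) = H w + (2 * π + Rshift f α) := by
    intro w
    rw [← Q_eq hf hα]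
    exact prim_shift _ hhc (by simp [Th_per]) w
  intro t
  have hut : u (t + Tper f α) = u t + 2 * π := by
    apply hGmono.injective
    rw [hG2]
    linarith [hGu (t + Tper f α) t]
  have := hHu (t + Tper f α) t
  rw [hut, hH2] at this
  linarith
end
end

section
/- Let f satisfy the stated conditions and suppose in addition that f is odd on [−α₀, α₀] for some α₀ ∈ (0, π/2), i.e. f(−θ) = −f(θ) whenever |θ| ≤ α₀. Let α ∈ [0, α₀] and let (θ, φ) : ℝ → ℝ² be a solution of the Euler–Lagrange equations with θ(0) = 0, φ̇(0) = cos α, and unit speed at t = 0. Then the geodesic is 2π-periodic: θ(t + 2π) = θ(t) and φ(t + 2π) = φ(t) + 2π for all t ∈ ℝ. -/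
open Real Set Filter MeasureTheory
open scoped BigOperators Topology

noncomputable section

theorem aux_u_bound (a α σ : ℝ) (hα0 : 0 ≤ α) (hα1 : α < π / 2) (ha : a ^ 2 = Real.sin α ^ 2) :
    |Real.arcsin (a * Real.sin σ)| ≤ α := by
  have hs : 0 ≤ Real.sin α := Real.sin_nonneg_of_nonneg_of_le_pi hα0 (by linarith [Real.pi_pos])
  have h1 : |a| = Real.sin α := by
    rw [← abs_of_nonneg hs]; exact sq_eq_sq_iff_abs_eq_abs _ _ |>.1 ha
  have h2 : |a * Real.sin σ| ≤ Real.sin α := by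
    rw [abs_mul, h1]
    exact mul_le_of_le_one_right hs (Real.abs_sin_le_one σ)
  rw [abs_le] at h2 ⊢
  have e : Real.arcsin (Real.sin α) = α := Real.arcsin_sin (by linarith [Real.pi_pos]) hα1.le
  constructor
  · have := Real.monotone_arcsin h2.1
    rw [Real.arcsin_neg, e] at this; exact this
  · have := Real.monotone_arcsin h2.2
    rw [e] at this; exact this

theorem aux_odd_int (g : ℝ → ℝ) (hodd : ∀ x, g (-x) = - g x)
    (hper : ∀ x, g (x + 2 * π) = g x) (x : ℝ) : ∫ y in x..(x + 2 * π), g y = 0 := by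
  have hp : Function.Periodic g (2 * π) := hper
  rw [hp.intervalIntegral_add_eq x (-π)]
  have e : -π + 2 * π = π := by ring
  rw [e]
  have h := intervalIntegral.integral_comp_neg (a := -π) (b := π) g
  simp only [hodd, intervalIntegral.integral_neg, neg_neg] at h
  linarith

theorem aux_G (c : ℝ) (hc : 0 < c) (s : ℝ) :
    HasDerivAt (fun s => s + Real.arctan ((c - 1) * (Real.sin s * Real.cos s) /
      (Real.cos s ^ 2 + c * Real.sin s ^ 2))) (c / (1 - (1 - c ^ 2) * Real.sin s ^ 2)) s := by
  have hsc := Real.sin_sq_add_cos_sq s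
  have hD : 0 < Real.cos s ^ 2 + c * Real.sin s ^ 2 := by
    rcases le_or_gt c 1 with h | h
    · nlinarith [sq_nonneg (Real.sin s), sq_nonneg (Real.cos s)]
    · nlinarith [sq_nonneg (Real.sin s), sq_nonneg (Real.cos s)]
  have hE : 0 < Real.cos s ^ 2 + c ^ 2 * Real.sin s ^ 2 := by
    have : 0 < c ^ 2 := by positivity
    rcases le_or_gt (c^2) 1 with h | h
    · nlinarith [sq_nonneg (Real.sin s), sq_nonneg (Real.cos s)]
    · nlinarith [sq_nonneg (Real.sin s), sq_nonneg (Real.cos s)]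
  have hS := Real.hasDerivAt_sin s
  have hC := Real.hasDerivAt_cos s
  have h := (hasDerivAt_id s).add ((((hS.mul hC).const_mul (c - 1)).div
    ((hC.pow 2).add ((hS.pow 2).const_mul c)) hD.ne').arctan)
  refine h.congr_deriv ?_
  have e1 : 1 - (1 - c ^ 2) * Real.sin s ^ 2 = Real.cos s ^ 2 + c ^ 2 * Real.sin s ^ 2 := by
    linear_combination -hsc
  rw [e1]
  simp only [Pi.add_apply, Pi.mul_apply, Pi.pow_apply, Pi.div_apply]
  generalize Real.sin s = x at *
  generalize Real.cos s = y at *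
  have e2 : 1 + ((c - 1) * (x * y) / (y ^ 2 + c * x ^ 2)) ^ 2
      = (y ^ 2 + c ^ 2 * x ^ 2) / (y ^ 2 + c * x ^ 2) ^ 2 := by
    field_simp
    linear_combination (y ^ 2 + c ^ 2 * x ^ 2) * hsc
  rw [e2]
  field_simp
  have hy : y ^ 2 = 1 - x ^ 2 := by linarith
  push_cast
  ring_nf
  have hy3 : y ^ 4 = (1 - x ^ 2) ^ 2 := by rw [← hy]; ring
  have hy6 : y ^ 6 = (1 - x ^ 2) ^ 3 := by rw [← hy]; ring
  simp only [hy, hy3]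
  ring

theorem aux_const (F : ℝ → ℝ) (h : ∀ t, HasDerivAt F 0 t) (t : ℝ) : F t = F 0 :=
  is_const_of_deriv_eq_zero (fun x => (h x).differentiableAt) (fun x => (h x).deriv) t 0

/-- Lemma 5.3: if `f` is odd on `[−α₀, α₀]`, then every geodesic crossing the equator at an
angle `α ≤ α₀` is `2π`-periodic. -/
theorem odd_profile_periodic_geodesics (f : ℝ → ℝ) (hf : SurfaceFun f)
    (α₀ : ℝ) (hα₀ : α₀ ∈ Set.Ioo 0 (π / 2))
    (hodd : ∀ ψ : ℝ, |ψ| ≤ α₀ → f (-ψ) = - f ψ)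
    (α : ℝ) (hα : α ∈ Set.Icc 0 α₀)
    (θ φ : ℝ → ℝ) (hEL : IsELGeodesicOn f θ φ Set.univ)
    (hθ0 : θ 0 = 0) (hφ'0 : deriv φ 0 = Real.cos α)
    (hunit : (deriv φ 0) ^ 2 * Real.cos (θ 0) ^ 2
      + (deriv θ 0) ^ 2 * (1 + f (θ 0)) ^ 2 = 1) :
    ∀ t : ℝ, θ (t + 2 * π) = θ t ∧ φ (t + 2 * π) = φ t + 2 * π := by
  obtain ⟨hfs, hf0, hfpos⟩ := hf
  obtain ⟨hθ2, hφ2, hEL1, hEL2⟩ := hEL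
  obtain ⟨hα₀0, hα₀1⟩ := hα₀
  obtain ⟨hα0, hα1⟩ := hα
  have hαlt : α < π / 2 := lt_of_le_of_lt hα1 hα₀1
  set c := Real.cos α with hcdef
  have hc : 0 < c := Real.cos_pos_of_mem_Ioo ⟨by linarith [Real.pi_pos], hαlt⟩
  have hθd : ∀ t, HasDerivAt θ (deriv θ t) t := fun t =>
    (hθ2.differentiable (by norm_num) t).hasDerivAt
  have hφd : ∀ t, HasDerivAt φ (deriv φ t) t := fun t =>
    (hφ2.differentiable (by norm_num) t).hasDerivAt
  have hθ1 : ContDiff ℝ 1 (deriv θ) := (contDiff_succ_iff_deriv (n := 1)).1 hθ2 |>.2.2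
  have hφ1 : ContDiff ℝ 1 (deriv φ) := (contDiff_succ_iff_deriv (n := 1)).1 hφ2 |>.2.2
  have hθdd : ∀ t, HasDerivAt (deriv θ) (deriv (deriv θ) t) t := fun t =>
    (hθ1.differentiable (by norm_num) t).hasDerivAt
  have hφdd : ∀ t, HasDerivAt (deriv φ) (deriv (deriv φ) t) t := fun t =>
    (hφ1.differentiable (by norm_num) t).hasDerivAt
  have hM : ∀ t, deriv φ t * Real.cos (θ t) ^ 2 = c := by
    intro t
    have := is_const_of_deriv_eq_zero (f := fun s => deriv φ s * Real.cos (θ s) ^ 2)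
      (fun x => ((hφdd x).mul ((hθd x).cos.pow 2)).differentiableAt)
      (fun x => hEL1 x (Set.mem_univ x)) t 0
    simpa [hθ0, hφ'0] using this
  have hcosne : ∀ t, Real.cos (θ t) ≠ 0 := by
    intro t h0
    have := hM t
    rw [h0] at this
    simp at this
    exact hc.ne this
  have hθc : Continuous θ := hθ2.continuous
  have hcospos : ∀ t, 0 < Real.cos (θ t) := by
    intro t
    by_contra hcon
    push Not at hcon
    have hr := mem_range_of_exists_le_of_exists_ge (f := fun s => Real.cos (θ s))
      (Real.continuous_cos.comp hθc) (c := 0) ⟨t, hcon⟩ ⟨0, by simp [hθ0]⟩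
    obtain ⟨x, hx⟩ := hr
    exact hcosne x hx
  have hlt : ∀ t, θ t < π / 2 := by
    intro t
    by_contra hcon
    push Not at hcon
    obtain ⟨x, hx⟩ := mem_range_of_exists_le_of_exists_ge hθc (c := π / 2)
      ⟨0, by rw [hθ0]; positivity⟩ ⟨t, hcon⟩
    exact hcosne x (by rw [hx, Real.cos_pi_div_two])
  have hgt : ∀ t, -(π / 2) < θ t := by
    intro t
    by_contra hcon
    push Not at hcon
    obtain ⟨x, hx⟩ := mem_range_of_exists_le_of_exists_ge hθc (c := -(π / 2))
      ⟨t, hcon⟩ ⟨0, by rw [hθ0]; linarith [Real.pi_pos]⟩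
    exact hcosne x (by rw [hx, Real.cos_neg, Real.cos_pi_div_two])
  have hmem : ∀ t, θ t ∈ Set.Ioo (-(π / 2)) (π / 2) := fun t => ⟨hgt t, hlt t⟩
  have hfd : ∀ t, HasDerivAt f (deriv f (θ t)) (θ t) := fun t =>
    ((hfs.contDiffAt (isOpen_Ioo.mem_nhds (hmem t))).differentiableAt (by simp)).hasDerivAt
  have hfp : ∀ ψ ∈ Set.Ioo (-(π / 2)) (π / 2), 0 < 1 + f ψ := fun ψ h =>
    lt_of_le_of_lt (abs_nonneg _) (hfpos ψ h)
  have hp : ∀ t, 0 < 1 + f (θ t) := fun t => hfp _ (hmem t)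
  have hfθ : ∀ t, HasDerivAt (fun s => 1 + f (θ s)) (deriv f (θ t) * deriv θ t) t := fun t =>
    ((hfd t).comp t (hθd t)).const_add 1
  have hW : ∀ t, HasDerivAt (fun s => deriv θ s * (1 + f (θ s)))
      (deriv (deriv θ) t * (1 + f (θ t)) + deriv θ t * (deriv f (θ t) * deriv θ t)) t := fun t =>
    (hθdd t).mul (hfθ t)
  -- energy
  have hφc : ∀ t, deriv φ t = c / Real.cos (θ t) ^ 2 := fun t => by
    rw [eq_div_iff (pow_ne_zero 2 (hcosne t))]; exact hM t
  have hE : ∀ t, c ^ 2 / Real.cos (θ t) ^ 2 + (deriv θ t * (1 + f (θ t))) ^ 2 = 1 := by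
    intro t
    have h0 : c ^ 2 / Real.cos (θ 0) ^ 2 + (deriv θ 0 * (1 + f (θ 0))) ^ 2 = 1 := by
      have h := hunit
      rw [hφ'0, hθ0, hf0] at h
      rw [hθ0, hf0]
      simp at h ⊢
      exact h
    refine Eq.trans ?_ h0
    refine aux_const (fun t => c ^ 2 / Real.cos (θ t) ^ 2 + (deriv θ t * (1 + f (θ t))) ^ 2) ?_ t
    intro t
    have h := ((hasDerivAt_const t (c ^ 2)).div ((hθd t).cos.pow 2)
      (pow_ne_zero 2 (hcosne t))).add ((hW t).pow 2)
    refine h.congr_deriv ?_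
    have h2 := hEL2 t (Set.mem_univ t)
    rw [hφc t] at h2
    have hcn := hcosne t
    simp only [Pi.pow_apply]
    have h3 : (2:ℝ) * (deriv θ t * (1 + f (θ t))) * (deriv (deriv θ) t * (1 + f (θ t))
        + deriv θ t * (deriv f (θ t) * deriv θ t))
        = - 2 * deriv θ t * ((c / Real.cos (θ t) ^ 2) ^ 2 * Real.cos (θ t) * Real.sin (θ t)) := by
      linear_combination 2 * deriv θ t * h2
    push_cast
    rw [pow_one, pow_one, h3]
    field_simp
    ring
  have hY : ∀ t, HasDerivAt (fun s => deriv θ s * (1 + f (θ s)) * Real.cos (θ s))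
      (- Real.sin (θ t) / (1 + f (θ t))) t := by
    intro t
    refine ((hW t).mul (hθd t).cos).congr_deriv ?_
    have h2 := hEL2 t (Set.mem_univ t)
    rw [hφc t] at h2
    have h3 := hE t
    have hcn := hcosne t
    have hpn := (hp t).ne'
    rw [eq_div_iff hpn]
    have h4 : (c / Real.cos (θ t) ^ 2) ^ 2 * Real.cos (θ t) * Real.cos (θ t)
        = c ^ 2 / Real.cos (θ t) ^ 2 := by field_simp
    linear_combination Real.cos (θ t) * h2 - Real.sin (θ t) * h3 - Real.sin (θ t) * h4
  have hX : ∀ t, HasDerivAt (fun s => Real.sin (θ s))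
      (deriv θ t * (1 + f (θ t)) * Real.cos (θ t) / (1 + f (θ t))) t := by
    intro t
    refine (hθd t).sin.congr_deriv ?_
    have hpn := (hp t).ne'
    field_simp
  -- phase
  have hqc : Continuous (fun t => 1 / (1 + f (θ t))) := by
    have : Continuous (fun t => 1 + f (θ t)) :=
      continuous_iff_continuousAt.2 fun t => (hfθ t).continuousAt
    exact continuous_const.div this fun t => (hp t).ne'
  obtain ⟨s, hs0, hsd⟩ : ∃ s : ℝ → ℝ, s 0 = 0 ∧ ∀ t, HasDerivAt s (1 / (1 + f (θ t))) t :=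
    ⟨fun t => ∫ x in (0:ℝ)..t, 1 / (1 + f (θ x)), by simp, fun t =>
      hqc.integral_hasStrictDerivAt 0 t |>.hasDerivAt⟩
  set a := deriv θ 0 with hadef
  have ha : a ^ 2 = Real.sin α ^ 2 := by
    have h := hunit
    rw [hφ'0, hθ0, hf0] at h
    simp at h
    have := Real.sin_sq_add_cos_sq α
    linarith
  have hA : ∀ t, Real.sin (θ t) * Real.cos (s t)
      - deriv θ t * (1 + f (θ t)) * Real.cos (θ t) * Real.sin (s t) = 0 := by
    intro t
    refine (aux_const (fun t => Real.sin (θ t) * Real.cos (s t)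
      - deriv θ t * (1 + f (θ t)) * Real.cos (θ t) * Real.sin (s t)) ?_ t).trans ?_
    · intro t
      refine (((hX t).mul (hsd t).cos).sub ((hY t).mul (hsd t).sin)).congr_deriv ?_
      ring
    · simp [hs0, hθ0]
  have hB : ∀ t, Real.sin (θ t) * Real.sin (s t)
      + deriv θ t * (1 + f (θ t)) * Real.cos (θ t) * Real.cos (s t) = a := by
    intro t
    refine (aux_const (fun t => Real.sin (θ t) * Real.sin (s t)
      + deriv θ t * (1 + f (θ t)) * Real.cos (θ t) * Real.cos (s t)) ?_ t).trans ?_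
    · intro t
      refine (((hX t).mul (hsd t).sin).add ((hY t).mul (hsd t).cos)).congr_deriv ?_
      ring
    · simp [hs0, hθ0, hf0, hadef]
  have hsin : ∀ t, Real.sin (θ t) = a * Real.sin (s t) := by
    intro t
    have := Real.sin_sq_add_cos_sq (s t)
    linear_combination Real.cos (s t) * hA t + Real.sin (s t) * hB t - Real.sin (θ t) * this
  obtain ⟨u, hu⟩ : ∃ u : ℝ → ℝ, ∀ σ, u σ = Real.arcsin (a * Real.sin σ) := ⟨_, fun _ => rfl⟩
  have hθu : ∀ t, θ t = u (s t) := by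
    intro t
    rw [hu, ← hsin, Real.arcsin_sin (hgt t).le (hlt t).le]
  have hub : ∀ σ, |u σ| ≤ α := fun σ => by
    rw [hu]; exact aux_u_bound a α σ hα0 hαlt ha
  have humem : ∀ σ, u σ ∈ Set.Ioo (-(π / 2)) (π / 2) := fun σ => by
    have := abs_le.1 (hub σ)
    exact ⟨by linarith, by linarith⟩
  have huodd : ∀ σ, u (-σ) = - u σ := fun σ => by
    rw [hu, hu, Real.sin_neg, mul_neg, Real.arcsin_neg]
  have huper : ∀ σ, u (σ + 2 * π) = u σ := fun σ => by
    rw [hu, hu, Real.sin_add_two_pi]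
  have huc : Continuous u := by
    have : u = fun σ => Real.arcsin (a * Real.sin σ) := funext hu
    rw [this]
    exact Real.continuous_arcsin.comp (continuous_const.mul Real.continuous_sin)
  have hfu : Continuous (fun σ => f (u σ)) := hfs.continuousOn.comp_continuous huc humem
  have hfuodd : ∀ σ, f (u (-σ)) = - f (u σ) := fun σ => by
    rw [huodd]; exact hodd _ ((hub σ).trans hα1)
  have hfuper : ∀ σ, f (u (σ + 2 * π)) = f (u σ) := fun σ => by rw [huper]
  -- time as a function of phase
  obtain ⟨T, hT⟩ : ∃ T : ℝ → ℝ, ∀ σ, T σ = ∫ x in (0:ℝ)..σ, (1 + f (u x)) := ⟨_, fun _ => rfl⟩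
  have hTc : Continuous (fun x => 1 + f (u x)) := continuous_const.add hfu
  have hTd : ∀ σ, HasDerivAt T (1 + f (u σ)) σ := by
    rw [funext hT]
    exact fun σ => (hTc.integral_hasStrictDerivAt 0 σ).hasDerivAt
  have hTmono : StrictMono T := strictMono_of_deriv_pos fun σ => by
    rw [(hTd σ).deriv]; exact hfp _ (humem σ)
  have hTper : ∀ σ, T (σ + 2 * π) = T σ + 2 * π := by
    intro σ
    have h1 : T (σ + 2 * π) - T σ = ∫ x in σ..(σ + 2 * π), (1 + f (u x)) := by
      rw [hT, hT]
      exact intervalIntegral.integral_interval_sub_left (hTc.intervalIntegrable _ _)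
        (hTc.intervalIntegrable _ _)
    rw [intervalIntegral.integral_add (continuous_const.intervalIntegrable _ _)
      (hfu.intervalIntegrable _ _), aux_odd_int (fun x => f (u x)) hfuodd hfuper] at h1
    simp at h1
    linarith
  have hTs : ∀ t, T (s t) = t := by
    intro t
    have := aux_const (fun t => T (s t) - t) (fun t => by
      refine (((hTd (s t)).comp t (hsd t)).sub (hasDerivAt_id t)).congr_deriv ?_
      rw [← hθu]
      have := (hp t).ne'
      field_simp
      ring) t
    simp only [hs0, hT 0, intervalIntegral.integral_same] at this
    linarith
  have hsper : ∀ t, s (t + 2 * π) = s t + 2 * π := by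
    intro t
    apply hTmono.injective
    rw [hTs, hTper, hTs]
  -- longitude
  have hsc : 1 - c ^ 2 = a ^ 2 := by
    rw [ha]; linarith [Real.sin_sq_add_cos_sq α]
  have hden : ∀ σ, 0 < 1 - (1 - c ^ 2) * Real.sin σ ^ 2 := by
    intro σ
    have h1 : Real.sin σ ^ 2 ≤ 1 := Real.sin_sq_le_one σ
    have h2 : 0 < c ^ 2 := by positivity
    nlinarith [sq_nonneg a]
  have hkc : Continuous (fun σ => c / (1 - (1 - c ^ 2) * Real.sin σ ^ 2)) :=
    continuous_const.div (by fun_prop) fun σ => (hden σ).ne'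
  have hgc : Continuous (fun σ => c / (1 - (1 - c ^ 2) * Real.sin σ ^ 2) * f (u σ)) :=
    hkc.mul hfu
  obtain ⟨Q, hQ⟩ : ∃ Q : ℝ → ℝ, ∀ σ, Q σ =
    ∫ x in (0:ℝ)..σ, c / (1 - (1 - c ^ 2) * Real.sin x ^ 2) * f (u x) := ⟨_, fun _ => rfl⟩
  have hQd : ∀ σ, HasDerivAt Q (c / (1 - (1 - c ^ 2) * Real.sin σ ^ 2) * f (u σ)) σ := by
    rw [funext hQ]
    exact fun σ => (hgc.integral_hasStrictDerivAt 0 σ).hasDerivAt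
  have hQper : ∀ σ, Q (σ + 2 * π) = Q σ := by
    intro σ
    have h1 : Q (σ + 2 * π) - Q σ = ∫ x in σ..(σ + 2 * π),
        c / (1 - (1 - c ^ 2) * Real.sin x ^ 2) * f (u x) := by
      rw [hQ, hQ]
      exact intervalIntegral.integral_interval_sub_left (hgc.intervalIntegrable _ _)
        (hgc.intervalIntegrable _ _)
    rw [aux_odd_int (fun x => c / (1 - (1 - c ^ 2) * Real.sin x ^ 2) * f (u x))
      (fun x => by simp only [hfuodd, Real.sin_neg]; ring)
      (fun x => by simp only [hfuper, Real.sin_add_two_pi])] at h1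
    linarith
  obtain ⟨G, hG⟩ : ∃ G : ℝ → ℝ, ∀ σ, G σ = σ + Real.arctan ((c - 1) * (Real.sin σ * Real.cos σ) /
      (Real.cos σ ^ 2 + c * Real.sin σ ^ 2)) := ⟨_, fun _ => rfl⟩
  have hGd : ∀ σ, HasDerivAt G (c / (1 - (1 - c ^ 2) * Real.sin σ ^ 2)) σ := by
    rw [funext hG]
    exact aux_G c hc
  have hGper : ∀ σ, G (σ + 2 * π) = G σ + 2 * π := by
    intro σ
    rw [hG, hG, Real.sin_add_two_pi, Real.cos_add_two_pi]; ring
  have hφs : ∀ t, φ t - (G (s t) + Q (s t)) = φ 0 - (G (s 0) + Q (s 0)) := by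
    intro t
    refine aux_const (fun t => φ t - (G (s t) + Q (s t))) (fun t => ?_) t
    refine ((hφd t).sub (((hGd (s t)).comp t (hsd t)).add
      ((hQd (s t)).comp t (hsd t)))).congr_deriv ?_
    have e : 1 - (1 - c ^ 2) * Real.sin (s t) ^ 2 = Real.cos (θ t) ^ 2 := by
      rw [Real.cos_sq' (θ t), hsin, hsc]; ring
    rw [hφc, ← hθu, e]
    have := (hp t).ne'
    have := hcosne t
    field_simp
    ring
  intro t
  refine ⟨by rw [hθu, hθu, hsper, huper], ?_⟩
  have h1 := hφs (t + 2 * π)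
  have h2 := hφs t
  rw [hsper, hGper, hQper] at h1
  linarith
end
end
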